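/- arXiv:1806.08849 — 3 statements merged into one kernel-verified Lean document; each statement's English description precedes it below -/
import Mathlib

section
/- For a non-negative integer a, the pair (a, k) is findable for every non-negative integer k if and only if a ≤ 2. -/
/-- A colouring of `ZMod p` (red set `A`, blue its complement) contains an `(a,b)`-AP:
an arithmetic progression with nonzero common difference whose first `a` terms are red
and whose last `b` terms are blue. -/
def HasAP {p : ℕ} (A : Set (ZMod p)) (a b : ℕ) : Prop :=
  ∃ x d : ZMod p, d ≠ 0 ∧
    (∀ i : ℕ, i < a → x + (i : ZMod p) * d ∈ A) ∧
    (∀ i : ℕ, a ≤ i → i < a + b → x + (i : ZMod p) * d ∉ A)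

/-- The pair `(a, b)` is findable: for every `δ > 0` there exists `p₀` such that for every
prime `p ≥ p₀`, every red–blue colouring of `ZMod p` in which each colour class has at
least `δ·p` elements contains an `(a,b)`-AP. -/
def Findable (a b : ℕ) : Prop :=
  ∀ δ : ℝ, 0 < δ → ∃ p₀ : ℕ, ∀ p : ℕ, p.Prime → p₀ ≤ p →
    ∀ A : Set (ZMod p),
      δ * p ≤ Nat.card ↥A → δ * p ≤ Nat.card ↥(Aᶜ) → HasAP A a b

section
namespace DHJ

open scoped Classical in
/-- average of a real function on a finite type -/
noncomputable def avg {X : Type} [Finite X] (f : X → ℝ) : ℝ :=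
  letI := Fintype.ofFinite X
  (∑ x, f x) / (Fintype.card X : ℝ)

/-- real indicator of a proposition -/
noncomputable def ind (P : Prop) : ℝ := by
  classical exact if P then 1 else 0

theorem ind_true {P : Prop} (h : P) : ind P = 1 := by simp [ind, h]
theorem ind_false {P : Prop} (h : ¬ P) : ind P = 0 := by simp [ind, h]
theorem ind_nonneg (P : Prop) : 0 ≤ ind P := by
  by_cases h : P <;> simp [ind, h]
theorem ind_le_one (P : Prop) : ind P ≤ 1 := by
  by_cases h : P <;> simp [ind, h]
theorem ind_mono {P Q : Prop} (h : P → Q) : ind P ≤ ind Q := by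
  by_cases hP : P
  · rw [ind_true hP, ind_true (h hP)]
  · rw [ind_false hP]; exact ind_nonneg _
theorem ind_and (P Q : Prop) : ind (P ∧ Q) = ind P * ind Q := by
  by_cases hP : P <;> by_cases hQ : Q <;> simp [ind, hP, hQ]
theorem ind_not (P : Prop) : ind (¬ P) = 1 - ind P := by
  by_cases hP : P <;> simp [ind, hP]

theorem avg_def {X : Type} [Fintype X] (f : X → ℝ) :
    avg f = (∑ x, f x) / (Fintype.card X : ℝ) := by
  unfold avg
  have h : Fintype.ofFinite X = ‹Fintype X› := Subsingleton.elim _ _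
  rw [h]

section
variable {X Y : Type} [Finite X] [Finite Y]

theorem avg_const [Nonempty X] (c : ℝ) : avg (fun _ : X => c) = c := by
  have := Fintype.ofFinite X
  rw [avg_def]
  simp

theorem avg_mono {f g : X → ℝ} (h : ∀ x, f x ≤ g x) : avg f ≤ avg g := by
  have := Fintype.ofFinite X
  rw [avg_def, avg_def]
  gcongr
  exact h _

theorem avg_nonneg {f : X → ℝ} (h : ∀ x, 0 ≤ f x) : 0 ≤ avg f := by
  have := Fintype.ofFinite X
  rw [avg_def]
  exact div_nonneg (Finset.sum_nonneg fun x _ => h x) (Nat.cast_nonneg _)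

theorem avg_nonpos {f : X → ℝ} (h : ∀ x, f x ≤ 0) : avg f ≤ 0 := by
  have := Fintype.ofFinite X
  rw [avg_def]
  exact div_nonpos_of_nonpos_of_nonneg (Finset.sum_nonpos fun x _ => h x) (Nat.cast_nonneg _)

theorem avg_le_const {f : X → ℝ} {c : ℝ} (hc : 0 ≤ c) (h : ∀ x, f x ≤ c) : avg f ≤ c := by
  cases isEmpty_or_nonempty X
  · have := Fintype.ofFinite X
    rw [avg_def]; simpa
  · exact (avg_mono h).trans (avg_const c).le

theorem avg_add (f g : X → ℝ) : avg (fun x => f x + g x) = avg f + avg g := by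
  have := Fintype.ofFinite X
  simp only [avg_def, Finset.sum_add_distrib, add_div]

theorem avg_sub (f g : X → ℝ) : avg (fun x => f x - g x) = avg f - avg g := by
  have := Fintype.ofFinite X
  simp only [avg_def, Finset.sum_sub_distrib, sub_div]

theorem avg_mul_left (c : ℝ) (f : X → ℝ) : avg (fun x => c * f x) = c * avg f := by
  have := Fintype.ofFinite X
  simp only [avg_def, ← Finset.mul_sum, mul_div_assoc]

theorem avg_sum {S : Type} (s : Finset S) (f : S → X → ℝ) :
    avg (fun x => ∑ i ∈ s, f i x) = ∑ i ∈ s, avg (f i) := by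
  have := Fintype.ofFinite X
  simp only [avg_def]
  rw [Finset.sum_comm, Finset.sum_div]

theorem avg_equiv (e : X ≃ Y) (f : Y → ℝ) : avg (fun x => f (e x)) = avg f := by
  have := Fintype.ofFinite X
  have := Fintype.ofFinite Y
  rw [avg_def, avg_def, Fintype.card_congr e, Equiv.sum_comp e f]

theorem avg_prod (f : X → Y → ℝ) :
    avg (fun z : X × Y => f z.1 z.2) = avg fun x => avg fun y => f x y := by
  have := Fintype.ofFinite X
  have := Fintype.ofFinite Y
  simp only [avg_def, Fintype.card_prod, Fintype.sum_prod_type, ← Finset.sum_div]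
  push_cast
  rw [div_div, mul_comm]

theorem avg_comm (f : X → Y → ℝ) :
    (avg fun x => avg fun y => f x y) = avg fun y => avg fun x => f x y := by
  rw [← avg_prod, ← avg_prod (fun y x => f x y), ← avg_equiv (Equiv.prodComm X Y)]
  rfl

theorem exists_le_of_avg {f : X → ℝ} {c : ℝ} (hc : 0 < c) (h : c ≤ avg f) : ∃ x, c ≤ f x := by
  by_contra hcon
  push Not at hcon
  cases isEmpty_or_nonempty X
  · have := Fintype.ofFinite X
    rw [avg_def] at h
    simp at h; linarith
  · have := Fintype.ofFinite X
    rw [avg_def, le_div_iff₀ (by exact_mod_cast Fintype.card_pos)] at h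
    have h2 : ∑ x, f x < ∑ _x : X, c :=
      Finset.sum_lt_sum_of_nonempty Finset.univ_nonempty (fun x _ => hcon x)
    simp at h2
    linarith

theorem avg_zero : avg (fun _ : X => (0 : ℝ)) = 0 := by
  have := Fintype.ofFinite X
  simp [avg_def]

theorem markov {f : X → ℝ} {δ : ℝ} (hδ : 0 ≤ δ) (h1 : ∀ x, f x ≤ 1) (h : δ ≤ avg f) :
    δ / 2 ≤ avg fun x => ind (δ / 2 ≤ f x) := by
  have h2 : avg f ≤ avg (fun x => ind (δ / 2 ≤ f x) + δ / 2 * 1) := by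
    apply avg_mono
    intro x
    by_cases hx : δ / 2 ≤ f x
    · rw [ind_true hx]; linarith [h1 x]
    · rw [ind_false hx]; linarith
  rw [avg_add] at h2
  have h3 : avg (fun _ : X => δ / 2 * 1) ≤ δ / 2 := avg_le_const (by linarith) (by simp)
  linarith

/-- pigeonhole -/
theorem pigeon {S : Type} [Finite S] {P : X → Prop} {Q : S → X → Prop} {δ : ℝ} (hδ : 0 < δ)
    (h : δ ≤ avg fun x => ind (P x)) (hQ : ∀ x, P x → ∃ s, Q s x) :
    ∃ s, δ / Nat.card S ≤ avg fun x => ind (Q s x) := by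
  have := Fintype.ofFinite S
  have h1 : avg (fun x => ind (P x)) ≤ avg fun x => ∑ s, ind (Q s x) := by
    apply avg_mono
    intro x
    by_cases hx : P x
    · obtain ⟨s, hs⟩ := hQ x hx
      rw [ind_true hx, ← ind_true hs]
      exact Finset.single_le_sum (f := fun s => ind (Q s x)) (fun s _ => ind_nonneg _)
        (Finset.mem_univ s)
    · rw [ind_false hx]; exact Finset.sum_nonneg fun s _ => ind_nonneg _
  rw [avg_sum] at h1
  have h2 : δ / Nat.card S ≤ avg (fun s => avg fun x => ind (Q s x)) := by
    rw [avg_def, Nat.card_eq_fintype_card]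
    gcongr
    linarith
  have hne : Nonempty S := by
    by_contra hne
    rw [not_nonempty_iff] at hne
    simp at h1
    linarith
  refine exists_le_of_avg ?_ h2
  have : 0 < Nat.card S := Nat.card_pos
  positivity

end

/-- density -/
noncomputable def dn {X : Type} [Finite X] (A : Set X) : ℝ := avg fun x => ind (x ∈ A)

theorem dn_nonneg {X : Type} [Finite X] (A : Set X) : 0 ≤ dn A := avg_nonneg fun _ => ind_nonneg _
theorem dn_le_one {X : Type} [Finite X] (A : Set X) : dn A ≤ 1 :=
  avg_le_const zero_le_one fun _ => ind_le_one _

section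
variable {ι κ η β : Type}

theorem avg_elim [Finite ι] [Finite κ] [Finite β] (f : (ι ⊕ κ → β) → ℝ) :
    avg f = avg fun x : ι → β => avg fun y : κ → β => f (Sum.elim x y) := by
  rw [← avg_prod, ← avg_equiv (Equiv.sumArrowEquivProdArrow ι κ β).symm]
  rfl

/-- combinatorial subspace given by a template -/
def sub (σ : ι → β ⊕ η) (a : η → β) : ι → β := fun i => Sum.elim id a (σ i)

/-- every wildcard occurs -/
def Full (σ : ι → β ⊕ η) : Prop := ∀ e, ∃ i, σ i = Sum.inr e

/-- composition of templates -/
def cmp {ζ : Type} (σ : ι → β ⊕ η) (τ : η → β ⊕ ζ) : ι → β ⊕ ζ :=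
  fun i => Sum.elim Sum.inl τ (σ i)

theorem sub_cmp {ζ : Type} (σ : ι → β ⊕ η) (τ : η → β ⊕ ζ) (a : ζ → β) :
    sub (cmp σ τ) a = sub σ (sub τ a) := by
  funext i
  unfold sub cmp
  cases σ i <;> simp

theorem full_cmp {ζ : Type} {σ : ι → β ⊕ η} {τ : η → β ⊕ ζ} (h1 : Full σ) (h2 : Full τ) :
    Full (cmp σ τ) := by
  intro e
  obtain ⟨i, hi⟩ := h2 e
  obtain ⟨j, hj⟩ := h1 i
  exact ⟨j, by simp [cmp, hj, hi]⟩

theorem sub_injective {σ : ι → β ⊕ η} (h : Full σ) : Function.Injective (sub σ) := by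
  intro a b hab
  funext e
  obtain ⟨i, hi⟩ := h e
  have := congrFun hab i
  simpa [sub, hi] using this

theorem sub_elim (σ : ι → β ⊕ η) (τ : κ → β ⊕ η) (a : η → β) :
    sub (Sum.elim σ τ) a = Sum.elim (sub σ a) (sub τ a) := by
  funext i
  cases i <;> rfl

theorem sub_inl (y : ι → β) (a : η → β) : sub (fun i => Sum.inl (y i)) a = y := rfl

theorem sub_elim_inl (σ : ι → β ⊕ η) (y : κ → β) (a : η → β) :
    sub (Sum.elim σ (fun i => Sum.inl (y i))) a = Sum.elim (sub σ a) y := by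
  rw [sub_elim, sub_inl]

theorem sub_inl_elim (σ : κ → β ⊕ η) (y : ι → β) (a : η → β) :
    sub (Sum.elim (fun i => Sum.inl (y i)) σ) a = Sum.elim y (sub σ a) := by
  rw [sub_elim, sub_inl]

theorem full_elim_left {σ : ι → β ⊕ η} (τ : κ → β ⊕ η) (h : Full σ) : Full (Sum.elim σ τ) := by
  intro e
  obtain ⟨i, hi⟩ := h e
  exact ⟨Sum.inl i, hi⟩

theorem full_elim_right (σ : ι → β ⊕ η) {τ : κ → β ⊕ η} (h : Full τ) : Full (Sum.elim σ τ) := by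
  intro e
  obtain ⟨i, hi⟩ := h e
  exact ⟨Sum.inr i, hi⟩

theorem full_comp_equiv {σ : κ → β ⊕ η} (e : ι ≃ κ) (h : Full σ) : Full (fun i => σ (e i)) := by
  intro w
  obtain ⟨i, hi⟩ := h w
  exact ⟨e.symm i, by simpa using hi⟩

theorem avg_reindex [Finite ι] [Finite κ] [Finite β] (e : ι ≃ κ) (f : (ι → β) → ℝ) :
    (avg fun x : κ → β => f (fun i => x (e i))) = avg f :=
  avg_equiv (X := κ → β) (Y := ι → β) (e.symm.arrowCongr (Equiv.refl β)) f

end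

/-- splitting off a block of `n` coordinates -/
theorem exists_split {ι : Type} [Finite ι] {n m : ℕ} (h : n + m ≤ Nat.card ι) :
    ∃ k, m ≤ k ∧ Nonempty (ι ≃ Fin n ⊕ Fin k) := by
  refine ⟨Nat.card ι - n, by omega, ⟨?_⟩⟩
  have e : ι ≃ Fin (Nat.card ι) := Finite.equivFin ι
  exact e.trans ((finCongr (by omega)).trans finSumFinEquiv.symm)

/-- density Hales Jewett at density δ -/
def Dl (δ : ℝ) (β : Type) [Finite β] : Prop :=
  ∃ N, ∀ (ι : Type) [Finite ι], N ≤ Nat.card ι → ∀ A : Set (ι → β), δ ≤ dn A →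
    ∃ σ : ι → β ⊕ Unit, Full σ ∧ ∀ a, sub σ a ∈ A

/-- multidimensional density Hales Jewett -/
def MD (β : Type) [Finite β] : Prop :=
  ∀ m : ℕ, ∀ δ : ℝ, 0 < δ → ∃ N, ∀ (ι : Type) [Finite ι], N ≤ Nat.card ι →
    ∀ A : Set (ι → β), δ ≤ dn A →
    ∃ σ : ι → β ⊕ Fin m, Full σ ∧ ∀ a, sub σ a ∈ A

theorem md_of_dl {β : Type} [Finite β] (h : ∀ δ > 0, Dl δ β) : MD β := by
  intro m
  induction m with
  | zero =>
    intro δ hδ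
    refine ⟨0, fun ι _ _ A hA => ?_⟩
    obtain ⟨x, hx⟩ := exists_le_of_avg hδ hA
    have hxA : x ∈ A := by
      by_contra hxA
      rw [ind_false hxA] at hx; linarith
    exact ⟨fun i => Sum.inl (x i), fun e => e.elim0, fun a => hxA⟩
  | succ m ih =>
    intro δ hδ
    obtain ⟨N1, hN1⟩ := h (δ / 2) (by linarith)
    by_cases hS : Nonempty (Fin N1 → β ⊕ Unit)
    swap
    · refine ⟨N1, fun ι _ hι A hA => ?_⟩
      exfalso
      exact hS ⟨fun _ => Sum.inr ()⟩
    have hSpos : 0 < Nat.card (Fin N1 → β ⊕ Unit) := Nat.card_pos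
    obtain ⟨N2, hN2⟩ := ih (δ / 2 / Nat.card (Fin N1 → β ⊕ Unit)) (by positivity)
    refine ⟨N1 + N2, fun ι _ hι A hA => ?_⟩
    obtain ⟨k, hk, ⟨e⟩⟩ := exists_split hι
    set A' : Set (Fin N1 ⊕ Fin k → β) := {x | (fun i => x (e i)) ∈ A} with hA'
    have hdA' : δ ≤ dn A' := by
      have := avg_reindex e (fun x => ind (x ∈ A))
      unfold dn
      rw [hA']
      simp only [Set.mem_ofPred_eq]
      rw [this]; exact hA
    unfold dn at hdA'
    rw [avg_elim, avg_comm] at hdA'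
    have h1 := markov hδ.le (fun y => avg_le_const zero_le_one (fun x => ind_le_one _)) hdA'
    obtain ⟨σ, hσ⟩ := pigeon (S := Fin N1 → β ⊕ Unit)
      (Q := fun σ y => Full σ ∧ ∀ a, Sum.elim (sub σ a) y ∈ A') (by linarith) h1 (by
        intro y hy
        exact hN1 (Fin N1) (by simp) {x | Sum.elim x y ∈ A'} hy)
    obtain ⟨τ, hτ1, hτ2⟩ := hN2 (Fin k) (by simpa using hk)
      {y | Full σ ∧ ∀ a, Sum.elim (sub σ a) y ∈ A'} hσ
    have hA'ne : 0 < Nat.card (Fin N1 → β ⊕ Unit) := hSpos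
    refine ⟨fun i => (Sum.elim (fun i => (σ i).map id (fun _ => (0 : Fin (m+1))))
      (fun i => (τ i).map id Fin.succ)) (e i), ?_, ?_⟩
    · apply full_comp_equiv (σ := (Sum.elim (fun i => (σ i).map id (fun _ => (0 : Fin (m+1))))
        (fun i => (τ i).map id Fin.succ)))
      intro w
      refine Fin.cases ?_ (fun w => ?_) w
      · by_cases hβ : Nonempty β
        · obtain ⟨b⟩ := hβ
          obtain ⟨i, hi⟩ := (hτ2 (fun _ => b)).1 ()
          exact ⟨Sum.inl i, by simp [hi]⟩
        · rw [not_nonempty_iff] at hβ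
          have : 0 < N1 := by
            by_contra h0
            obtain rfl : N1 = 0 := by omega
            obtain ⟨y, hy⟩ := exists_le_of_avg (c := δ / 2 / Nat.card (Fin 0 → β ⊕ Unit))
              (by positivity) hσ
            have hy' : Full σ ∧ ∀ a, Sum.elim (sub σ a) y ∈ A' := by
              by_contra hc
              rw [ind_false hc] at hy
              have : 0 < δ / 2 / Nat.card (Fin 0 → β ⊕ Unit) := by positivity
              linarith
            obtain ⟨i, _⟩ := hy'.1 ()
            exact i.elim0
          refine ⟨Sum.inl ⟨0, this⟩, ?_⟩
          rcases hh : σ ⟨0, this⟩ with b | u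
          · exact (hβ.false b).elim
          · simp [hh]
      · obtain ⟨i, hi⟩ := hτ1 w
        exact ⟨Sum.inr i, by simp [hi]⟩
    · intro a
      have h2 := (hτ2 (fun i => a i.succ)).2 (fun _ => a 0)
      have h3 : (fun i => Sum.elim (sub σ fun _ => a 0) (sub τ fun i => a i.succ) (e i)) ∈ A := h2
      convert h3 using 1
      funext i
      change Sum.elim id a (Sum.elim (fun i => (σ i).map id (fun _ => (0 : Fin (m+1))))
        (fun i => (τ i).map id Fin.succ) (e i)) = _
      generalize e i = u
      unfold sub
      rcases u with j | j
      · simp only [Sum.elim_inl]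
        cases σ j <;> simp
      · simp only [Sum.elim_inr]
        cases τ j <;> simp

end DHJ
end

section
namespace DHJ

/-- insensitivity between `none` and `some a0` -/
def Ins {ι α : Type} (a0 : α) (E : Set (ι → Option α)) : Prop :=
  ∀ x y : ι → Option α, (∀ i, (x i).getD a0 = (y i).getD a0) → (x ∈ E → y ∈ E)

section
variable {ι α : Type}

/-- replace the non-none entries of `x` by the entries of `z` -/
def rep (x : ι → Option α) (z : ι → α) : ι → Option α := fun i => (x i).map (fun _ => z i)

def swp : Option α × α → Option α × α
  | (none, z) => (none, z)
  | (some a, z) => (some z, a)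

theorem swp_swp (u : Option α × α) : swp (swp u) = u := by
  rcases u with ⟨_ | a, z⟩ <;> rfl

def pairEquiv : (ι → Option α) × (ι → α) ≃ (ι → Option α) × (ι → α) where
  toFun u := (fun i => (swp (u.1 i, u.2 i)).1, fun i => (swp (u.1 i, u.2 i)).2)
  invFun u := (fun i => (swp (u.1 i, u.2 i)).1, fun i => (swp (u.1 i, u.2 i)).2)
  left_inv u := by
    simp only [Prod.mk.eta, swp_swp]
  right_inv u := by
    simp only [Prod.mk.eta, swp_swp]

theorem avg_rep [Finite ι] [Finite α] [Nonempty α] (f : (ι → Option α) → ℝ) :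
    avg f = avg fun x : ι → Option α => avg fun z : ι → α => f (rep x z) := by
  have h1 : avg f = avg fun x : ι → Option α => avg fun _ : ι → α => f x := by
    congr 1; funext x; rw [avg_const]
  rw [h1, ← avg_prod, ← avg_prod (fun x z => f (rep x z)), ← avg_equiv pairEquiv]
  congr 1
  funext u
  simp only [pairEquiv, Equiv.coe_fn_mk]
  congr 1
  funext i
  unfold rep swp
  rcases u.1 i with _ | a <;> rfl

theorem avg_pi_prod [Finite ι] {β : Type} [Finite β] (g : β → ℝ) [Fintype ι] :
    avg (fun x : ι → β => ∏ i, g (x i)) = (avg g) ^ Fintype.card ι := by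
  classical
  have := Fintype.ofFinite β
  rw [avg_def, avg_def, div_pow, Fintype.card_fun]
  push_cast
  congr 1
  rw [← Fintype.piFinset_univ, ← Finset.prod_univ_sum]
  simp

theorem avg_option [Finite α] (g : Option α → ℝ) (hg0 : g none = 1) (hg : ∀ a, g (some a) = 1 / 2)
    [Nonempty α] : avg g ≤ 3 / 4 := by
  have := Fintype.ofFinite α
  rw [avg_def, div_le_iff₀ (by positivity), Fintype.sum_option, Fintype.card_option, hg0]
  simp only [hg]
  simp
  have : (1 : ℝ) ≤ Fintype.card α := by exact_mod_cast Fintype.card_pos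
  linarith

theorem few_small [Finite ι] [Finite α] [Nonempty α] (N : ℕ) :
    (avg fun x : ι → Option α => ind (Nat.card {i // x i ≠ none} < N)) ≤
      2 ^ N * (3 / 4) ^ Nat.card ι := by
  classical
  have := Fintype.ofFinite ι
  set g : Option α → ℝ := fun o => if o = none then 1 else 1 / 2 with hg
  have h1 : (avg fun x : ι → Option α => ind (Nat.card {i // x i ≠ none} < N)) ≤
      avg fun x : ι → Option α => 2 ^ N * ∏ i, g (x i) := by
    apply avg_mono
    intro x
    have h2 : ∏ i, g (x i) = (1 / 2) ^ (Nat.card {i // x i ≠ none}) := by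
      rw [Nat.card_eq_fintype_card, Fintype.card_subtype, ← Finset.prod_const, Finset.prod_filter]
      apply Finset.prod_congr rfl
      intro i _
      simp only [hg]
      by_cases h : x i = none <;> simp [h]
    rw [h2]
    by_cases hN : Nat.card {i // x i ≠ none} < N
    · rw [ind_true hN]
      obtain ⟨k, hk⟩ := Nat.exists_eq_add_of_lt hN
      generalize Nat.card {i // x i ≠ none} = c at hk
      rw [hk, add_assoc, pow_add, mul_right_comm, ← mul_pow]
      norm_num
      exact one_le_pow₀ (by norm_num)
    · rw [ind_false hN]; positivity
  rw [avg_mul_left, avg_pi_prod] at h1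
  refine h1.trans ?_
  rw [Nat.card_eq_fintype_card]
  gcongr
  · apply avg_nonneg
    intro o; simp only [hg]; split_ifs <;> norm_num
  · exact avg_option g (by simp [hg]) (by simp [hg])

end

theorem ins_subspace {α : Type} [Finite α] [Nonempty α] (h : MD α) (m : ℕ) (ε : ℝ) (hε : 0 < ε) :
    ∃ N, ∀ (ι : Type) [Finite ι], N ≤ Nat.card ι → ∀ (a0 : α) (E : Set (ι → Option α)),
      Ins a0 E → ε ≤ dn E → ∃ σ : ι → Option α ⊕ Fin m, Full σ ∧ ∀ a, sub σ a ∈ E := by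
  classical
  obtain ⟨N0, hN0⟩ := h m (ε / 2) (by linarith)
  obtain ⟨N, hN⟩ : ∃ N : ℕ, ∀ n ≥ N, (2 : ℝ) ^ N0 * (3 / 4) ^ n ≤ ε / 2 := by
    obtain ⟨N, hN⟩ := exists_pow_lt_of_lt_one (x := ε / 2 / 2 ^ N0) (y := (3 / 4 : ℝ))
      (by positivity) (by norm_num)
    refine ⟨N, fun n hn => ?_⟩
    rw [lt_div_iff₀ (by positivity)] at hN
    have : (3 / 4 : ℝ) ^ n ≤ (3 / 4) ^ N := pow_le_pow_of_le_one (by norm_num) (by norm_num) hn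
    nlinarith [show (0:ℝ) < 2 ^ N0 by positivity]
  refine ⟨N, fun ι _ hι a0 E hE hd => ?_⟩
  have h1 := few_small (ι := ι) (α := α) N0
  have h2 := hN _ hι
  unfold dn at hd
  rw [avg_rep] at hd
  obtain ⟨x, hx⟩ := exists_le_of_avg (f := fun x : ι → Option α =>
    (avg fun z => ind (rep x z ∈ E)) - ind (Nat.card {i // x i ≠ none} < N0)) (c := ε / 2)
    (by linarith) (by rw [avg_sub]; linarith)
  have hle : (avg fun z => ind (rep x z ∈ E)) ≤ 1 := avg_le_const zero_le_one fun _ => ind_le_one _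
  have hfew : N0 ≤ Nat.card {i // x i ≠ none} := by
    by_contra hc
    rw [ind_true (by omega)] at hx
    linarith
  rw [ind_false (by omega), sub_zero] at hx
  -- restrict to the non-none coordinates
  let p : ι → Prop := fun i => x i ≠ none
  let ext : ({i // p i} → α) → ι → Option α := fun z i => if hi : p i then some (z ⟨i, hi⟩) else none
  have h3 : (avg fun z => ind (rep x z ∈ E)) = avg fun z : {i // p i} → α => ind (ext z ∈ E) := by
    rw [← avg_equiv (Equiv.piEquivPiSubtypeProd p (fun _ => α)).symm]
    rw [avg_prod (fun z1 z2 => ind (rep x ((Equiv.piEquivPiSubtypeProd p (fun _ => α)).symm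
      (z1, z2)) ∈ E))]
    congr 1
    funext z
    have : ∀ z2, rep x ((Equiv.piEquivPiSubtypeProd p (fun _ => α)).symm (z, z2)) = ext z := by
      intro z2
      funext i
      unfold rep
      simp only [ext, Equiv.piEquivPiSubtypeProd_symm_apply]
      by_cases hi : p i
      · simp only [hi, dif_pos]
        obtain ⟨a, ha⟩ := Option.ne_none_iff_exists'.1 hi
        simp [ha]
      · simp only [hi, dif_neg, not_false_eq_true]
        have : x i = none := by simpa [p] using hi
        simp [this]
    simp only [this]
    rw [avg_const]
  rw [h3] at hx
  obtain ⟨τ, hτ1, hτ2⟩ := hN0 {i // p i} hfew {z | ext z ∈ E} hx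
  refine ⟨fun i => if hi : p i then (τ ⟨i, hi⟩).map some id else Sum.inl none, ?_, ?_⟩
  · intro w
    obtain ⟨⟨i, hi⟩, hw⟩ := hτ1 w
    exact ⟨i, by simp [hi, hw]⟩
  · intro a
    refine hE _ _ ?_ (hτ2 (fun w => (a w).getD a0))
    intro i
    simp only [ext, sub]
    by_cases hi : p i
    · simp only [hi, dif_pos]
      rcases τ ⟨i, hi⟩ with b | w <;> simp
    · simp [hi]

end DHJ
end

section
namespace DHJ

theorem avg_image_nonpos {A W : Type} [Finite A] [Finite W] {g : A → W}
    (hg : Function.Injective g) (F : W → ℝ) (h : avg (fun a => F (g a)) ≤ 0) :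
    avg (fun w => ind (∃ a, g a = w) * F w) ≤ 0 := by
  classical
  have := Fintype.ofFinite A
  have := Fintype.ofFinite W
  rw [avg_def] at h ⊢
  have h1 : ∑ w, ind (∃ a, g a = w) * F w = ∑ a, F (g a) := by
    rw [← Finset.sum_image (f := F) (s := Finset.univ) (g := g) (fun a _ b _ hab => hg hab)]
    symm
    rw [← Finset.sum_subset (Finset.subset_univ (Finset.univ.image g))
      (f := fun w => ind (∃ a, g a = w) * F w)]
    · apply Finset.sum_congr rfl
      intro w hw
      rw [ind_true (by simpa using hw), one_mul]
    · intro w _ hw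
      rw [ind_false (by simpa using hw), zero_mul]
  rw [h1]
  apply div_nonpos_of_nonpos_of_nonneg _ (Nat.cast_nonneg _)
  by_contra hc
  push Not at hc
  cases isEmpty_or_nonempty A
  · simp at hc
  · have : (0 : ℝ) < Fintype.card A := by exact_mod_cast Fintype.card_pos
    have := div_pos hc this
    linarith

theorem avg_ind_ge {W : Type} [Finite W] {P : W → Prop} (h : ∃ w, P w) :
    1 / (Nat.card W : ℝ) ≤ avg fun w => ind (P w) := by
  have := Fintype.ofFinite W
  obtain ⟨w, hw⟩ := h
  rw [avg_def, Nat.card_eq_fintype_card]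
  gcongr
  rw [← ind_true hw]
  exact Finset.single_le_sum (f := fun w => ind (P w)) (fun s _ => ind_nonneg _)
        (Finset.mem_univ w)

theorem avg_mul_right {X : Type} [Finite X] (c : ℝ) (f : X → ℝ) :
    avg (fun x => f x * c) = avg f * c := by
  simp only [mul_comm _ c, avg_mul_left]

theorem part_step {α I κ X : Type} [Finite α] [Nonempty α] [Finite I] [Finite κ] [Finite X]
    (m : ℕ) (ε : ℝ) (hε : 0 < ε) (a0 : α)
    (hI : ∀ E : Set (I → Option α), Ins a0 E → ε / 2 ≤ dn E →
      ∃ σ : I → Option α ⊕ Fin m, Full σ ∧ ∀ a, sub σ a ∈ E)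
    (E : X → Set (I ⊕ κ → Option α)) (hE : ∀ x, Ins a0 (E x))
    (f : X → (I ⊕ κ → Option α) → ℝ)
    (hf : ∀ x, ∀ σ : I ⊕ κ → Option α ⊕ Fin m, Full σ → (∀ a, sub σ a ∈ E x) →
      avg (fun a => f x (sub σ a)) ≤ 0)
    (hd : ε ≤ avg fun x => avg fun u => ind (u ∈ E x)) :
    ∃ E' : X × (I → Option α) → Set (κ → Option α),
      (∀ z, Ins a0 (E' z)) ∧
      (∀ z, ∀ σ : κ → Option α ⊕ Fin m, Full σ → (∀ a, sub σ a ∈ E' z) →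
        avg (fun a => f z.1 (Sum.elim z.2 (sub σ a))) ≤ 0) ∧
      (avg fun x => avg fun u => ind (u ∈ E x) * f x u) ≤
        (avg fun z => avg fun y => ind (y ∈ E' z) * f z.1 (Sum.elim z.2 y)) ∧
      (avg fun z => avg fun y => ind (y ∈ E' z)) ≤ (avg fun x => avg fun u => ind (u ∈ E x)) -
        1 / (Nat.card (I → Option α)) * (ε / 2 / Nat.card (I → Option α ⊕ Fin m)) := by
  classical
  set Y : (I → Option α ⊕ Fin m) → X → (κ → Option α) → Prop := fun σ x y =>
    Full σ ∧ ∀ a, Sum.elim (sub σ a) y ∈ E x with hY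
  set q : X → ℝ := fun x => avg fun y => ind (ε / 2 ≤ dn {w | Sum.elim w y ∈ E x}) with hq
  have hσ : ∀ x, ∃ σ : I → Option α ⊕ Fin m, q x / Nat.card (I → Option α ⊕ Fin m) ≤
      avg fun y => ind (Y σ x y) := by
    intro x
    by_cases hq0 : 0 < q x
    · apply pigeon (P := fun y => ε / 2 ≤ dn {w | Sum.elim w y ∈ E x}) hq0 le_rfl
      intro y hy
      refine hI _ ?_ hy
      intro u v huv hu
      refine hE x _ _ ?_ hu
      intro i
      rcases i with i | i
      · exact huv i
      · rfl
    · refine ⟨fun _ => Sum.inl none, ?_⟩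
      have : q x = 0 := le_antisymm (not_lt.1 hq0) (avg_nonneg fun _ => ind_nonneg _)
      rw [this, zero_div]
      exact avg_nonneg fun _ => ind_nonneg _
  choose σ hσ using hσ
  set R : X → (I → Option α) → (κ → Option α) → Prop := fun x w y =>
    (∃ a, sub (σ x) a = w) ∧ Y (σ x) x y with hR
  have hRE : ∀ x w y, R x w y → Sum.elim w y ∈ E x := by
    rintro x w y ⟨⟨a, rfl⟩, h⟩
    exact h.2 a
  refine ⟨fun z => {y | Sum.elim z.2 y ∈ E z.1 ∧ ¬ R z.1 z.2 y}, ?_, ?_, ?_, ?_⟩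
  · rintro ⟨x, w⟩ u v huv ⟨h1, h2⟩
    have key : ∀ (w : I → Option α) (u v : κ → Option α), (∀ i, (u i).getD a0 = (v i).getD a0) →
        Sum.elim w u ∈ E x → Sum.elim w v ∈ E x := by
      intro w u v huv hu
      refine hE x _ _ ?_ hu
      intro i
      rcases i with i | i
      · rfl
      · exact huv i
    refine ⟨key _ _ _ huv h1, fun h3 => h2 ⟨h3.1, h3.2.1, fun a => ?_⟩⟩
    exact key _ _ _ (fun i => (huv i).symm) (h3.2.2 a)
  · rintro ⟨x, w⟩ τ hτ h
    have := hf x (Sum.elim (fun i => Sum.inl (w i)) τ) (full_elim_right _ hτ) (by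
      intro a
      rw [sub_inl_elim]
      exact (h a).1)
    simpa only [sub_inl_elim] using this
  · have h1 : (avg fun x => avg fun u => ind (u ∈ E x) * f x u) =
        (avg fun x => avg fun w => avg fun y =>
          ind (Sum.elim w y ∈ E x ∧ ¬ R x w y) * f x (Sum.elim w y)) +
        avg fun x => avg fun w => avg fun y => ind (R x w y) * f x (Sum.elim w y) := by
      simp only [← avg_add, avg_elim]
      congr 1; funext x; congr 1; funext w; congr 1; funext y
      by_cases h1 : R x w y
      · simp [ind, h1, hRE x w y h1]
      · simp [ind, h1]
    rw [h1]
    have h2 : (avg fun x => avg fun w => avg fun y => ind (R x w y) * f x (Sum.elim w y)) ≤ 0 := by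
      apply avg_nonpos
      intro x
      rw [avg_comm]
      apply avg_nonpos
      intro y
      by_cases hYy : Y (σ x) x y
      · have h3 := avg_image_nonpos (sub_injective hYy.1) (fun w => f x (Sum.elim w y)) (by
          have := hf x (Sum.elim (σ x) (fun i => Sum.inl (y i))) (full_elim_left _ hYy.1) (by
            intro a
            rw [sub_elim_inl]
            exact hYy.2 a)
          simpa only [sub_elim_inl] using this)
        simpa only [hR, hYy, and_true] using h3
      · simp only [hR, hYy, and_false]
        simp only [ind_false not_false, zero_mul]
        rw [avg_zero]
    have h3 := avg_prod (fun (x : X) (w : I → Option α) => avg fun y : κ → Option α =>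
      ind (Sum.elim w y ∈ E x ∧ ¬ R x w y) * f x (Sum.elim w y))
    rw [← h3]
    simp only [Set.mem_ofPred_eq]
    linarith
  · have h1 : (avg fun x => avg fun u => ind (u ∈ E x)) =
        (avg fun x => avg fun w => avg fun y =>
          ind (Sum.elim w y ∈ E x ∧ ¬ R x w y)) +
        avg fun x => avg fun w => avg fun y => ind (R x w y) := by
      simp only [← avg_add, avg_elim]
      congr 1; funext x; congr 1; funext w; congr 1; funext y
      by_cases h1 : R x w y
      · simp [ind, h1, hRE x w y h1]
      · simp [ind, h1]
    have h3 := avg_prod (fun (x : X) (w : I → Option α) => avg fun y : κ → Option α =>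
      ind (Sum.elim w y ∈ E x ∧ ¬ R x w y))
    simp only [Set.mem_ofPred_eq]
    rw [h3, h1]
    have h4 : (avg fun x => avg fun w => avg fun y => ind (R x w y)) =
        avg fun x => (avg fun w => ind (∃ a, sub (σ x) a = w)) * avg fun y => ind (Y (σ x) x y) := by
      congr 1; funext x
      rw [← avg_mul_right]
      congr 1; funext w
      rw [← avg_mul_left]
      congr 1; funext y
      rw [← ind_and]
    have h5 : ε / 2 ≤ avg q := by
      have e1 : (avg fun x => avg fun u => ind (u ∈ E x)) =
          avg fun z : X × (κ → Option α) => dn {w | Sum.elim w z.2 ∈ E z.1} := by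
        rw [avg_prod (fun (x : X) (y : κ → Option α) => dn {w | Sum.elim w y ∈ E x})]
        congr 1; funext x
        rw [avg_elim, avg_comm]; rfl
      rw [e1] at hd
      have := markov hε.le (fun z => dn_le_one _) hd
      rwa [avg_prod (fun (x : X) (y : κ → Option α) =>
        ind (ε / 2 ≤ dn {w | Sum.elim w y ∈ E x}))] at this
    have h6 : (avg fun x => 1 / (Nat.card (I → Option α) : ℝ) *
        (1 / Nat.card (I → Option α ⊕ Fin m) * q x)) ≤
        avg fun x => avg fun w => avg fun y => ind (R x w y) := by
      rw [h4]
      apply avg_mono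
      intro x
      have e1 := hσ x
      rw [div_eq_mul_one_div, mul_comm] at e1
      have e2 := avg_ind_ge (P := fun w => ∃ a, sub (σ x) a = w) ⟨_, fun _ => none, rfl⟩
      apply mul_le_mul e2 e1
      · apply mul_nonneg (by positivity)
        exact avg_nonneg fun _ => ind_nonneg _
      · exact avg_nonneg fun _ => ind_nonneg _
    rw [avg_mul_left, avg_mul_left] at h6
    have h7 : 1 / (Nat.card (I → Option α) : ℝ) * (ε / 2 / Nat.card (I → Option α ⊕ Fin m)) ≤
      1 / (Nat.card (I → Option α) : ℝ) * (1 / Nat.card (I → Option α ⊕ Fin m) * avg q) := by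
      rw [div_eq_mul_one_div (ε / 2), mul_comm (ε / 2)]
      gcongr
    linarith

theorem part_iter {α : Type} [Finite α] [Nonempty α] (h : MD α) (m : ℕ) (ε : ℝ) (hε : 0 < ε) :
    ∃ c : ℝ, 0 < c ∧ ∀ t : ℕ, ∃ N, ∀ (ι : Type) [Finite ι], N ≤ Nat.card ι → ∀ (X : Type) [Finite X]
      (a0 : α) (E : X → Set (ι → Option α)), (∀ x, Ins a0 (E x)) → ∀ f : X → (ι → Option α) → ℝ,
      (∀ x y, f x y ≤ 1) →
      (∀ x, ∀ σ : ι → Option α ⊕ Fin m, Full σ → (∀ a, sub σ a ∈ E x) →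
      avg (fun a => f x (sub σ a)) ≤ 0) →
      (avg fun x => avg fun u => ind (u ∈ E x) * f x u) ≤ ε ∨
      (avg fun x => avg fun u => ind (u ∈ E x) * f x u) ≤
        (avg fun x => avg fun u => ind (u ∈ E x)) - t * c := by
  obtain ⟨N0, hN0⟩ := ins_subspace h m (ε / 2) (by linarith)
  have hpos1 : 0 < Nat.card (Fin N0 → Option α) := Nat.card_pos
  have hpos2 : 0 < Nat.card (Fin N0 → Option α ⊕ Fin m) := Nat.card_pos
  refine ⟨1 / (Nat.card (Fin N0 → Option α)) * (ε / 2 / Nat.card (Fin N0 → Option α ⊕ Fin m)),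
    by positivity, ?_⟩
  have triv : ∀ (ι : Type) [Finite ι] (X : Type) [Finite X] (E : X → Set (ι → Option α))
      (f : X → (ι → Option α) → ℝ), (∀ x y, f x y ≤ 1) →
      (avg fun x => avg fun u => ind (u ∈ E x) * f x u) ≤
        (avg fun x => avg fun u => ind (u ∈ E x)) := by
    intro ι _ X _ E f hf
    apply avg_mono; intro x; apply avg_mono; intro y
    nlinarith [hf x y, ind_nonneg (y ∈ E x)]
  intro t
  induction t with
  | zero =>
    refine ⟨0, fun ι _ _ X _ a0 E hE f hf _ => Or.inr ?_⟩
    simpa using triv ι X E f hf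
  | succ t ih =>
    obtain ⟨N1, hN1⟩ := ih
    refine ⟨N0 + N1, fun ι _ hι X _ a0 E hE f hf hh => ?_⟩
    by_cases hd : (avg fun x => avg fun u => ind (u ∈ E x)) ≤ ε
    · exact Or.inl ((triv ι X E f hf).trans hd)
    push Not at hd
    obtain ⟨k, hk, ⟨e⟩⟩ := exists_split hι
    have r1 : ∀ g : X → (ι → Option α) → ℝ, (avg fun x => avg fun u => g x u) =
        avg fun x => avg fun u : Fin N0 ⊕ Fin k → Option α => g x (fun i => u (e i)) := by
      intro g
      congr 1; funext x
      exact (avg_reindex e (g x)).symm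
    rw [r1 (fun x u => ind (u ∈ E x))] at hd ⊢
    rw [r1 (fun x u => ind (u ∈ E x) * f x u)]
    obtain ⟨E', p1, p2, p3, p4⟩ := part_step (I := Fin N0) (κ := Fin k) m ε hε a0
      (fun E => hN0 (Fin N0) (by simp) a0 E)
      (fun x => {u | (fun i => u (e i)) ∈ E x}) (by
        intro x u v huv hu
        exact hE x _ _ (fun i => huv (e i)) hu) (fun x u => f x (fun i => u (e i))) (by
        intro x σ hσ h
        exact hh x (fun i => σ (e i)) (full_comp_equiv e hσ) h) hd.le
    have := hN1 (Fin k) (by simpa using hk) (X × (Fin N0 → Option α)) a0 E' p1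
      (fun z y => f z.1 (fun i => Sum.elim z.2 y (e i))) (fun _ _ => hf _ _) p2
    simp only [Set.mem_ofPred_eq] at p3 p4
    rcases this with this | this
    · left; exact p3.trans this
    · right
      refine (p3.trans this).trans ?_
      push_cast
      linarith

theorem ins_avg {α : Type} [Finite α] [Nonempty α] (h : MD α) (m : ℕ) (ε : ℝ) (hε : 0 < ε) :
    ∃ N, ∀ (ι : Type) [Finite ι], N ≤ Nat.card ι → ∀ 
      (a0 : α) (E : Set (ι → Option α)), Ins a0 E → ∀ f : (ι → Option α) → ℝ,
      (∀ y, f y ≤ 1) →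
      (∀ σ : ι → Option α ⊕ Fin m, Full σ → (∀ a, sub σ a ∈ E) →
      avg (fun a => f (sub σ a)) ≤ 0) →
      (avg fun u => ind (u ∈ E) * f u) ≤ ε := by
  obtain ⟨c, hc, H⟩ := part_iter h m ε hε
  obtain ⟨t, ht⟩ := exists_nat_gt (1 / c)
  obtain ⟨N, hN⟩ := H t
  refine ⟨N, fun ι _ hι a0 E hE f hf hh => ?_⟩
  have := hN ι hι Unit a0 (fun _ => E) (fun _ => hE) (fun _ => f) (fun _ => hf) (fun _ => hh)
  rw [avg_const, avg_const] at this
  rcases this with this | this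
  · exact this
  · have h1 : (avg fun u => ind (u ∈ E)) ≤ 1 := dn_le_one E
    rw [div_lt_iff₀ hc] at ht
    linarith

/-- several insensitive sets -/
theorem multi_ins_avg {α : Type} [Finite α] [Nonempty α] (h : MD α) (r : ℕ) :
    ∀ (m : ℕ) (ε : ℝ), 0 < ε →
    ∃ N, ∀ (ι : Type) [Finite ι], N ≤ Nat.card ι → ∀ 
      (a0 : Fin r → α) (E : Fin r → Set (ι → Option α)), (∀ j, Ins (a0 j) (E j)) →
      ∀ f : (ι → Option α) → ℝ, (∀ y, f y ≤ 1) →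
      (∀ σ : ι → Option α ⊕ Fin m, Full σ → (∀ a j, sub σ a ∈ E j) →
      avg (fun a => f (sub σ a)) ≤ 0) →
      (avg fun u => ind (∀ j, u ∈ E j) * f u) ≤ ε := by
  induction r with
  | zero =>
    intro m ε hε
    refine ⟨m, fun ι _ hι a0 E hE f hf hh => ?_⟩
    obtain ⟨k, hk, ⟨e⟩⟩ := exists_split (m := 0) hι
    rw [← avg_reindex e, avg_elim, avg_comm]
    refine le_trans ?_ hε.le
    apply avg_nonpos
    intro y
    have := hh (fun i => (Sum.elim Sum.inr (fun i => Sum.inl (y i)) : Fin m ⊕ Fin k → _) (e i))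
      (full_comp_equiv e (full_elim_left _ fun w => ⟨w, rfl⟩)) (fun _ j => j.elim0)
    refine le_trans (le_of_eq ?_) this
    congr 1
    funext a
    rw [ind_true (fun j => j.elim0), one_mul]
    congr 1
    funext i
    change _ = Sum.elim id a (Sum.elim Sum.inr (fun i => Sum.inl (y i)) (e i))
    rcases e i with j | j <;> rfl
  | succ r ih =>
    intro m ε hε
    obtain ⟨m1, hm1⟩ := ih m (ε / 2) (by linarith)
    obtain ⟨N, hN⟩ := ins_avg h m1 (ε / 2) (by linarith)
    refine ⟨N, fun ι _ hι a0 E hE f hf hh => ?_⟩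
    set g : (ι → Option α) → ℝ := fun u => ind (∀ j : Fin r, u ∈ E j.succ) * f u - ε / 2 with hg
    have hg1 : ∀ y, ind (∀ j : Fin r, y ∈ E j.succ) * f y ≤ 1 := by
      intro y
      by_cases hP : ∀ j : Fin r, y ∈ E j.succ
      · rw [ind_true hP, one_mul]; exact hf y
      · rw [ind_false hP, zero_mul]; norm_num
    have key := hN ι hι (a0 0) (E 0) (hE 0) g (by
      intro y
      have := hg1 y
      simp only [hg]; linarith) (by
      intro σ hσ hσE
      have := hm1 (Fin m1) (by simp) (fun j => a0 j.succ) (fun j => {a | sub σ a ∈ E j.succ}) (by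
        intro j a b hab ha
        refine hE j.succ _ _ ?_ ha
        intro i
        unfold sub
        rcases σ i with c | c
        · rfl
        · exact hab c) (fun a => f (sub σ a)) (fun _ => hf _) (by
        intro τ hτ hτE
        have := hh (cmp σ τ) (full_cmp hσ hτ) (by
          intro a j
          rw [sub_cmp]
          refine Fin.cases ?_ (fun j => ?_) j
          · exact hσE _
          · exact hτE a j)
        simpa only [sub_cmp] using this)
      simp only [hg]
      rw [avg_sub, avg_const]
      simp only [Set.mem_ofPred_eq] at this
      linarith)
    have e1 : (avg fun u => ind (∀ j, u ∈ E j) * f u) =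
        (avg fun u => ind (u ∈ E 0) * g u) + ε / 2 * dn (E 0) := by
      unfold dn
      rw [← avg_mul_left, ← avg_add]
      congr 1
      funext u
      simp only [hg]
      rw [Fin.forall_fin_succ, ind_and]
      ring
    rw [e1]
    have := dn_le_one (E 0)
    nlinarith

end DHJ
end

section
namespace DHJ

theorem ramsey_good {α : Type} [Finite α] [Nonempty α] (m l : ℕ) :
    ∀ (C : Type) [Finite C], ∃ (I : Type) (_ : Finite I), ∀ Good : C → (I → Option α) → Prop,
      (∃ c, ∃ σ : I → Option α ⊕ Fin m, Full σ ∧ (∃ i, σ i = Sum.inl none) ∧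
        ∀ a, Good c (sub σ a)) ∨
      ∃ V : I → α ⊕ Fin l, ∀ c, ∀ b : Fin l → Option α, (∃ e, b e = none) →
        ¬ Good c (sub (fun i => (V i).map some id) b) := by
  induction l with
  | zero =>
    intro C _
    refine ⟨Empty, inferInstance, fun Good => Or.inr ⟨fun i => i.elim, ?_⟩⟩
    rintro c b ⟨e, _⟩
    exact e.elim0
  | succ l ih =>
    intro C _
    obtain ⟨I1, _, hI1⟩ := ih (C × α)
    obtain ⟨a0⟩ := ‹Nonempty α›
    obtain ⟨J, hJ, hJ1⟩ := Combinatorics.Subspace.exists_mono_in_high_dimension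
      (Option α) (Set C) (I1 ⊕ Fin m)
    refine ⟨Unit ⊕ J, inferInstance, fun Good => ?_⟩
    obtain ⟨Z, K, hK⟩ := hJ1 (fun z => {c | Good c (Sum.elim (fun _ => none) z)})
    have hK' : ∀ x c, Good c (Sum.elim (fun _ => none) (sub Z.idxFun x)) ↔ c ∈ K := by
      intro x c
      rw [← hK x]
      rfl
    by_cases hne : ∃ c, c ∈ K
    · obtain ⟨c, hc⟩ := hne
      left
      refine ⟨c, Sum.elim (fun _ => Sum.inl none)
        (cmp Z.idxFun (Sum.elim (fun _ => Sum.inl none) Sum.inr)), ?_, ⟨Sum.inl (), rfl⟩, ?_⟩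
      · intro w
        obtain ⟨j, hj⟩ := Z.proper (Sum.inr w)
        exact ⟨Sum.inr j, by simp [cmp, hj]⟩
      · intro a
        rw [sub_inl_elim (y := fun _ => none), sub_cmp, hK']
        exact hc
    · push Not at hne
      -- the specialised templates
      let Zi : α → J → Option α ⊕ I1 := fun i j =>
        Sum.elim (fun o => Sum.inl (some (o.getD i)))
          (Sum.elim (fun e => Sum.inr e) (fun _ => Sum.inl (some a0))) (Z.idxFun j)
      rcases hI1 (fun ci a => Good ci.1 (Sum.elim (fun _ => some ci.2) (sub (Zi ci.2) a))) with
        ⟨⟨c, i⟩, σ, hσ1, ⟨i1, hi1⟩, hσ2⟩ | ⟨U, hU⟩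
      · left
        refine ⟨c, Sum.elim (fun _ => Sum.inl (some i)) (cmp (Zi i) σ), ?_, ?_, ?_⟩
        · intro w
          obtain ⟨i2, hi2⟩ := hσ1 w
          obtain ⟨j, hj⟩ := Z.proper (Sum.inl i2)
          exact ⟨Sum.inr j, by simp [cmp, Zi, hj, hi2]⟩
        · obtain ⟨j, hj⟩ := Z.proper (Sum.inl i1)
          exact ⟨Sum.inr j, by simp [cmp, Zi, hj, hi1]⟩
        · intro a
          rw [sub_inl_elim (y := fun _ => some i), sub_cmp]
          exact hσ2 a
      · right
        refine ⟨Sum.elim (fun _ => Sum.inr 0) (fun j =>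
          Sum.elim (fun o => Option.elim o (Sum.inr 0) Sum.inl)
          (Sum.elim (fun e => (U e).map id Fin.succ) (fun _ => Sum.inl a0)) (Z.idxFun j)), ?_⟩
        intro c b hb
        rcases hb0 : b 0 with _ | i
        · have h1 := (hK' (Sum.elim (sub (fun i => (U i).map some id) (fun e => b e.succ))
            (fun _ => some a0)) c).not.2 (hne c)
          convert h1 using 2
          funext j
          rcases j with j | j
          · simp [sub, hb0]
          · simp only [sub, Sum.elim_inr]
            rcases Z.idxFun j with (_ | o) | (e | e)
            · simp [hb0]
            · simp
            · rcases hh : U e with u | u <;> simp [hh, sub]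
            · simp
        · obtain ⟨e, he⟩ := hb
          have he2 : ∃ e' : Fin l, b e'.succ = none := by
            revert he
            refine Fin.cases ?_ (fun e' => ?_) e
            · intro h; rw [hb0] at h; cases h
            · intro h; exact ⟨e', h⟩
          have h1 := hU (c, i) (fun e => b e.succ) he2
          convert h1 using 2
          funext j
          rcases j with j | j
          · simp [sub, hb0]
          · simp only [sub, Sum.elim_inr, Zi]
            rcases Z.idxFun j with (_ | o) | (e | e)
            · simp [hb0]
            · simp
            · rcases hh : U e with u | u <;> simp [hh, sub]
            · simp

end DHJ
end

section
namespace DHJ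

theorem ind_exists_first {k : ℕ} (P : Fin k → Prop) :
    ind (∃ i, ¬ P i) = ∑ s : Fin k, ind ((∀ j, j < s → P j) ∧ ¬ P s) := by
  by_cases h : ∃ i, ¬ P i
  · obtain ⟨s, hs, hmin⟩ := WellFounded.has_min (wellFounded_lt (α := Fin k)) {i | ¬ P i} h
    have hs' : (∀ j, j < s → P j) ∧ ¬ P s :=
      ⟨fun j hj => by by_contra hc; exact hmin j hc hj, hs⟩
    rw [ind_true h, Finset.sum_eq_single s, ind_true hs']
    · intro t _ hts
      apply ind_false
      rintro ⟨h1, h2⟩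
      rcases lt_trichotomy t s with h3 | h3 | h3
      · exact h2 (hs'.1 t h3)
      · exact hts h3
      · exact hs'.2 (h1 s h3)
    · simp
  · rw [ind_false h, Finset.sum_eq_zero]
    intro s _
    apply ind_false
    rintro ⟨_, h2⟩
    exact h ⟨s, h2⟩

theorem per_y {α : Type} [Finite α] [Nonempty α] (h : MD α) (m : ℕ) (ε : ℝ) (hε : 0 < ε) :
    ∃ N, ∀ (ι : Type) [Finite ι], N ≤ Nat.card ι → ∀ (D : α → Set (ι → Option α)),
      (∀ i, Ins i (D i)) → ∀ (B : Set (ι → Option α)), (∀ u ∈ B, ∃ i, u ∉ D i) → ∀ s : ℝ, 0 ≤ s →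
      (∀ σ : ι → Option α ⊕ Fin m, Full σ → dn {a | sub σ a ∈ B} ≤ s) →
      dn B ≤ ε + s * (1 - dn {u | ∀ i, u ∈ D i}) := by
  have hk : 0 < Nat.card α := Nat.card_pos
  set k := Nat.card α with hkdef
  have ν : α ≃ Fin k := Finite.equivFin α
  obtain ⟨N, hN⟩ := multi_ins_avg h k m (ε / k) (by positivity)
  refine ⟨N, fun ι _ hι D hD B hB s hs hσ => ?_⟩
  set f : (ι → Option α) → ℝ := fun u => ind (u ∈ B) - s with hf
  have key : ∀ t : Fin k, (avg fun u => ind ((∀ j, j < t → u ∈ D (ν.symm j)) ∧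
      ¬ u ∈ D (ν.symm t)) * f u) ≤ ε / k := by
    intro t
    have := hN ι hι (fun j => ν.symm j) (fun j => if j < t then D (ν.symm j) else
      if j = t then (D (ν.symm j))ᶜ else Set.univ) (by
        intro j
        by_cases h1 : j < t
        · simp only [h1, if_true]; exact hD _
        · by_cases h2 : j = t
          · simp only [h2, lt_irrefl, if_false, if_true]
            intro x y hxy hx hy
            exact hx (hD _ _ _ (fun i => (hxy i).symm) hy)
          · simp only [h1, h2, if_false]
            intro x y _ _
            trivial) f (by
        intro y
        have := ind_le_one (y ∈ B)
        simp only [hf]; linarith) (by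
        intro σ hσ1 _
        have := hσ σ hσ1
        simp only [hf]
        rw [avg_sub, avg_const]
        unfold dn at this
        simp only [Set.mem_ofPred_eq] at this
        linarith)
    refine le_trans (le_of_eq ?_) this
    congr 1
    funext u
    congr 2
    apply propext
    constructor
    · rintro ⟨h1, h2⟩ j
      by_cases h3 : j < t
      · simp only [h3, if_true]; exact h1 j h3
      · by_cases h4 : j = t
        · subst h4; simpa using h2
        · simp [h3, h4]
    · intro h1
      refine ⟨fun j hj => ?_, ?_⟩
      · have := h1 j
        simpa only [hj, if_true] using this
      · have := h1 t
        simpa using this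
  have h1 : (avg fun u => ind (∃ i, u ∉ D i) * f u) ≤ ε := by
    have e1 : (fun u => ind (∃ i, u ∉ D i) * f u) = fun u =>
        ∑ t : Fin k, ind ((∀ j, j < t → u ∈ D (ν.symm j)) ∧ ¬ u ∈ D (ν.symm t)) * f u := by
      funext u
      rw [← Finset.sum_mul, ← ind_exists_first (fun j => u ∈ D (ν.symm j))]
      congr 2
      apply propext
      exact ⟨fun ⟨i, hi⟩ => ⟨ν i, by simpa using hi⟩, fun ⟨i, hi⟩ => ⟨_, hi⟩⟩
    rw [e1, avg_sum]
    refine (Finset.sum_le_sum fun t _ => key t).trans ?_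
    simp only [Finset.sum_const, Finset.card_univ, Fintype.card_fin, nsmul_eq_mul]
    rw [mul_div_cancel₀]
    positivity
  have h2 : dn B = (avg fun u => ind (∃ i, u ∉ D i) * f u) +
      s * (1 - dn {u | ∀ i, u ∈ D i}) := by
    have e1 : (1 : ℝ) - dn {u | ∀ i, u ∈ D i} = avg fun u : ι → Option α => ind (∃ i, u ∉ D i) := by
      rw [← avg_const (X := ι → Option α) (1 : ℝ)]
      unfold dn
      rw [← avg_sub]
      congr 1
      funext u
      rw [← ind_not]
      congr 1
      simp
    rw [e1, ← avg_mul_left, ← avg_add]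
    unfold dn
    congr 1
    funext u
    simp only [hf]
    by_cases hu : u ∈ B
    · rw [ind_true hu, ind_true (hB u hu)]; ring
    · rw [ind_false hu]; ring
  linarith

/-- replace `none` by `some i` -/
def fill {ι α : Type} (i : α) (x : ι → Option α) : ι → Option α := fun j => some ((x j).getD i)

theorem line_of_fill {ι κ α : Type} (A : Set (ι ⊕ κ → Option α)) (x : ι → Option α) (y : κ → Option α)
    (hx : ∃ j, x j = none) (h0 : Sum.elim x y ∈ A) (h1 : ∀ i, Sum.elim (fill i x) y ∈ A) :
    ∃ σ : ι ⊕ κ → Option α ⊕ Unit, Full σ ∧ ∀ a, sub σ a ∈ A := by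
  refine ⟨Sum.elim (fun j => Option.elim (x j) (Sum.inr ()) (fun a => Sum.inl (some a)))
    (fun j => Sum.inl (y j)), ?_, ?_⟩
  · rintro ⟨⟩
    obtain ⟨j, hj⟩ := hx
    exact ⟨Sum.inl j, by simp [hj]⟩
  · intro a
    rw [sub_elim_inl]
    rcases ha : a () with _ | i
    · convert h0 using 2
      funext j
      rcases hj : x j with _ | b <;> simp [sub, ha, hj]
    · convert h1 i using 2
      funext j
      rcases hj : x j with _ | b <;> simp [sub, ha, hj, fill]

theorem all_ge {X : Type} [Finite X] (f : X → ℝ) (s γ : ℝ) (hγ : 0 ≤ γ) (h : s - γ ≤ avg f)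
    (h1 : ∀ x, f x ≤ s + γ) (x : X) : s - 2 * Nat.card X * γ ≤ f x := by
  classical
  have := Fintype.ofFinite X
  have hpos : (1 : ℝ) ≤ Fintype.card X := by exact_mod_cast Fintype.card_pos_iff.2 ⟨x⟩
  rw [avg_def, le_div_iff₀ (by linarith)] at h
  rw [Nat.card_eq_fintype_card]
  have h2 : ∑ z ∈ Finset.univ.erase x, f z ≤ ∑ z ∈ Finset.univ.erase x, (s + γ) :=
    Finset.sum_le_sum fun z _ => h1 z
  rw [Finset.sum_const, Finset.card_erase_of_mem (Finset.mem_univ x), Finset.card_univ,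
    nsmul_eq_mul, Nat.cast_sub (by exact_mod_cast hpos)] at h2
  have h3 := Finset.add_sum_erase Finset.univ f (Finset.mem_univ x)
  push_cast at h2
  nlinarith

theorem dl_core {α : Type} [Finite α] [Nonempty α] (h : ∀ δ > 0, Dl δ α) (s : ℝ) (hs : 0 < s)
    (h1 : ∀ γ > 0, Dl (s + γ) (Option α)) (h2 : ∀ γ > 0, ¬ Dl (s - γ) (Option α)) : False := by
  obtain ⟨l, hl⟩ := h (s / 4) (by linarith)
  have hΛ : 0 < Nat.card (Fin l → Option α) := Nat.card_pos
  obtain ⟨θ, hθdef⟩ : ∃ θ, θ = s / 4 / Nat.card (Fin l → Option α) := ⟨_, rfl⟩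
  have hθ : 0 < θ := by rw [hθdef]; positivity
  obtain ⟨m, hm⟩ := h1 (θ * s / 4) (by positivity)
  obtain ⟨M, hM⟩ := per_y (md_of_dl h) m (θ * s / 8) (by positivity)
  obtain ⟨I, _, hI⟩ := ramsey_good (α := α) M l Unit
  have hK : 0 < Nat.card (I → Option α) := Nat.card_pos
  obtain ⟨γ, hγdef⟩ : ∃ γ, γ = min (θ * s) s / (16 * Nat.card (I → Option α)) := ⟨_, rfl⟩
  have hγ : 0 < γ := by rw [hγdef]; positivity
  have hη : 16 * Nat.card (I → Option α) * γ = min (θ * s) s := by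
    rw [hγdef]; field_simp
  have hη1 : 16 * Nat.card (I → Option α) * γ ≤ θ * s := hη.le.trans (min_le_left _ _)
  have hη2 : 16 * Nat.card (I → Option α) * γ ≤ s := hη.le.trans (min_le_right _ _)
  obtain ⟨N2, hN2⟩ := h1 γ hγ
  have h3 := h2 γ hγ
  unfold Dl at h3
  push Not at h3
  obtain ⟨ι, _, hι, A0, hA0, hA0l⟩ := h3 (Nat.card I + N2)
  obtain ⟨k, hk, ⟨e0⟩⟩ := exists_split hι
  have eI : Fin (Nat.card I) ≃ I := (Finite.equivFin I).symm
  have e : ι ≃ I ⊕ Fin k := e0.trans (Equiv.sumCongr eI (Equiv.refl _))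
  set A : Set (I ⊕ Fin k → Option α) := {x | (fun i => x (e i)) ∈ A0} with hA
  have hdA : s - γ ≤ dn A := by
    have := avg_reindex e (fun x => ind (x ∈ A0))
    unfold dn
    rw [hA]
    simp only [Set.mem_ofPred_eq]
    rw [this]; exact hA0
  have hAl : ∀ σ : I ⊕ Fin k → Option α ⊕ Unit, Full σ → ¬ ∀ a, sub σ a ∈ A := by
    intro σ hσ hc
    obtain ⟨a, ha⟩ := hA0l (fun i => σ (e i)) (full_comp_equiv e hσ)
    exact ha (hc a)
  have hup : ∀ x : I → Option α, (avg fun y : Fin k → Option α => ind (Sum.elim x y ∈ A)) ≤ s + γ := by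
    intro x
    by_contra hc
    push Not at hc
    obtain ⟨σ, hσ1, hσ2⟩ := hN2 (Fin k) (by simpa using hk) {y | Sum.elim x y ∈ A} hc.le
    refine hAl (Sum.elim (fun i => Sum.inl (x i)) σ) (full_elim_right _ hσ1) ?_
    intro a
    rw [sub_inl_elim]
    exact hσ2 a
  have hlow : ∀ x : I → Option α, s - s * min θ 1 / 8 ≤
      (avg fun y : Fin k → Option α => ind (Sum.elim x y ∈ A)) := by
    intro x
    have := all_ge (fun x : I → Option α => avg fun y : Fin k → Option α => ind (Sum.elim x y ∈ A))
      s γ hγ.le (by unfold dn at hdA; rwa [avg_elim] at hdA) hup x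
    have e1 : min (θ * s) s = s * min θ 1 := by
      rw [mul_min_of_nonneg _ _ hs.le]; ring_nf
    rw [e1] at hη
    linarith
  have hlow1 : ∀ x : I → Option α, s - θ * s / 8 ≤
      (avg fun y : Fin k → Option α => ind (Sum.elim x y ∈ A)) := by
    intro x
    have := hlow x
    have h4 : s * min θ 1 ≤ s * θ := by gcongr; exact min_le_left _ _
    linarith
  have hlow2 : ∀ x : I → Option α, s / 2 ≤
      (avg fun y : Fin k → Option α => ind (Sum.elim x y ∈ A)) := by
    intro x
    have := hlow x
    have h4 : s * min θ 1 ≤ s * 1 := by gcongr; exact min_le_right _ _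
    linarith
  rcases hI (fun _ x => θ ≤ avg fun y : Fin k → Option α => ind (∀ i, Sum.elim (fill i x) y ∈ A)) with
    ⟨_, W, hW1, ⟨j0, hj0⟩, hW2⟩ | ⟨V, hV⟩
  · -- a good subspace
    have hy : ∀ y : Fin k → Option α, dn {a | Sum.elim (sub W a) y ∈ A} ≤ θ * s / 8 +
        (s + θ * s / 4) * (1 - dn {a | ∀ i, a ∈ {a | Sum.elim (fill i (sub W a)) y ∈ A}}) := by
      intro y
      refine hM (Fin M) (by simp) (fun i => {a | Sum.elim (fill i (sub W a)) y ∈ A}) ?_ _ ?_ _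
        (by positivity) ?_
      · intro i u v huv hu
        have : fill i (sub W u) = fill i (sub W v) := by
          funext j
          unfold fill sub
          rcases W j with c | c
          · rfl
          · simp [huv c]
        simp only [Set.mem_ofPred_eq] at hu ⊢
        rwa [← this]
      · intro u hu
        by_contra hc
        push Not at hc
        obtain ⟨σ, hσ1, hσ2⟩ := line_of_fill A (sub W u) y ⟨j0, by simp [sub, hj0]⟩ hu hc
        exact hAl σ hσ1 hσ2
      · intro τ hτ
        by_contra hc
        push Not at hc
        obtain ⟨σ, hσ1, hσ2⟩ := hm (Fin m) (by simp) _ hc.le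
        refine hAl (Sum.elim (cmp W (cmp τ σ)) (fun i => Sum.inl (y i)))
          (full_elim_left _ (full_cmp hW1 (full_cmp hτ hσ1))) ?_
        intro a
        rw [sub_elim_inl, sub_cmp, sub_cmp]
        exact hσ2 a
    have hy2 := avg_mono hy
    rw [avg_add, avg_mul_left, avg_sub, avg_const, avg_const] at hy2
    have e1 : (avg fun y : Fin k → Option α => dn {a | Sum.elim (sub W a) y ∈ A}) =
        avg fun a => avg fun y : Fin k → Option α => ind (Sum.elim (sub W a) y ∈ A) := by
      rw [avg_comm]; rfl
    have e2 : (avg fun y : Fin k → Option α =>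
        dn {a | ∀ i, a ∈ {a | Sum.elim (fill i (sub W a)) y ∈ A}}) =
        avg fun a => avg fun y : Fin k → Option α => ind (∀ i, Sum.elim (fill i (sub W a)) y ∈ A) := by
      rw [avg_comm]; rfl
    have e3 : s - θ * s / 8 ≤ avg fun y : Fin k → Option α => dn {a | Sum.elim (sub W a) y ∈ A} := by
      rw [e1, ← avg_const (X := Fin M → Option α) (s - θ * s / 8)]
      exact avg_mono fun a => hlow1 _
    have e4 : θ ≤ avg fun y : Fin k → Option α =>
        dn {a | ∀ i, a ∈ {a | Sum.elim (fill i (sub W a)) y ∈ A}} := by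
      rw [e2, ← avg_const (X := Fin M → Option α) θ]
      exact avg_mono fun a => hW2 a
    have e5 : (s + θ * s / 4) * (1 - avg fun y : Fin k → Option α =>
        dn {a | ∀ i, a ∈ {a | Sum.elim (fill i (sub W a)) y ∈ A}}) ≤ (s + θ * s / 4) * (1 - θ) := by
      apply mul_le_mul_of_nonneg_left _ (by positivity)
      linarith
    have : 0 < θ * s := by positivity
    have : 0 < θ * s * θ := by positivity
    nlinarith
  · -- all bad
    have q1 : s / 2 ≤ avg fun y : Fin k → Option α =>
        avg fun b : Fin l → α => ind (Sum.elim (sub (fun i => (V i).map some id) (fun e => some (b e))) y ∈ A) := by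
      rw [avg_comm, ← avg_const (X := Fin l → α) (s / 2)]
      exact avg_mono fun a => hlow2 _
    have q2 := markov (by linarith) (fun y => avg_le_const zero_le_one (fun x => ind_le_one _)) q1
    have q3 : s / 2 / 2 = s / 4 := by ring
    rw [q3] at q2
    obtain ⟨b, hb⟩ := pigeon (S := Fin l → Option α) (Q := fun b y => (∃ e, b e = none) ∧
      ∀ i, Sum.elim (fill i (sub (fun i => (V i).map some id) b)) y ∈ A) (by linarith) q2 (by
      intro y hy
      obtain ⟨σ, hσ1, hσ2⟩ := hl (Fin l) (by simp) {b | Sum.elim (sub (fun i => (V i).map some id)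
        (fun e => some (b e))) y ∈ A} hy
      refine ⟨fun e => Sum.elim some (fun _ => none) (σ e), ?_, ?_⟩
      · obtain ⟨e, he⟩ := hσ1 ()
        exact ⟨e, by simp [he]⟩
      · intro i
        have := hσ2 (fun _ => i)
        simp only [Set.mem_ofPred_eq] at this
        convert this using 2
        funext j
        unfold fill sub
        rcases hVj : V j with c | c
        · simp [hVj]
        · rcases hσc : σ c with d | d <;> simp [hVj, hσc])
    rw [← hθdef] at hb
    obtain ⟨y, hy⟩ := exists_le_of_avg hθ hb
    have hy' : ∃ e, b e = none := by
      by_contra hc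
      rw [ind_false (fun h => hc h.1)] at hy
      linarith
    refine hV () b hy' (hb.trans (avg_mono fun y => ind_mono fun h => h.2))

theorem dl_option {α : Type} [Finite α] [Nonempty α] (h : ∀ δ > 0, Dl δ α) :
    ∀ δ > 0, Dl δ (Option α) := by
  by_contra hcon
  push Not at hcon
  obtain ⟨δ0, hδ0, hn⟩ := hcon
  have mono : ∀ δ δ' : ℝ, δ ≤ δ' → Dl δ (Option α) → Dl δ' (Option α) := by
    rintro δ δ' hd ⟨N, hN⟩
    exact ⟨N, fun ι _ hι A hA => hN ι hι A (hd.trans hA)⟩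
  set S : Set ℝ := {δ | Dl δ (Option α)} with hS
  have hne : S.Nonempty := by
    refine ⟨2, 0, fun ι _ _ A hA => ?_⟩
    have := dn_le_one A
    linarith
  have hlb : ∀ δ ∈ S, δ0 ≤ δ := by
    intro δ hδ
    by_contra hc
    push Not at hc
    exact hn (mono _ _ hc.le hδ)
  have hbdd : BddBelow S := ⟨δ0, hlb⟩
  have hs : δ0 ≤ sInf S := le_csInf hne hlb
  refine dl_core h (sInf S) (by linarith) ?_ ?_
  · intro γ hγ
    obtain ⟨δ, hδ, hlt⟩ := exists_lt_of_csInf_lt hne (show sInf S < sInf S + γ by linarith)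
    exact mono _ _ hlt.le hδ
  · intro γ hγ hd
    have : sInf S ≤ sInf S - γ := csInf_le hbdd hd
    linarith

theorem dl_unit : ∀ δ > 0, Dl δ Unit := by
  intro δ hδ
  refine ⟨1, fun ι _ hι A hA => ?_⟩
  obtain ⟨x, hx⟩ := exists_le_of_avg hδ hA
  have hxA : x ∈ A := by
    by_contra hxA
    rw [ind_false hxA] at hx; linarith
  have hne : Nonempty ι := by
    by_contra hc
    rw [not_nonempty_iff] at hc
    simp at hι
  obtain ⟨i⟩ := hne
  refine ⟨fun _ => Sum.inr (), fun u => ⟨i, rfl⟩, fun a => ?_⟩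
  convert hxA

theorem dl_equiv {α β : Type} [Finite α] [Finite β] (e : α ≃ β) (δ : ℝ) (h : Dl δ α) : Dl δ β := by
  obtain ⟨N, hN⟩ := h
  refine ⟨N, fun ι _ hι A hA => ?_⟩
  obtain ⟨σ, hσ1, hσ2⟩ := hN ι hι {x | (fun i => e (x i)) ∈ A} (by
    unfold dn at hA ⊢
    rw [← avg_equiv ((Equiv.refl ι).arrowCongr e)] at hA
    exact hA)
  refine ⟨fun i => (σ i).map e id, ?_, ?_⟩
  · intro w
    obtain ⟨i, hi⟩ := hσ1 w
    exact ⟨i, by simp [hi]⟩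
  · intro a
    have := hσ2 (fun w => e.symm (a w))
    simp only [Set.mem_ofPred_eq] at this
    convert this using 1
    funext i
    unfold sub
    rcases hσi : σ i with c | c <;> simp [hσi]

/-- density Hales Jewett for all alphabets -/
theorem dl_fin (k : ℕ) : ∀ δ > 0, Dl δ (Fin (k + 1)) := by
  induction k with
  | zero =>
    intro δ hδ
    exact dl_equiv (Equiv.ofUnique Unit (Fin 1)) δ (dl_unit δ hδ)
  | succ k ih =>
    intro δ hδ
    exact dl_equiv (finSuccEquiv (k + 1)).symm δ (dl_option ih δ hδ)

/-- Szemerédi in `ZMod p` -/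
theorem szemeredi (k : ℕ) (δ : ℝ) (hδ : 0 < δ) : ∃ p₀ : ℕ, ∀ p : ℕ, p.Prime → p₀ ≤ p →
    ∀ B : Set (ZMod p), δ * p ≤ Nat.card B →
      ∃ x d : ZMod p, d ≠ 0 ∧ ∀ i : ℕ, i < k → x + (i : ZMod p) * d ∈ B := by
  classical
  obtain ⟨N, hN⟩ := dl_fin k δ hδ
  refine ⟨N + 1, fun p hp hpN B hB => ?_⟩
  have : Fact p.Prime := ⟨hp⟩
  have : NeZero p := ⟨hp.ne_zero⟩
  have hd : dn B = Nat.card B / p := by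
    unfold dn
    rw [avg_def, ZMod.card]
    congr 1
    rw [Nat.card_eq_fintype_card, Fintype.card_subtype, Finset.card_eq_sum_ones,
      Finset.sum_filter]
    push_cast
    rfl
  have hppos : (0 : ℝ) < p := by exact_mod_cast hp.pos
  have hd' : δ ≤ dn B := by rw [hd, le_div_iff₀ hppos]; exact hB
  let g : (Fin N → Fin (k+1)) → ZMod p := fun x => ∑ i, ((x i : ℕ) : ZMod p)
  have h1 : δ ≤ avg fun a : ZMod p => avg fun x : Fin N → Fin (k+1) => ind (a + g x ∈ B) := by
    rw [avg_comm]
    rw [← avg_const (X := Fin N → Fin (k+1)) δ]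
    apply avg_mono
    intro x
    refine hd'.trans (le_of_eq ?_)
    exact (avg_equiv (Equiv.addRight (g x)) (fun a => ind (a ∈ B))).symm
  obtain ⟨a, ha⟩ := exists_le_of_avg hδ h1
  obtain ⟨σ, hσ1, hσ2⟩ := hN (Fin N) (by simp) {x | a + g x ∈ B} ha
  set d : ℕ := (Finset.univ.filter fun i => σ i = Sum.inr ()).card with hddef
  set c : ZMod p := ∑ i, Sum.elim (fun u : Fin (k+1) => ((u : ℕ) : ZMod p)) (fun _ => 0) (σ i) with hc
  have hd0 : 0 < d := by
    obtain ⟨i, hi⟩ := hσ1 ()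
    exact Finset.card_pos.2 ⟨i, by simp [hi]⟩
  have hdN : d ≤ N := by
    refine (Finset.card_le_univ _).trans (by simp)
  refine ⟨a + c, (d : ZMod p), ?_, ?_⟩
  · rw [Ne, ZMod.natCast_eq_zero_iff]
    intro hdvd
    have := Nat.le_of_dvd hd0 hdvd
    omega
  · intro i hi
    have h2 := hσ2 (fun _ => ⟨i, by omega⟩)
    have h3 : g (sub σ fun _ => ⟨i, by omega⟩) = c + i * d := by
      simp only [g, hc, hddef]
      rw [Finset.card_eq_sum_ones, Finset.sum_filter]
      push_cast
      rw [Finset.mul_sum, ← Finset.sum_add_distrib]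
      apply Finset.sum_congr rfl
      intro j _
      unfold sub
      rcases σ j with u | u <;> simp
    simp only [Set.mem_ofPred_eq] at h2
    rw [h3] at h2
    rwa [add_assoc]

end DHJ
end

section
namespace TwoRed

/-- a periodic colouring of the integers without RRB^k, with extremal blue run M -/
structure Sys (k M p : ℕ) (R : ℤ → Prop) : Prop where
  hk : 1 ≤ k
  hp : p.Prime
  hMp : M + 1 < p
  per : ∀ x, R x → R (x + p)
  rule : ∀ x d : ℤ, ¬ (p : ℤ) ∣ d → R x → R (x + d) → ∃ i : ℤ, 1 ≤ i ∧ i ≤ k ∧ R (x + d + i * d)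
  run : ∀ x a : ℤ, ¬ (p : ℤ) ∣ a → ∃ i : ℤ, 0 ≤ i ∧ i ≤ M ∧ R (x + i * a)
  zero : R 0
  neg : ∀ j : ℤ, 1 ≤ j → j ≤ M → ¬ R (-j)

variable {k M p : ℕ} {R : ℤ → Prop}

theorem Sys.ndvd (h : Sys k M p R) {g : ℤ} (h0 : 0 < g) (h1 : g ≤ M + 1) : ¬ (p : ℤ) ∣ g := by
  intro hd
  have := Int.le_of_dvd h0 hd
  have := h.hMp
  omega

theorem Sys.ruleR (h : Sys k M p R) {a b : ℤ} (hab : a < b) (hb : b ≤ a + (M + 1))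
    (ha : R a) (hb' : R b) : ∃ i : ℤ, 1 ≤ i ∧ i ≤ k ∧ R (b + i * (b - a)) := by
  obtain ⟨i, h1, h2, h3⟩ := h.rule a (b - a) (h.ndvd (by omega) (by omega)) ha (by simpa using hb')
  exact ⟨i, h1, h2, by simpa using h3⟩

theorem Sys.ruleL (h : Sys k M p R) {a b : ℤ} (hab : a < b) (hb : b ≤ a + (M + 1))
    (ha : R a) (hb' : R b) : ∃ i : ℤ, 1 ≤ i ∧ i ≤ k ∧ R (a - i * (b - a)) := by
  obtain ⟨i, h1, h2, h3⟩ := h.rule b (a - b) (by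
    intro hd
    rw [← dvd_neg] at hd
    exact h.ndvd (g := -(a - b)) (by omega) (by omega) hd) hb' (by simpa using ha)
  refine ⟨i, h1, h2, ?_⟩
  convert h3 using 1
  ring

/-- the previous red element -/
theorem Sys.pred (h : Sys k M p R) (z : ℤ) :
    ∃ b, b < z ∧ z ≤ b + (M + 1) ∧ R b ∧ ∀ y, R y → y < z → y ≤ b := by
  classical
  obtain ⟨i, h1, h2, h3⟩ := h.run (z - (M + 1)) 1 (h.ndvd one_pos (by omega))
  have hne : ((Finset.Icc (z - (M + 1)) (z - 1)).filter R).Nonempty :=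
    ⟨z - (M + 1) + i * 1, by simp only [Finset.mem_filter, Finset.mem_Icc]; exact ⟨by omega, h3⟩⟩
  have hm := Finset.max'_mem _ hne
  simp only [Finset.mem_filter, Finset.mem_Icc] at hm
  refine ⟨_, by omega, by omega, hm.2, ?_⟩
  intro y hy hyz
  by_cases hy2 : z - (M + 1) ≤ y
  · exact Finset.le_max' _ _ (by simp only [Finset.mem_filter, Finset.mem_Icc]; exact ⟨by omega, hy⟩)
  · omega

/-- the next red element -/
theorem Sys.succ (h : Sys k M p R) (z : ℤ) :
    ∃ b, z < b ∧ b ≤ z + (M + 1) ∧ R b ∧ ∀ y, R y → z < y → b ≤ y := by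
  classical
  obtain ⟨i, h1, h2, h3⟩ := h.run (z + 1) 1 (h.ndvd one_pos (by omega))
  have hne : ((Finset.Icc (z + 1) (z + (M + 1))).filter R).Nonempty :=
    ⟨z + 1 + i * 1, by simp only [Finset.mem_filter, Finset.mem_Icc]; exact ⟨by omega, h3⟩⟩
  have hm := Finset.min'_mem _ hne
  simp only [Finset.mem_filter, Finset.mem_Icc] at hm
  refine ⟨_, by omega, by omega, hm.2, ?_⟩
  intro y hy hyz
  by_cases hy2 : y ≤ z + (M + 1)
  · exact Finset.min'_le _ _ (by simp only [Finset.mem_filter, Finset.mem_Icc]; exact ⟨by omega, hy⟩)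
  · omega

open Classical in
theorem Sys.count (h : Sys k M p R) {w : ℤ} (hw0 : 0 ≤ w) (hw : k * w ≤ M) (j : ℕ) :
    ((Finset.Icc (0 : ℤ) (j * w)).filter R).card ≤ (k + 2) ^ j := by
  induction j with
  | zero =>
    refine (Finset.card_filter_le _ _).trans ?_
    simp
  | succ j ih =>
    set N := (Finset.Icc (0 : ℤ) (j * w)).filter R with hN
    have h0N : 0 ∈ N := by
      simp only [hN, Finset.mem_filter, Finset.mem_Icc, le_refl, true_and]
      exact ⟨by positivity, h.zero⟩
    have hN1 : 1 ≤ N.card := Finset.card_pos.2 ⟨0, h0N⟩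
    obtain ⟨r, hr1, hr2, hr3, hr4⟩ := h.succ (j * w)
    have hsub : (Finset.Icc (0 : ℤ) ((j + 1 : ℕ) * w)).filter R ⊆
        (N ∪ {r}) ∪ (Finset.Icc (1 : ℤ) k ×ˢ N).image (fun ml => r + (r - ml.2) / ml.1) := by
      intro z hz
      simp only [Finset.mem_filter, Finset.mem_Icc] at hz
      obtain ⟨⟨hz0, hz1⟩, hz2⟩ := hz
      push_cast at hz1
      by_cases hzj : z ≤ j * w
      · simp only [Finset.mem_union]
        left; left
        simp only [hN, Finset.mem_filter, Finset.mem_Icc]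
        exact ⟨⟨hz0, hzj⟩, hz2⟩
      · have hrz := hr4 z hz2 (by omega)
        rcases hrz.eq_or_lt with heq | hlt
        · simp [heq]
        · have hg : z - r ≤ w := by nlinarith
          have hgk : k * (z - r) ≤ M := le_trans (by gcongr) hw
          have hk1 : (1 : ℤ) ≤ k := by exact_mod_cast h.hk
          obtain ⟨i, hi1, hi2, hi3⟩ := h.ruleL hlt (by nlinarith) hr3 hz2
          have hig : i * (z - r) ≤ k * (z - r) := mul_le_mul_of_nonneg_right hi2 (by omega)
          have hig0 : 0 < i * (z - r) := mul_pos (by omega) (by omega)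
          have hjw : 0 ≤ (j : ℤ) * w := by positivity
          have hnn : 0 ≤ r - i * (z - r) := by
            by_contra hc
            push Not at hc
            refine h.neg (-(r - i * (z - r))) (by omega) (by omega) (by simpa using hi3)
          have hle : r - i * (z - r) ≤ j * w := by
            by_contra hc
            push Not at hc
            have := hr4 _ hi3 hc
            omega
          simp only [Finset.mem_union, Finset.mem_image, Finset.mem_product, Finset.mem_Icc]
          right
          refine ⟨(i, r - i * (z - r)), ⟨⟨hi1, hi2⟩, ?_⟩, ?_⟩
          · simp only [hN, Finset.mem_filter, Finset.mem_Icc]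
            exact ⟨⟨hnn, hle⟩, hi3⟩
          · simp only [sub_sub_cancel]
            rw [Int.mul_ediv_cancel_left _ (by omega)]
            omega
    have h1 := Finset.card_le_card hsub
    have h2 := Finset.card_union_le (N ∪ {r})
      ((Finset.Icc (1 : ℤ) k ×ˢ N).image (fun ml => r + (r - ml.2) / ml.1))
    have h3 := Finset.card_union_le N {r}
    have h4 := Finset.card_image_le (s := Finset.Icc (1 : ℤ) k ×ˢ N)
      (f := fun ml => r + (r - ml.2) / ml.1)
    rw [Finset.card_product] at h4
    simp only [Int.card_Icc, add_sub_cancel_right, Int.toNat_natCast, Finset.card_singleton] at h3 h4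
    rw [pow_succ]
    nlinarith

/-- simultaneous Dirichlet approximation -/
theorem dirichlet (S : Finset ℤ) (K : ℕ) (hK : 0 < K) (Y : ℕ) (hY : K ^ S.card < Y) :
    ∃ (j : ℤ) (φ : ℤ → ℤ), 1 ≤ j ∧ j < Y ∧ (∀ r, (Y : ℤ) ∣ j * r - φ r) ∧
      ∀ r ∈ S, K * |φ r| < Y := by
  classical
  have hY0 : (0 : ℤ) < Y := by exact_mod_cast (Nat.zero_le _).trans_lt hY
  have hK0 : (0 : ℤ) < K := by exact_mod_cast hK
  let bk : Fin Y → S → Fin K := fun j r => ⟨((K * ((j : ℤ) * r % Y)) / Y).toNat, by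
    have h1 := Int.emod_lt_of_pos ((j : ℤ) * r) hY0
    have h2 : (K * ((j : ℤ) * r % Y)) / Y < K := by
      apply Int.ediv_lt_of_lt_mul hY0
      gcongr
    omega⟩
  obtain ⟨j1, j2, hne, heq⟩ := Fintype.exists_ne_map_eq_of_card_lt bk (by simpa using hY)
  wlog hlt : j1 < j2 generalizing j1 j2
  · exact this j2 j1 hne.symm heq.symm (lt_of_le_of_ne (not_lt.1 hlt) hne.symm)
  refine ⟨(j2 : ℤ) - j1, fun r => (j2 : ℤ) * r % Y - (j1 : ℤ) * r % Y, ?_, ?_, ?_, ?_⟩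
  · have : (j1 : ℕ) < j2 := hlt
    omega
  · have := j2.2
    omega
  · intro r
    have h1 := Int.emod_add_mul_ediv ((j1 : ℤ) * r) Y
    have h2 := Int.emod_add_mul_ediv ((j2 : ℤ) * r) Y
    refine ⟨(j2 : ℤ) * r / Y - (j1 : ℤ) * r / Y, ?_⟩
    linarith
  · intro r hr
    have h1 := congrFun heq ⟨r, hr⟩
    simp only [bk, Fin.mk.injEq] at h1
    have n1 := Int.emod_nonneg ((j1 : ℤ) * r) hY0.ne'
    have n2 := Int.emod_nonneg ((j2 : ℤ) * r) hY0.ne'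
    have m1 : 0 ≤ (K * ((j1 : ℤ) * r % Y)) / Y := Int.ediv_nonneg (by positivity) hY0.le
    have m2 : 0 ≤ (K * ((j2 : ℤ) * r % Y)) / Y := Int.ediv_nonneg (by positivity) hY0.le
    have h2 : (K * ((j1 : ℤ) * r % Y)) / Y = (K * ((j2 : ℤ) * r % Y)) / Y := by omega
    have e1 := Int.emod_add_mul_ediv (K * ((j1 : ℤ) * r % Y)) Y
    have e2 := Int.emod_add_mul_ediv (K * ((j2 : ℤ) * r % Y)) Y
    have f1 := Int.emod_nonneg (K * ((j1 : ℤ) * r % Y)) hY0.ne'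
    have f2 := Int.emod_nonneg (K * ((j2 : ℤ) * r % Y)) hY0.ne'
    have g1 := Int.emod_lt_of_pos (K * ((j1 : ℤ) * r % Y)) hY0
    have g2 := Int.emod_lt_of_pos (K * ((j2 : ℤ) * r % Y)) hY0
    rw [h2] at e1
    rw [← abs_of_pos hK0, ← abs_mul]
    beta_reduce
    rw [mul_sub, abs_lt]
    constructor <;> linarith

end TwoRed
end

section
namespace TwoRed
variable {k M p : ℕ} {R : ℤ → Prop}

theorem dvd_of_eq_of_dvd' {a b c : ℤ} (h : b = c) (h' : a ∣ c) : a ∣ b := h ▸ h'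

theorem Sys.linear (h : Sys k M p R) (X : ℤ) (hX : M + 1 ≤ X) (φ : ℤ → ℤ)
    (hφ : ∀ x d i : ℤ, 1 ≤ i → i ≤ k → R x → R (x + d) → R (x + d + i * d) → 0 ≤ x → x ≤ X →
      0 ≤ x + d → x + d ≤ X → 0 ≤ x + d + i * d → x + d + i * d ≤ X →
      φ (x + d + i * d) = (1 + i) * φ (x + d) - i * φ x) :
    ∃ s c : ℚ, ∀ r, R r → k * (M + 1) ≤ r → r ≤ X - k * (M + 1) → (φ r : ℚ) = s * r + c := by
  classical
  set S := (Finset.Icc (0 : ℤ) X).filter R with hS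
  have memS : ∀ r, r ∈ S ↔ (0 ≤ r ∧ r ≤ X) ∧ R r := by
    intro r; simp only [hS, Finset.mem_filter, Finset.mem_Icc]
  set T := (S ×ˢ S).filter (fun ab => ab.1 < ab.2) with hT
  have memT : ∀ a b, (a, b) ∈ T ↔ (a ∈ S ∧ b ∈ S) ∧ a < b := by
    intro a b; simp only [hT, Finset.mem_filter, Finset.mem_product]
  have hTne : T.Nonempty := by
    obtain ⟨b, hb1, hb2, hb3, _⟩ := h.succ 0
    refine ⟨(0, b), ?_⟩
    rw [memT, memS, memS]
    exact ⟨⟨⟨⟨le_rfl, by omega⟩, h.zero⟩, ⟨by omega, by omega⟩, hb3⟩, hb1⟩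
  obtain ⟨⟨u, u'⟩, huT, hmax⟩ := Finset.exists_max_image T
    (fun ab => ((φ ab.2 - φ ab.1 : ℤ) : ℚ) / ((ab.2 - ab.1 : ℤ) : ℚ)) hTne
  rw [memT, memS, memS] at huT
  obtain ⟨⟨⟨⟨hu0, huX⟩, hRu⟩, ⟨hu'0, hu'X⟩, hRu'⟩, huu'⟩ := huT
  set s : ℚ := ((φ u' - φ u : ℤ) : ℚ) / ((u' - u : ℤ) : ℚ) with hs
  set ψ : ℤ → ℚ := fun r => φ r - s * r with hψ
  have anti : ∀ a b, R a → R b → 0 ≤ a → b ≤ X → a ≤ b → ψ b ≤ ψ a := by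
    intro a b ha hb ha0 hbX hab
    rcases hab.eq_or_lt with rfl | hlt
    · exact le_rfl
    have := hmax (a, b) (by
      rw [memT, memS, memS]
      exact ⟨⟨⟨⟨ha0, by omega⟩, ha⟩, ⟨by omega, hbX⟩, hb⟩, hlt⟩)
    simp only at this
    rw [div_le_iff₀ (by exact_mod_cast (by omega : 0 < b - a))] at this
    simp only [hψ]
    push_cast at this ⊢
    linarith
  have hψu : ψ u' = ψ u := by
    have : s * ((u' - u : ℤ) : ℚ) = ((φ u' - φ u : ℤ) : ℚ) := by
      rw [hs, div_mul_cancel₀]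
      have : (u' - u : ℤ) ≠ 0 := by omega
      exact_mod_cast this
    simp only [hψ]
    push_cast at this
    linarith
  have hmid : ∀ r, R r → u ≤ r → r ≤ u' → ψ r = ψ u := by
    intro r hr h1 h2
    apply le_antisymm
    · exact anti u r hRu hr hu0 (by omega) h1
    · rw [← hψu]; exact anti r u' hr hRu' (by omega) hu'X h2
  have hrel : ∀ x d i : ℤ, 1 ≤ i → i ≤ k → R x → R (x + d) → R (x + d + i * d) → 0 ≤ x → x ≤ X →
      0 ≤ x + d → x + d ≤ X → 0 ≤ x + d + i * d → x + d + i * d ≤ X → ψ x = ψ u → ψ (x + d) = ψ u →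
      ψ (x + d + i * d) = ψ u := by
    intro x d i a1 a2 a3 a4 a5 a6 a7 a8 a9 a10 a11 e1 e2
    have := hφ x d i a1 a2 a3 a4 a5 a6 a7 a8 a9 a10 a11
    simp only [hψ] at e1 e2 ⊢
    rw [this]
    push_cast at e1 e2 ⊢
    linear_combination (1 + (i : ℚ)) * e2 - (i : ℚ) * e1
  have hk1 : (1 : ℤ) ≤ k := by exact_mod_cast h.hk
  -- right propagation
  have right : ∀ n : ℕ, ∀ r, R r → u ≤ r → r ≤ u' + n → r ≤ X - k * (M + 1) → ψ r = ψ u := by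
    intro n
    induction n with
    | zero => intro r hr h1 h2 _; exact hmid r hr h1 (by simpa using h2)
    | succ n ih =>
      intro r hr h1 h2 h3
      push_cast at h2
      by_cases h4 : r ≤ u' + n
      · exact ih r hr h1 h4 h3
      obtain ⟨a', q1, q2, q3, q4⟩ := h.pred r
      have q5 := q4 u' hRu' (by omega)
      obtain ⟨a, s1, s2, s3, s4⟩ := h.pred a'
      have s5 := s4 u hRu (by omega)
      have e1 := ih a' q3 (by omega) (by omega) (by omega)
      have e2 := ih a s3 (by omega) (by omega) (by omega)
      obtain ⟨i, i1, i2, i3⟩ := h.ruleR s1 s2 s3 q3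
      have ipos : 0 < i * (a' - a) := mul_pos (by omega) (by omega)
      have ile : i * (a' - a) ≤ k * (M + 1) := mul_le_mul i2 (by omega) (by omega) (by omega)
      have hv : r ≤ a' + i * (a' - a) := by
        by_contra hc
        push Not at hc
        have := q4 _ i3 hc
        omega
      have e3 := hrel a (a' - a) i i1 i2 s3 (by simpa using q3) (by simpa using i3) (by omega)
        (by nlinarith) (by omega) (by nlinarith) (by linarith) (by linarith) e2 (by simpa using e1)
      simp only [add_sub_cancel] at e3
      apply le_antisymm
      · rw [← e1]; exact anti _ _ q3 hr (by omega) (by nlinarith) (by omega)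
      · rw [← e3]; exact anti _ _ hr i3 (by omega) (by linarith) hv
  have left : ∀ n : ℕ, ∀ r, R r → u - n ≤ r → r ≤ u' → k * (M + 1) ≤ r → ψ r = ψ u := by
    intro n
    induction n with
    | zero => intro r hr h1 h2 _; exact hmid r hr (by simpa using h1) h2
    | succ n ih =>
      intro r hr h1 h2 h3
      push_cast at h1
      by_cases h4 : u - n ≤ r
      · exact ih r hr h4 h2 h3
      obtain ⟨a, q1, q2, q3, q4⟩ := h.succ r
      have q5 := q4 u hRu (by omega)
      obtain ⟨a', s1, s2, s3, s4⟩ := h.succ a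
      have s5 := s4 u' hRu' (by omega)
      have e1 := ih a q3 (by omega) (by omega) (by omega)
      have e2 := ih a' s3 (by omega) (by omega) (by omega)
      obtain ⟨i, i1, i2, i3⟩ := h.ruleL s1 s2 q3 s3
      have ipos : 0 < i * (a' - a) := mul_pos (by omega) (by omega)
      have ile : i * (a' - a) ≤ k * (M + 1) := mul_le_mul i2 (by omega) (by omega) (by omega)
      have hkM : 0 ≤ (k : ℤ) * (M + 1) := by positivity
      have hv : a - i * (a' - a) ≤ r := by
        by_contra hc
        push Not at hc
        have := q4 _ i3 hc
        omega
      have hid : a' + (a - a') + i * (a - a') = a - i * (a' - a) := by ring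
      have e3 := hrel a' (a - a') i i1 i2 s3 (by simpa using q3) (by rw [hid]; exact i3) (by omega)
        (by omega) (by omega) (by omega) (by rw [hid]; linarith) (by rw [hid]; linarith) e2
        (by simpa using e1)
      rw [hid] at e3
      apply le_antisymm
      · rw [← e3]; exact anti _ _ i3 hr (by linarith) (by omega) hv
      · rw [← e1]; exact anti _ _ hr q3 (by omega) (by omega) (by omega)
  refine ⟨s, ψ u, fun r hr h1 h2 => ?_⟩
  have : ψ r = ψ u := by
    by_cases h3 : r ≤ u'
    · exact left (u - r).toNat r hr (by omega) h3 h1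
    · exact right (r - u').toNat r hr (by omega) (by omega) h2
  rw [← this]
  simp only [hψ]
  ring

set_option maxHeartbeats 1600000 in
/-- reds in the window are congruent modulo a prime -/
theorem Sys.congr (h : Sys k M p R) {w T Y : ℕ} (hw : k * w ≤ M) (hT : 6 * k + 4 ≤ T)
    (n : ℕ) (hTn : T * M ≤ n * w)
    (hY : Y = (2 * k + 2) ^ ((k + 2) ^ n) + 1) (hYM : Y ≤ M) :
    ∃ q : ℕ, q.Prime ∧ ∀ r r', R r → R r' → k * (M + 1) ≤ r → r ≤ T * M - k * (M + 1) →
      k * (M + 1) ≤ r' → r' ≤ T * M - k * (M + 1) → (q : ℤ) ∣ r - r' := by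
  classical
  have hk1 : (1 : ℤ) ≤ k := by exact_mod_cast h.hk
  set S := (Finset.Icc (0 : ℤ) (T * M)).filter R with hS
  have memS : ∀ r, r ∈ S ↔ (0 ≤ r ∧ r ≤ T * M) ∧ R r := by
    intro r; simp only [hS, Finset.mem_filter, Finset.mem_Icc]
  have hcard : S.card ≤ (k + 2) ^ n := by
    refine le_trans (Finset.card_le_card ?_) (h.count (w := w) (by positivity) (by exact_mod_cast hw) n)
    apply Finset.filter_subset_filter
    apply Finset.Icc_subset_Icc_right
    exact_mod_cast hTn
  obtain ⟨j, φ, hj1, hjY, hφ1, hφ2⟩ := dirichlet S (2 * k + 2) (by omega) Y (by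
    rw [hY, Nat.lt_succ_iff]
    exact Nat.pow_le_pow_right (by omega) hcard)
  have hY0 : (0 : ℤ) < Y := by omega
  have hM1 : (1 : ℤ) ≤ M := by omega
  have hT' : (6 * k + 4 : ℤ) ≤ T := by exact_mod_cast hT
  have hTM : (6 * k + 4 : ℤ) * M ≤ T * M := by gcongr
  have hkM : (k : ℤ) ≤ k * M := by nlinarith
  obtain ⟨s, c, hlin⟩ := h.linear (T * M) (by nlinarith) φ (by
    intro x d i i1 i2 r1 r2 r3 a1 a2 a3 a4 a5 a6
    have f1 := hφ2 _ ((memS _).2 ⟨⟨a1, a2⟩, r1⟩)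
    have f2 := hφ2 _ ((memS _).2 ⟨⟨a3, a4⟩, r2⟩)
    have f3 := hφ2 _ ((memS _).2 ⟨⟨a5, a6⟩, r3⟩)
    have g1 := hφ1 x
    have g2 := hφ1 (x + d)
    have g3 := hφ1 (x + d + i * d)
    have hd : (Y : ℤ) ∣ φ (x + d + i * d) - ((1 + i) * φ (x + d) - i * φ x) := by
      have := (((g2.mul_left (1 + i)).sub (g1.mul_left i))).sub g3
      exact dvd_of_eq_of_dvd' (by ring) this
    have habs : |φ (x + d + i * d) - ((1 + i) * φ (x + d) - i * φ x)| < Y := by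
      push_cast at f1 f2 f3
      have b1 := abs_lt.1 (show |(2 * k + 2 : ℤ) * φ x| < Y by
        rw [abs_mul, abs_of_pos (by omega)]; exact f1)
      have b2 := abs_lt.1 (show |(2 * k + 2 : ℤ) * φ (x + d)| < Y by
        rw [abs_mul, abs_of_pos (by omega)]; exact f2)
      have b3 := abs_lt.1 (show |(2 * k + 2 : ℤ) * φ (x + d + i * d)| < Y by
        rw [abs_mul, abs_of_pos (by omega)]; exact f3)
      generalize φ (x + d + i * d) = t3 at *
      generalize φ (x + d) = t2 at *
      generalize φ x = t1 at *
      have hK : (0 : ℤ) < 2 * k + 2 := by omega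
      have key : |(2 * k + 2 : ℤ) * (t3 - ((1 + i) * t2 - i * t1))| < (2 * k + 2) * Y := by
        rw [abs_lt]
        constructor <;> nlinarith
      rw [abs_mul, abs_of_pos hK] at key
      exact lt_of_mul_lt_mul_left key hK.le
    have := Int.eq_zero_of_abs_lt_dvd hd habs
    linarith)
  -- two reds far apart
  obtain ⟨r1, p1, p2, p3, _⟩ := h.succ (k * (M + 1))
  obtain ⟨r2, t1, t2, t3, _⟩ := h.succ (r1 + M)
  have hL : (k : ℤ) * (M + 1) = k * M + k := by ring
  have hw1 : r1 ≤ T * M - k * (M + 1) := by nlinarith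
  have hw2 : r2 ≤ T * M - k * (M + 1) := by nlinarith
  have hs : |s| < 1 := by
    have l1 := hlin r1 p3 p1.le hw1
    have l2 := hlin r2 t3 (by omega) hw2
    have f1 := hφ2 _ ((memS r1).2 ⟨⟨by omega, by linarith⟩, p3⟩)
    have f2 := hφ2 _ ((memS r2).2 ⟨⟨by omega, by linarith⟩, t3⟩)
    have d1 : |φ r2 - φ r1| < Y := by
      have := abs_sub (φ r2) (φ r1)
      push_cast at f1 f2
      have n1 := abs_nonneg (φ r1)
      have n2 := abs_nonneg (φ r2)
      nlinarith
    have d2 : ((φ r2 - φ r1 : ℤ) : ℚ) = s * ((r2 - r1 : ℤ) : ℚ) := by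
      push_cast; rw [l1, l2]; ring
    have d3 : (Y : ℚ) ≤ ((r2 - r1 : ℤ) : ℚ) := by
      have : (Y : ℤ) ≤ r2 - r1 := by omega
      exact_mod_cast this
    have d4 : |((φ r2 - φ r1 : ℤ) : ℚ)| < Y := by exact_mod_cast d1
    rw [d2, abs_mul] at d4
    by_contra hc
    push Not at hc
    have d5 : (0 : ℚ) < Y := by exact_mod_cast hY0
    rw [abs_of_pos (lt_of_lt_of_le d5 d3)] at d4
    nlinarith
  rw [abs_lt] at hs
  -- the modulus
  set P : ℤ := s.num with hP
  set Q : ℤ := (s.den : ℤ) with hQ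
  have hQ0 : 0 < Q := by have := s.den_pos; omega
  have hsPQ : s * Q = P := by
    have := Rat.mul_den_eq_num s
    exact_mod_cast this
  set m : ℤ := Q * j - P with hm
  set N : ℤ := Q * Y with hN
  have hN0 : 0 < N := mul_pos hQ0 hY0
  have hm0 : 0 < m := by
    have : (0 : ℚ) < Q := by exact_mod_cast hQ0
    have hj1' : (1 : ℚ) ≤ j := by exact_mod_cast hj1
    have : (0 : ℚ) < m := by
      rw [hm]; push_cast; rw [← hsPQ]; nlinarith [hs.2]
    exact_mod_cast this
  have hmN : m < N := by
    have : (0 : ℚ) < Q := by exact_mod_cast hQ0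
    have hj1' : (j : ℚ) + 1 ≤ Y := by exact_mod_cast hjY
    have : (m : ℚ) < N := by
      rw [hm, hN]; push_cast; rw [← hsPQ]; nlinarith [hs.1]
    exact_mod_cast this
  have hdvd : ∀ r r', R r → R r' → k * (M + 1) ≤ r → r ≤ T * M - k * (M + 1) →
      k * (M + 1) ≤ r' → r' ≤ T * M - k * (M + 1) → N ∣ m * (r - r') := by
    intro r r' hr hr' a1 a2 a3 a4
    have l1 := hlin r hr a1 a2
    have l2 := hlin r' hr' a3 a4
    have e : Q * (φ r - φ r') = P * (r - r') := by
      have : (Q : ℚ) * (φ r - φ r') = P * (r - r') := by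
        rw [l1, l2, ← hsPQ]; ring
      exact_mod_cast this
    have := mul_dvd_mul_left Q ((hφ1 r).sub (hφ1 r'))
    rw [hN]
    exact dvd_of_eq_of_dvd' (by rw [hm]; linear_combination e) this
  set g : ℕ := Int.gcd N m with hg
  have hgN : (g : ℤ) ∣ N := Int.gcd_dvd_left N m
  obtain ⟨D, hD⟩ := hgN
  have hg0 : (0 : ℤ) < g := by
    have : 0 < g := Int.gcd_pos_of_ne_zero_left _ hN0.ne'
    exact_mod_cast this
  have hDpos : 0 < D := by
    by_contra hc
    push Not at hc
    nlinarith
  have hgm : (g : ℤ) ≤ m := Int.le_of_dvd hm0 (Int.gcd_dvd_right N m)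
  have hD1 : 1 < D := by
    by_contra hc
    have : D = 1 := by omega
    rw [this] at hD
    omega
  have hDdvd : ∀ z, N ∣ m * z → D ∣ z := by
    intro z hz
    obtain ⟨m', hm'⟩ := Int.gcd_dvd_right N m
    have hcop : IsCoprime D m' := by
      have := Int.gcd_div_gcd_div_gcd (i := N) (j := m) (by
        have : 0 < g := by exact_mod_cast hg0
        exact this)
      rw [Int.isCoprime_iff_gcd_eq_one]
      rw [← hg] at this hm'
      rw [hD] at this
      conv at this => lhs; arg 2; rw [hm']
      rwa [Int.mul_ediv_cancel_left _ hg0.ne', Int.mul_ediv_cancel_left _ hg0.ne'] at this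
    rw [← hg] at hm'
    rw [hD, hm', mul_assoc] at hz
    have := Int.dvd_of_mul_dvd_mul_left hg0.ne' hz
    exact hcop.dvd_of_dvd_mul_left this
  obtain ⟨q, hq, hqD⟩ := Nat.exists_prime_and_dvd (n := D.natAbs) (by omega)
  refine ⟨q, hq, fun r r' a1 a2 a3 a4 a5 a6 => ?_⟩
  exact (Int.natCast_dvd.2 hqD).trans (hDdvd _ (hdvd r r' a1 a2 a3 a4 a5 a6))

theorem Sys.false (h : Sys k M p R) {w T Y : ℕ} (hw : k * w ≤ M) (hT : 6 * k + 4 ≤ T)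
    (n : ℕ) (hTn : T * M ≤ n * w)
    (hY : Y = (2 * k + 2) ^ ((k + 2) ^ n) + 1) (hYM : Y ≤ M) (hkM : k ≤ M) : False := by
  obtain ⟨q, hq, hcong⟩ := h.congr hw hT n hTn hY hYM
  have hk1 : (1 : ℤ) ≤ k := by exact_mod_cast h.hk
  have hM1 : (1 : ℤ) ≤ M := by omega
  have hT' : (6 * k + 4 : ℤ) ≤ T := by exact_mod_cast hT
  have hTM : (6 * k + 4 : ℤ) * M ≤ T * M := by gcongr
  have hkMM : (k : ℤ) ≤ k * M := by nlinarith
  obtain ⟨r1, p1, p2, p3, _⟩ := h.succ (k * (M + 1))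
  have hL : (k : ℤ) * (M + 1) = k * M + k := by ring
  have hL0 : 0 ≤ (k : ℤ) * M := by positivity
  have hw1 : r1 ≤ T * M - k * (M + 1) := by nlinarith
  have hq2 := hq.two_le
  by_cases hqk : q ≤ k
  · -- a long blue progression
    have hpq : ¬ (p : ℤ) ∣ (q : ℤ) := h.ndvd (by omega) (by omega)
    obtain ⟨x, hx1, hx2, hx3⟩ : ∃ x : ℤ, k * (M + 1) ≤ x ∧ x ≤ k * (M + 1) + 1 ∧
        ¬ (q : ℤ) ∣ r1 - x := by
      by_cases h1 : (q : ℤ) ∣ r1 - k * (M + 1)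
      · refine ⟨k * (M + 1) + 1, by omega, le_rfl, fun h2 => ?_⟩
        have := h1.sub h2
        have e : r1 - k * (M + 1) - (r1 - (k * (M + 1) + 1)) = (1 : ℤ) := by ring
        rw [e] at this
        have := Int.le_of_dvd one_pos this
        omega
      · exact ⟨_, le_rfl, by omega, h1⟩
    obtain ⟨i, i1, i2, i3⟩ := h.run x q hpq
    have hiq : i * q ≤ M * k := mul_le_mul i2 (by exact_mod_cast hqk) (by positivity) (by positivity)
    have hiq0 : 0 ≤ i * q := by positivity
    have := hcong r1 (x + i * q) p3 i3 p1.le hw1 (by omega) (by nlinarith)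
    apply hx3
    have := this.add (Dvd.intro_left i rfl : (q : ℤ) ∣ i * q)
    exact dvd_of_eq_of_dvd' (by ring) this
  · push Not at hqk
    have key : ∀ n : ℕ, ∀ z, R z → k * (M + 1) ≤ z → z ≤ T * M - k * (M + 1) + n →
        (q : ℤ) ∣ z - r1 := by
      intro n
      induction n with
      | zero =>
        intro z hz h1 h2
        exact hcong z r1 hz p3 h1 (by simpa using h2) p1.le hw1
      | succ n ih =>
        intro z hz h1 h2
        push_cast at h2
        by_cases h3 : z ≤ T * M - k * (M + 1) + n
        · exact ih z hz h1 h3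
        obtain ⟨b, b1, b2, b3, b4⟩ := h.pred z
        obtain ⟨i, i1, i2, i3⟩ := h.ruleL b1 b2 b3 hz
        have ile : i * (z - b) ≤ k * (M + 1) := mul_le_mul i2 (by omega) (by omega) (by omega)
        have ipos : 0 < i * (z - b) := mul_pos (by omega) (by omega)
        have hbig : k * (M + 1) + k * (M + 1) + (M + 1) ≤ z := by nlinarith
        have e1 := ih b b3 (by omega) (by omega)
        have e2 := ih _ i3 (by omega) (by omega)
        have e3 := e1.sub e2
        have e4 : b - r1 - (b - i * (z - b) - r1) = i * (z - b) := by ring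
        rw [e4] at e3
        have hqp : Prime (q : ℤ) := Nat.prime_iff_prime_int.1 hq
        rcases hqp.dvd_or_dvd e3 with h5 | h5
        · have := Int.le_of_dvd (by omega) h5
          omega
        · have := h5.add e1
          exact dvd_of_eq_of_dvd' (by ring) this
    have key' : ∀ z, R z → k * (M + 1) ≤ z → (q : ℤ) ∣ z - r1 := fun z hz h1 =>
      key (z - (T * M - k * (M + 1))).toNat z hz h1 (by omega)
    have h1 := key' (r1 + p) (h.per _ p3) (by omega)
    rw [add_sub_cancel_left] at h1
    have h2 : q = p := (Nat.prime_dvd_prime_iff_eq hq h.hp).1 (by exact_mod_cast h1)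
    obtain ⟨r2, s1, s2, s3, _⟩ := h.succ r1
    have h3 := key' r2 s3 (by omega)
    rw [h2] at h3
    exact h.ndvd (by omega) (by omega) h3

end TwoRed
end

section
namespace TwoRed

theorem findable_two (k : ℕ) : Findable 2 (k + 1) := by
  classical
  intro δ hδ
  set K := k + 1 with hK
  set T := 6 * K + 4 with hT
  set n := 2 * K * T with hn
  set Y := (2 * K + 2) ^ ((K + 2) ^ n) + 1 with hY
  set M0 := max K Y with hM0
  obtain ⟨p₁, hp₁⟩ := DHJ.szemeredi M0 δ hδ
  refine ⟨max p₁ (⌈2 / δ⌉₊), ?_⟩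
  intro p hp hpp A hA hAc
  by_contra hno
  haveI : Fact p.Prime := ⟨hp⟩
  have hpδ : 2 ≤ δ * p := by
    have h1 : (⌈2 / δ⌉₊ : ℝ) ≤ p := by exact_mod_cast (le_max_right _ _).trans hpp
    have h2 := (Nat.le_ceil (2 / δ)).trans h1
    rw [div_le_iff₀ hδ] at h2
    linarith
  have hcard : 2 ≤ A.ncard := by
    have : (2 : ℝ) ≤ Nat.card A := hpδ.trans hA
    have h2 : 2 ≤ Nat.card A := by exact_mod_cast this
    rwa [Nat.card_coe_set_eq] at h2
  set P : ℕ → Prop := fun m => ∃ x d : ZMod p, d ≠ 0 ∧ ∀ i : ℕ, i < m → x + (i : ZMod p) * d ∉ A with hP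
  have hPM0 : P M0 := by
    obtain ⟨x, d, hd, h⟩ := hp₁ p hp ((le_max_left _ _).trans hpp) Aᶜ hAc
    exact ⟨x, d, hd, fun i hi => h i hi⟩
  have hmono : ∀ m m', m ≤ m' → P m' → P m := by
    rintro m m' hmm ⟨x, d, hd, h⟩
    exact ⟨x, d, hd, fun i hi => h i (by omega)⟩
  have hPp : ¬ P (p - 1) := by
    rintro ⟨x, d, hd, h⟩
    obtain ⟨a, ha, a', ha', hne⟩ := (Set.one_lt_ncard).1 (show 1 < A.ncard by omega)
    have key : ∀ a ∈ A, ((a - x) / d).val = p - 1 := by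
      intro a ha
      have h1 := ZMod.val_lt ((a - x) / d)
      by_contra hc
      apply h ((a - x) / d).val (by omega)
      rw [ZMod.natCast_zmod_val, div_mul_cancel₀ _ hd]
      simpa using ha
    have h2 := ZMod.val_injective p ((key a ha).trans (key a' ha').symm)
    field_simp at h2
    exact hne (by simpa using h2)
  have hp2 := hp.two_le
  set M := Nat.findGreatest P (p - 2) with hM
  have hM0p : M0 ≤ p - 2 := by
    by_contra hc
    exact hPp (hmono _ _ (by omega) hPM0)
  have hPM : P M := Nat.findGreatest_spec hM0p hPM0
  have hMM0 : M0 ≤ M := Nat.le_findGreatest hM0p hPM0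
  have hMle : M ≤ p - 2 := Nat.findGreatest_le _
  have hPM1 : ¬ P (M + 1) := by
    intro h
    rcases Nat.lt_or_ge (p - 2) (M + 1) with h1 | h1
    · exact hPp (hmono _ _ (by omega) h)
    · have := Nat.le_findGreatest h1 h
      omega
  obtain ⟨x, d, hd, hrun⟩ := hPM
  have he : x + (M : ZMod p) * d ∈ A := by
    by_contra hc
    refine hPM1 ⟨x, d, hd, fun i hi => ?_⟩
    rcases Nat.lt_or_ge i M with h1 | h1
    · exact hrun i h1
    · have : i = M := by omega
      rw [this]; exact hc
  set e := x + (M : ZMod p) * d with hee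
  have hcast : ∀ a : ℤ, ¬ (p : ℤ) ∣ a → (a : ZMod p) * d ≠ 0 := by
    intro a ha
    refine mul_ne_zero ?_ hd
    rwa [Ne, ZMod.intCast_zmod_eq_zero_iff_dvd]
  have hsys : Sys K M p (fun j : ℤ => e + (j : ZMod p) * d ∈ A) := by
    refine ⟨by omega, hp, by omega, ?_, ?_, ?_, ?_, ?_⟩
    · intro y hy
      simpa using hy
    · intro y d' hd' h1 h2
      by_contra hc
      push Not at hc
      refine hno ⟨e + (y : ZMod p) * d, (d' : ZMod p) * d, hcast _ hd', ?_, ?_⟩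
      · intro i hi
        interval_cases i
        · simpa using h1
        · convert h2 using 1
          push_cast; ring
      · intro i hi hi2
        have := hc ((i : ℤ) - 1) (by omega) (by omega)
        convert this using 2
        push_cast; ring
    · intro y a ha
      by_contra hc
      push Not at hc
      refine hPM1 ⟨e + (y : ZMod p) * d, (a : ZMod p) * d, hcast _ ha, fun i hi => ?_⟩
      have := hc i (by omega) (by omega)
      convert this using 2
      push_cast; ring
    · simpa using he
    · intro j h1 h2
      have := hrun (M - j.toNat) (by omega)
      convert this using 2
      rw [hee, Nat.cast_sub (by omega)]
      have : ((j.toNat : ℕ) : ZMod p) = (j : ZMod p) := by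
        have h3 : ((j.toNat : ℕ) : ℤ) = j := Int.toNat_of_nonneg (by omega)
        exact_mod_cast congrArg (fun z : ℤ => (z : ZMod p)) h3
      rw [this]
      push_cast; ring
  have hKM : K ≤ M := (le_max_left _ _).trans hMM0
  have hdm := Nat.div_add_mod M K
  have hml := Nat.mod_lt M (show 0 < K by omega)
  have hw1 : 1 ≤ M / K := (Nat.one_le_div_iff (by omega)).2 hKM
  refine hsys.false (w := M / K) (T := T) (Y := Y) (by omega) le_rfl n ?_ hY
    ((le_max_right _ _).trans hMM0) hKM
  rw [hn]
  have : M ≤ 2 * K * (M / K) := by nlinarith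
  calc T * M ≤ T * (2 * K * (M / K)) := Nat.mul_le_mul_left _ this
    _ = 2 * K * T * (M / K) := by ring

end TwoRed
end

section
namespace ThreeRed

/-- binary digits read in base four -/
def bf : ℕ → ℕ
  | 0 => 0
  | n + 1 => 4 * bf ((n + 1) / 2) + (n + 1) % 2
decreasing_by omega

theorem bf_eq (n : ℕ) : bf n = 4 * bf (n / 2) + n % 2 := by
  cases n with
  | zero => simp [bf]
  | succ n => rw [bf]

theorem bf_le (n : ℕ) : bf n ≤ n ^ 2 := by
  induction n using Nat.strong_induction_on with
  | _ n ih =>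
    rcases Nat.eq_zero_or_pos n with rfl | hn
    · simp [bf]
    · rw [bf_eq]
      have := ih (n / 2) (by omega)
      have h1 := Nat.div_add_mod n 2
      have h2 : n % 2 < 2 := Nat.mod_lt _ (by norm_num)
      set q := n / 2
      set e := n % 2
      have : e ≤ e ^ 2 := by interval_cases e <;> norm_num
      rw [← h1]
      nlinarith

theorem bf_ap (a b c : ℕ) (h : bf a + bf c = 2 * bf b) : a = b ∧ b = c := by
  induction b using Nat.strong_induction_on generalizing a c with
  | _ b ih =>
    rw [bf_eq a, bf_eq b, bf_eq c] at h
    rcases Nat.eq_zero_or_pos b with rfl | hb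
    · have key : ∀ n, bf n = 0 → n = 0 := by
        intro n
        induction n using Nat.strong_induction_on with
        | _ n ih =>
          intro hn
          rw [bf_eq] at hn
          by_contra h0
          have := ih (n / 2) (by omega) (by omega)
          omega
      have h0 : bf (0 / 2) = 0 := by simp [bf]
      have ha := key (a / 2) (by omega)
      have hc := key (c / 2) (by omega)
      omega
    · have := ih (b / 2) (by omega) (a / 2) (c / 2) (by omega)
      omega

/-- greedy choice -/
theorem greedy {Φ : Type*} (w : ℕ) (n : ℕ) (S : Finset Φ) (f : Φ → ℕ → ℕ)
    (hf : ∀ φ ∈ S, ∀ β, β < n → f φ β < w) (hS : S.card * (w - 1) ^ n < w ^ n) :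
    ∃ c : ℕ → ℕ, (∀ β, β < n → c β < w) ∧ ∀ φ ∈ S, ∃ β, β < n ∧ f φ β = c β := by
  classical
  induction n generalizing S with
  | zero =>
    refine ⟨fun _ => 0, by omega, ?_⟩
    intro φ hφ
    have : 0 < S.card := Finset.card_pos.2 ⟨φ, hφ⟩
    simp at hS
    subst hS
    simp at hφ
  | succ n ih =>
    have hw : 0 < w := by
      rcases Nat.eq_zero_or_pos w with rfl | h
      · simp at hS
      · exact h
    obtain ⟨c0, hc0, hc⟩ : ∃ c0 ∈ Finset.range w, S.card ≤ w * (S.filter (fun φ => f φ n = c0)).card := by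
      by_contra hcon
      push Not at hcon
      have h1 : S.card = ∑ c ∈ Finset.range w, (S.filter (fun φ => f φ n = c)).card :=
        Finset.card_eq_sum_card_fiberwise (fun φ hφ => by simpa using hf φ hφ n (by omega))
      have h2 : w * S.card < w * S.card := by
        conv_lhs => rw [h1, Finset.mul_sum]
        calc _ < ∑ c ∈ Finset.range w, S.card :=
              Finset.sum_lt_sum_of_nonempty (by simpa using hw.ne') hcon
          _ = w * S.card := by simp
      omega
    have hcc := Finset.card_filter_add_card_filter_not (s := S) (fun φ => f φ n = c0)
    set S' := S.filter (fun φ => ¬ f φ n = c0) with hS'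
    have hle : w * S'.card ≤ S.card * (w - 1) := by
      obtain ⟨v, rfl⟩ : ∃ v, w = v + 1 := ⟨w - 1, by omega⟩
      simp only [Nat.add_sub_cancel]
      nlinarith
    obtain ⟨c, h1, h2⟩ := ih S' (fun φ hφ β hβ => hf φ (Finset.mem_filter.1 hφ).1 β (by omega)) (by
      have : w * (S'.card * (w - 1) ^ n) < w * w ^ n := by
        calc w * (S'.card * (w - 1) ^ n) = (w * S'.card) * (w - 1) ^ n := by ring
          _ ≤ (S.card * (w - 1)) * (w - 1) ^ n := Nat.mul_le_mul_right _ hle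
          _ = S.card * (w - 1) ^ (n + 1) := by ring
          _ < _ := hS
          _ = w * w ^ n := by ring
      exact Nat.lt_of_mul_lt_mul_left this)
    refine ⟨fun β => if β = n then c0 else c β, ?_, ?_⟩
    · intro β hβ
      dsimp only
      split_ifs with h
      · simpa using hc0
      · exact h1 β (by omega)
    · intro φ hφ
      by_cases hh : f φ n = c0
      · exact ⟨n, by omega, by simp [hh]⟩
      · obtain ⟨β, hβ, he⟩ := h2 φ (Finset.mem_filter.2 ⟨hφ, hh⟩)
        refine ⟨β, by omega, ?_⟩
        have : β ≠ n := by omega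
        simp only [this, if_false]
        exact he

theorem growth (C : ℕ) : ∃ n : ℕ, 10 ≤ n ∧ C * n ^ 4 * (32768 - 1) ^ n < 32768 ^ n := by
  have h := tendsto_pow_const_mul_const_pow_of_abs_lt_one 4 (r := (32767 : ℝ) / 32768)
    (by rw [abs_of_pos (by norm_num)]; norm_num)
  have h2 := (h.const_mul (C : ℝ))
  rw [mul_zero] at h2
  have h3 := (h2.eventually (gt_mem_nhds (show (0 : ℝ) < 1 by norm_num))).and
    (Filter.eventually_ge_atTop 10)
  obtain ⟨n, hn, hn2⟩ := h3.exists
  refine ⟨n, hn2, ?_⟩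
  rw [div_pow, ← mul_assoc, ← mul_div_assoc, div_lt_one (by positivity)] at hn
  have : (32768 - 1 : ℕ) = 32767 := by norm_num
  rw [this]
  exact_mod_cast hn

/-- hitting the blocks -/
theorem hit_block (Q D Y a : ℤ) (g : ℕ) (hQ : 0 < Q) (hD1 : 4096 * Q ≤ D) (hD2 : D ≤ 32768 * Q)
    (hY : 0 ≤ Y) (hYa : Y ≤ a * Q) (hg : 3 ≤ g) (hag : a ≤ 2144 * g) :
    ∃ m : ℕ, m ≤ g ∧ a * Q ≤ Y + m * D ∧ Y + m * D < (a + 32768) * Q := by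
  have hD0 : 0 < D := by linarith
  set q : ℤ := (a * Q - Y + (D - 1)) / D with hq
  have h1 : q * D ≤ a * Q - Y + (D - 1) := Int.ediv_mul_le _ hD0.ne'
  have h2 : a * Q - Y + (D - 1) < (q + 1) * D := Int.lt_ediv_add_one_mul_self _ hD0
  have hq0 : 0 ≤ q := Int.ediv_nonneg (by linarith) hD0.le
  have hqg : q ≤ g := by
    by_contra hc
    push Not at hc
    have h3 : ((g : ℤ)) * D ≤ (q - 1) * D := by gcongr; omega
    have h4 : (g : ℤ) * (4096 * Q) ≤ g * D := by gcongr
    have h5 : (a * Q : ℤ) ≤ 2144 * g * Q := by gcongr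
    have h6 : 0 < (g : ℤ) * Q := by positivity
    nlinarith
  refine ⟨q.toNat, by omega, ?_, ?_⟩
  · rw [Int.toNat_of_nonneg hq0]; linarith
  · rw [Int.toNat_of_nonneg hq0]; linarith

theorem exists_T : ∃ (g : ℕ) (T : ℤ → Prop), 100 ≤ g ∧
    (∀ t, T t → 2112 * g ≤ t ∧ t ≤ 2144 * g) ∧
    (∀ t1 t2 t3, T t1 → T t2 → T t3 → |t1 + t3 - 2 * t2| ≤ 16 → t1 = t2 ∧ t2 = t3) ∧
    (∀ u D Y : ℤ, 0 < u → 4096 * u ≤ D → D < 32768 * u → 0 ≤ Y → Y ≤ 5 * D →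
      ∃ m : ℕ, m ≤ g ∧ ∃ t, T t ∧ t * u ≤ Y + m * D ∧ Y + m * D < (t + 2) * u) := by
  classical
  obtain ⟨n, hn, hgr⟩ := growth (32769 * 163841 * 100000 ^ 2)
  obtain ⟨w, hw⟩ : ∃ w : ℕ, w = 32768 := ⟨_, rfl⟩
  rw [← hw] at hgr
  set W : ℕ := 70000 with hW
  set g : ℕ := 80000 * n ^ 2 with hg
  set Q : ℕ := g + 1 with hQ
  have hn2 : 100 ≤ n ^ 2 := by nlinarith
  set S : Finset (ℤ × ℤ) := Finset.Icc (4096 * (Q : ℤ)) (32768 * Q) ×ˢ Finset.Icc 0 (163840 * (Q : ℤ)) with hS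
  have hcard : S.card ≤ 32769 * 163841 * 100000 ^ 2 * n ^ 4 := by
    rw [hS, Finset.card_product, Int.card_Icc, Int.card_Icc]
    have h1 : (32768 * (Q : ℤ) + 1 - 4096 * Q).toNat ≤ 32769 * Q := by omega
    have h2 : (163840 * (Q : ℤ) + 1 - 0).toNat ≤ 163841 * Q := by omega
    have h3 : Q ≤ 100000 * n ^ 2 := by omega
    calc _ ≤ (32769 * Q) * (163841 * Q) := Nat.mul_le_mul h1 h2
      _ ≤ (32769 * (100000 * n ^ 2)) * (163841 * (100000 * n ^ 2)) := by gcongr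
      _ = _ := by ring
  clear_value S
  set a : ℕ → ℤ := fun β => 2112 * g + W * bf β with ha
  have hbf : ∀ β, β < n → (bf β : ℤ) ≤ n ^ 2 := by
    intro β hβ
    have := bf_le β
    have h2 : β ^ 2 ≤ n ^ 2 := Nat.pow_le_pow_left hβ.le 2
    exact_mod_cast this.trans h2
  have hgZ : (g : ℤ) = 80000 * n ^ 2 := by rw [hg]; push_cast; ring
  have hn2Z : (100 : ℤ) ≤ n ^ 2 := by exact_mod_cast hn2
  have hQ0 : (0 : ℤ) < Q := by omega
  have key : ∀ φ : ℤ × ℤ, ∀ β : ℕ, ∃ c : ℕ, φ ∈ S → β < n → c < w ∧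
      ∃ m : ℕ, m ≤ g ∧ (a β + c) * Q ≤ φ.2 + m * φ.1 ∧ φ.2 + m * φ.1 < (a β + c + 1) * Q := by
    intro φ β
    by_cases h : φ ∈ S ∧ β < n
    · obtain ⟨h, hβ⟩ := h
      rw [hS, Finset.mem_product, Finset.mem_Icc, Finset.mem_Icc] at h
      have hb := hbf β hβ
      have ha1 : a β ≤ 2144 * g := by simp only [ha, hW]; push_cast; omega
      have ha0 : 163840 ≤ a β := by simp only [ha, hW]; push_cast; omega
      obtain ⟨m, hm, h1, h2⟩ := hit_block Q φ.1 φ.2 (a β) g hQ0 h.1.1 h.1.2 h.2.1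
        (h.2.2.trans (by gcongr)) (by omega) ha1
      set z := φ.2 + m * φ.1 with hz
      have e1 : z / Q * Q ≤ z := Int.ediv_mul_le _ hQ0.ne'
      have e2 : z < (z / Q + 1) * Q := Int.lt_ediv_add_one_mul_self _ hQ0
      have e3 : a β ≤ z / Q := by
        rw [Int.le_ediv_iff_mul_le hQ0]; exact h1
      have e4 : z / Q < a β + 32768 := by
        rw [Int.ediv_lt_iff_lt_mul hQ0]; exact h2
      refine ⟨(z / Q - a β).toNat, fun _ _ => ⟨by omega, m, hm, ?_⟩⟩
      rw [Int.toNat_of_nonneg (by omega)]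
      simp only [add_sub_cancel]
      exact ⟨e1, e2⟩
    · exact ⟨0, fun h1 h2 => (h ⟨h1, h2⟩).elim⟩
  choose f hf using key
  obtain ⟨c, hc1, hc2⟩ := greedy w n S f (fun φ hφ β hβ => (hf φ β hφ hβ).1)
    (lt_of_le_of_lt (Nat.mul_le_mul_right _ hcard) hgr)
  refine ⟨g, fun t => ∃ β, β < n ∧ t = a β + c β, by omega, ?_, ?_, ?_⟩
  · rintro t ⟨β, hβ, rfl⟩
    have := hbf β hβ
    have := hc1 β hβ
    simp only [ha, hW]
    push_cast
    omega
  · rintro _ _ _ ⟨β1, h1, rfl⟩ ⟨β2, h2, rfl⟩ ⟨β3, h3, rfl⟩ habs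
    have c1 := hc1 β1 h1
    have c2 := hc1 β2 h2
    have c3 := hc1 β3 h3
    rw [abs_le] at habs
    simp only [ha, hW] at habs
    push_cast at habs
    obtain ⟨e1, e2⟩ := bf_ap β1 β2 β3 (by omega)
    subst e1 e2
    exact ⟨rfl, rfl⟩
  · intro u D Y hu hD1 hD2 hY1 hY2
    set D' := Q * D / u with hD'
    set Y' := Q * Y / u with hY'
    have d1 : D' * u ≤ Q * D := Int.ediv_mul_le _ hu.ne'
    have d2 : Q * D < (D' + 1) * u := Int.lt_ediv_add_one_mul_self _ hu
    have y1 : Y' * u ≤ Q * Y := Int.ediv_mul_le _ hu.ne'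
    have y2 : Q * Y < (Y' + 1) * u := Int.lt_ediv_add_one_mul_self _ hu
    have hmem : (D', Y') ∈ S := by
      rw [hS, Finset.mem_product, Finset.mem_Icc, Finset.mem_Icc]
      refine ⟨⟨?_, ?_⟩, ?_, ?_⟩
      · simp only
        rw [hD', Int.le_ediv_iff_mul_le hu]
        nlinarith
      · have : D' * u ≤ 32768 * Q * u := d1.trans (by nlinarith)
        exact le_of_mul_le_mul_right this hu
      · exact Int.ediv_nonneg (by positivity) hu.le
      · have : Y' * u ≤ 163840 * Q * u := y1.trans (by nlinarith)
        exact le_of_mul_le_mul_right this hu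
    obtain ⟨β, hβ, he⟩ := hc2 _ hmem
    obtain ⟨_, m, hm, h1, h2⟩ := hf _ β hmem hβ
    rw [he] at h1 h2
    simp only at h1 h2
    refine ⟨m, hm, a β + c β, ⟨β, hβ, rfl⟩, ?_, ?_⟩
    · set t := a β + c β
      have : t * u * Q ≤ (Y + m * D) * Q := by
        have k1 : t * Q * u ≤ (Y' + m * D') * u := by gcongr
        have k2 : m * (D' * u) ≤ m * (Q * D) := by gcongr
        nlinarith
      exact le_of_mul_le_mul_right this hQ0
    · set t := a β + c β
      have : (Y + m * D) * Q < (t + 2) * u * Q := by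
        have k1 : (Y' + m * D') * u ≤ (t + 1) * Q * u := by gcongr
        have k2 : m * (Q * D) ≤ m * ((D' + 1) * u) := by gcongr
        have k3 : (m + 1 : ℤ) * u ≤ Q * u := by gcongr; omega
        nlinarith
      exact lt_of_mul_lt_mul_right this hQ0.le

end ThreeRed
end

section
namespace ThreeRed

/-- one level of the construction -/
def InS (h : ℕ) (F : ℕ → ℤ → Prop) (T : ℤ → Prop) (σ τ : ℤ) (j : ℕ) (x : ℤ) : Prop :=
  ∃ t, T t ∧ ((t * 8 ^ j ≤ x ∧ x < (t + 2) * 8 ^ j) ∨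
    (∃ i, (i + h < j ∨ (t = τ ∧ i ≤ j)) ∧ F i (x - (t + 2) * 8 ^ j)) ∨
    (∃ i, (i + h < j ∨ (t = σ ∧ i ≤ j)) ∧ F i (t * 8 ^ j - 1 - x)))

/-- properties of the smaller levels -/
structure Fam (g K : ℕ) (F : ℕ → ℤ → Prop) (j : ℕ) : Prop where
  loc : ∀ i ≤ j, ∀ y, F i y → 2047 * g * 8 ^ i ≤ 4096 * y ∧ 4096 * y < 2306 * g * 8 ^ i
  hit : ∀ i ≤ j, 4 ≤ i → ∀ D Y : ℤ, 8 ^ i ≤ D → D < 8 ^ (i + 1) → 0 ≤ Y → Y ≤ 5 * D →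
    ∃ m : ℕ, m ≤ g ∧ F i (Y + m * D)
  closed : ∀ i ≤ j, ∀ x d : ℤ, 4096 ≤ |d| → F i x → F i (x + d) → F i (x + 2 * d) →
    ∃ m : ℕ, 3 ≤ m ∧ m ≤ K ∧ F i (x + m * d)

/-- the layout of a level -/
structure Cfg (g h : ℕ) (T : ℤ → Prop) (σ τ : ℤ) : Prop where
  hg : 100 ≤ g
  hgh : g ≤ 8 ^ h
  sep : ∀ t t', T t → T t' → t < t' → t + 9 ≤ t'
  mn : ∀ t, T t → σ ≤ t
  mx : ∀ t, T t → t ≤ τ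
  hs : T σ
  ht : T τ
  len : τ - σ = 256 * g

variable {g h K : ℕ} {F : ℕ → ℤ → Prop} {T : ℤ → Prop} {σ τ : ℤ} {j : ℕ}

theorem Cfg.mirror (c : Cfg g h T σ τ) : Cfg g h (fun t => T (-2 - t)) (-2 - τ) (-2 - σ) where
  hg := c.hg
  hgh := c.hgh
  sep := fun t t' h1 h2 h3 => by
    have := c.sep _ _ h2 h1 (by omega)
    omega
  mn := fun t h1 => by have := c.mx _ h1; omega
  mx := fun t h1 => by have := c.mn _ h1; omega
  hs := by simpa using c.ht
  ht := by simpa using c.hs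
  len := by have := c.len; omega

theorem InS.mirror {x : ℤ} (hx : InS h F T σ τ j x) :
    InS h F (fun t => T (-2 - t)) (-2 - τ) (-2 - σ) j (-1 - x) := by
  obtain ⟨t, ht, hx⟩ := hx
  refine ⟨-2 - t, by simpa using ht, ?_⟩
  have e1 : (-2 - t) * (8 : ℤ) ^ j = - ((t + 2) * 8 ^ j) := by ring
  have e2 : (-2 - t + 2) * (8 : ℤ) ^ j = - (t * 8 ^ j) := by ring
  rw [e1, e2]
  rcases hx with ⟨h1, h2⟩ | ⟨i, h1, h2⟩ | ⟨i, h1, h2⟩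
  · left; omega
  · right; right
    refine ⟨i, ?_, ?_⟩
    · rcases h1 with h1 | ⟨h1, h3⟩
      · exact Or.inl h1
      · exact Or.inr ⟨by omega, h3⟩
    · convert h2 using 1; ring
  · right; left
    refine ⟨i, ?_, ?_⟩
    · rcases h1 with h1 | ⟨h1, h3⟩
      · exact Or.inl h1
      · exact Or.inr ⟨by omega, h3⟩
    · convert h2 using 1; ring

theorem InS.of_mirror {x : ℤ} (hx : InS h F (fun t => T (-2 - t)) (-2 - τ) (-2 - σ) j (-1 - x)) :
    InS h F T σ τ j x := by
  have := hx.mirror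
  simpa using this

theorem Cfg.gu (c : Cfg g h T σ τ) {i : ℕ} (hi : i + h < j) : (g : ℤ) * 8 ^ i * 8 ≤ 8 ^ j := by
  have h1 : (g : ℤ) ≤ 8 ^ h := by exact_mod_cast c.hgh
  calc (g : ℤ) * 8 ^ i * 8 ≤ 8 ^ h * 8 ^ i * 8 := by gcongr
    _ = 8 ^ (i + h + 1) := by ring
    _ ≤ 8 ^ j := pow_le_pow_right₀ (by norm_num) hi

theorem Fam.small (f : Fam g K F j) (c : Cfg g h T σ τ) {i : ℕ} (hi : i + h < j) {y : ℤ}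
    (hy : F i y) : 0 ≤ y ∧ y < 8 ^ j := by
  obtain ⟨h1, h2⟩ := f.loc i (by omega) y hy
  have := c.gu hi
  have h3 : (0 : ℤ) ≤ g * 8 ^ i := by positivity
  constructor <;> nlinarith

theorem Fam.big (f : Fam g K F j) {i : ℕ} (hi : i ≤ j) {y : ℤ}
    (hy : F i y) : 0 ≤ y ∧ y < g * 8 ^ j := by
  obtain ⟨h1, h2⟩ := f.loc i hi y hy
  have h3 : (0 : ℤ) ≤ g * 8 ^ i := by positivity
  have h4 : (g : ℤ) * 8 ^ i ≤ g * 8 ^ j := by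
    gcongr
    norm_num
  constructor <;> nlinarith

theorem Fam.lac (f : Fam g K F j) {i i' : ℕ} (hi : i < i') (hi' : i' ≤ j) {y y' : ℤ}
    (hy : F i y) (hy' : F i' y') : 7 * y ≤ y' := by
  obtain ⟨h1, h2⟩ := f.loc i (by omega) y hy
  obtain ⟨h3, h4⟩ := f.loc i' hi' y' hy'
  have h5 : (g : ℤ) * 8 ^ i * 8 ≤ g * 8 ^ i' := by
    rw [mul_assoc, ← pow_succ]
    gcongr
    · norm_num
    · omega
  have h6 : (0 : ℤ) ≤ g * 8 ^ i := by positivity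
  nlinarith

/-- monotonicity of the child index -/
theorem Fam.mono (f : Fam g K F j) {i i' : ℕ} (hi : i ≤ j) {y y' : ℤ}
    (hy : F i y) (hy' : F i' y') (hlt : y < y') : i ≤ i' := by
  by_contra hc
  have h1 := f.lac (by omega) hi hy' hy
  have := (f.big (i := i') (by omega) hy').1
  omega

/-- an element just to the right of a solid is in its right fringe -/
theorem rightFringe (c : Cfg g h T σ τ) (f : Fam g K F j) {t x : ℤ} (ht : T t)
    (h1 : (t + 2) * 8 ^ j ≤ x) (h2 : x < (t + 4) * 8 ^ j ∨ t = τ) (hx : InS h F T σ τ j x) :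
    ∃ i, (i + h < j ∨ (t = τ ∧ i ≤ j)) ∧ F i (x - (t + 2) * 8 ^ j) := by
  obtain ⟨t', ht', hx⟩ := hx
  have hu : (0 : ℤ) < 8 ^ j := by positivity
  have hg : (100 : ℤ) ≤ g := by exact_mod_cast c.hg
  set u : ℤ := 8 ^ j with hu'
  rcases lt_trichotomy t t' with hlt | rfl | hlt
  · exfalso
    have hs := c.sep _ _ ht ht' hlt
    have hs' : (t + 9) * u ≤ t' * u := by gcongr
    have h3 : x < (t + 4) * u := by
      rcases h2 with h2 | h2
      · exact h2
      · have := c.mx _ ht'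
        omega
    rcases hx with ⟨a, b⟩ | ⟨i, a, b⟩ | ⟨i, a, b⟩
    · nlinarith
    · rcases a with a | ⟨_, a⟩
      · have := f.small c a b; nlinarith
      · have := f.big a b; nlinarith
    · rcases a with a | ⟨a', a⟩
      · have := f.small c a b; nlinarith
      · have := c.mn _ ht
        omega
  · rcases hx with ⟨a, b⟩ | h4 | ⟨i, a, b⟩
    · omega
    · exact h4
    · exfalso
      rcases a with a | ⟨a', a⟩
      · have := f.small c a b; nlinarith
      · have := f.big a b; nlinarith
  · exfalso
    have hs := c.sep _ _ ht' ht hlt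
    have hs' : (t' + 9) * u ≤ t * u := by gcongr
    rcases hx with ⟨a, b⟩ | ⟨i, a, b⟩ | ⟨i, a, b⟩
    · nlinarith
    · rcases a with a | ⟨a', a⟩
      · have := f.small c a b; nlinarith
      · have := c.mx _ ht
        omega
    · rcases a with a | ⟨a', a⟩
      · have := f.small c a b; nlinarith
      · have := f.big a b; nlinarith

theorem leftFringe (c : Cfg g h T σ τ) (f : Fam g K F j) {t x : ℤ} (ht : T t)
    (h1 : x < t * 8 ^ j) (h2 : (t - 2) * 8 ^ j ≤ x ∨ t = σ) (hx : InS h F T σ τ j x) :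
    ∃ i, (i + h < j ∨ (t = σ ∧ i ≤ j)) ∧ F i (t * 8 ^ j - 1 - x) := by
  obtain ⟨i, h3, h4⟩ := rightFringe c.mirror f (t := -2 - t) (x := -1 - x) (by simpa using ht)
    (by nlinarith) (by
      rcases h2 with h2 | h2
      · left; nlinarith
      · right; omega) hx.mirror
  refine ⟨i, ?_, ?_⟩
  · rcases h3 with h3 | ⟨h3, h5⟩
    · exact Or.inl h3
    · exact Or.inr ⟨by omega, h5⟩
  · convert h4 using 1; ring

theorem lower (c : Cfg g h T σ τ) (f : Fam g K F j) {x : ℤ} (hx : InS h F T σ τ j x) :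
    (σ - g) * 8 ^ j ≤ x := by
  obtain ⟨t, ht, hx⟩ := hx
  have hu : (0 : ℤ) < 8 ^ j := by positivity
  have hg : (100 : ℤ) ≤ g := by exact_mod_cast c.hg
  have h1 : (σ : ℤ) * 8 ^ j ≤ t * 8 ^ j := by have := c.mn _ ht; gcongr
  have h2 : (100 : ℤ) * 8 ^ j ≤ g * 8 ^ j := by gcongr
  rcases hx with ⟨a, b⟩ | ⟨i, a, b⟩ | ⟨i, a, b⟩
  · nlinarith
  · rcases a with a | ⟨a', a⟩
    · have := f.small c a b; nlinarith
    · have := f.big a b; nlinarith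
  · rcases a with a | ⟨a', a⟩
    · have := f.small c a b; nlinarith
    · have := f.big a b; nlinarith

theorem upper (c : Cfg g h T σ τ) (f : Fam g K F j) {x : ℤ} (hx : InS h F T σ τ j x) :
    x < (τ + 2 + g) * 8 ^ j := by
  have := lower c.mirror f hx.mirror
  nlinarith

theorem exists_scale (d : ℤ) (hd : 4096 ≤ d) :
    ∃ i : ℕ, 4 ≤ i ∧ (8 : ℤ) ^ i ≤ d ∧ d < 8 ^ (i + 1) := by
  obtain ⟨n, rfl⟩ : ∃ n : ℕ, d = n := ⟨d.toNat, by omega⟩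
  refine ⟨Nat.log 8 n, ?_, ?_, ?_⟩
  · apply Nat.le_log_of_pow_le (by norm_num)
    norm_num
    omega
  · exact_mod_cast Nat.pow_log_le_self 8 (by omega)
  · exact_mod_cast Nat.lt_pow_succ_log_self (by norm_num) n

theorem catch' (f : Fam g K F j) {t z d : ℤ} (ht : T t) {i : ℕ} (hi : i + h < j ∨ (t = τ ∧ i ≤ j))
    (hi4 : 4 ≤ i) (hd1 : 8 ^ i ≤ d) (hd2 : d < 8 ^ (i + 1)) (hz1 : (t + 2) * 8 ^ j ≤ z)
    (hz2 : z ≤ (t + 2) * 8 ^ j + 5 * d) : ∃ m : ℕ, m ≤ g ∧ InS h F T σ τ j (z + m * d) := by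
  obtain ⟨m, hm, h1⟩ := f.hit i (by omega) hi4 d (z - (t + 2) * 8 ^ j) hd1 hd2 (by omega) (by omega)
  refine ⟨m, hm, t, ht, Or.inr (Or.inl ⟨i, hi, ?_⟩)⟩
  convert h1 using 1; ring

theorem fringeStep (c : Cfg g h T σ τ) (f : Fam g K F j) (hK : g + 10 ≤ K) {t x d : ℤ} (ht : T t)
    {i : ℕ} (hi : i + h < j ∨ (t = τ ∧ i ≤ j))
    (hi4 : 4 ≤ i) (hd1 : 8 ^ i ≤ d) (hd2 : d < 8 ^ (i + 1)) (hd : 4096 ≤ d)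
    (h1 : InS h F T σ τ j x) (h2 : InS h F T σ τ j (x + d)) (h3 : InS h F T σ τ j (x + 2 * d))
    (hx1 : (t + 2) * 8 ^ j ≤ x + 2 * d) (hx2 : x + 2 * d < (t + 4) * 8 ^ j ∨ t = τ) :
    ∃ m : ℕ, 3 ≤ m ∧ m ≤ K ∧ InS h F T σ τ j (x + m * d) := by
  have fin : x + 3 * d ≤ (t + 2) * 8 ^ j + 5 * d →
      ∃ m : ℕ, 3 ≤ m ∧ m ≤ K ∧ InS h F T σ τ j (x + m * d) := by
    intro hle
    obtain ⟨m, hm, h4⟩ := catch' (h := h) (τ := τ) (σ := σ) f (z := x + 3 * d) ht hi hi4 hd1 hd2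
      (by omega) hle
    refine ⟨m + 3, by omega, by omega, ?_⟩
    convert h4 using 1; push_cast; ring
  by_cases hx : x < (t + 2) * 8 ^ j
  · exact fin (by omega)
  push Not at hx
  have r2 : ∀ y, y ≤ x + 2 * d → (y < (t + 4) * 8 ^ j ∨ t = τ) := fun y hy => by
    rcases hx2 with hx2 | hx2
    · left; omega
    · right; exact hx2
  obtain ⟨i1, a1, b1⟩ := rightFringe c f ht hx (r2 _ (by omega)) h1
  obtain ⟨i2, a2, b2⟩ := rightFringe c f ht (by omega) (r2 _ (by omega)) h2
  obtain ⟨i3, a3, b3⟩ := rightFringe c f ht hx1 (r2 _ (by omega)) h3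
  have m12 := f.mono (by omega) b1 b2 (by omega)
  have m23 := f.mono (by omega) b2 b3 (by omega)
  rcases Nat.lt_or_ge i1 i3 with hlt | hge
  · have := f.lac hlt (by omega) b1 b3
    exact fin (by omega)
  · have e2 : i2 = i1 := by omega
    have e3 : i3 = i1 := by omega
    subst e2 e3
    obtain ⟨m, m1, m2, m3⟩ := f.closed i3 (by omega) (x - (t + 2) * 8 ^ j) d
      (by rw [abs_of_pos (by omega)]; exact hd) b1 (by convert b2 using 1; ring)
      (by convert b3 using 1; ring)
    refine ⟨m, m1, m2, t, ht, Or.inr (Or.inl ⟨i3, a1, ?_⟩)⟩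
    convert m3 using 1; ring

theorem step (c : Cfg g h T σ τ) (f : Fam g K F j) (hK : g + 258 * g * 8 ^ h + 10 ≤ K) {x d : ℤ}
    (hd : 4096 ≤ d) (hdu : d < 8 * 8 ^ j)
    (h1 : InS h F T σ τ j x) (h2 : InS h F T σ τ j (x + d)) (h3 : InS h F T σ τ j (x + 2 * d)) :
    ∃ m : ℕ, 3 ≤ m ∧ m ≤ K ∧ InS h F T σ τ j (x + m * d) := by
  have hK' : g + 10 ≤ K := by
    have : 0 ≤ 258 * g * 8 ^ h := Nat.zero_le _
    omega
  have hu : (0 : ℤ) < 8 ^ j := by positivity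
  have hg : (100 : ℤ) ≤ g := by exact_mod_cast c.hg
  have hgh : (g : ℤ) ≤ 8 ^ h := by exact_mod_cast c.hgh
  obtain ⟨i, hi4, hi1, hi2⟩ := exists_scale d hd
  rcases lt_or_ge (d * 8 ^ h) (8 ^ j) with hC | hB
  · -- small steps
    have hij : i + h < j := by
      have : (8 : ℤ) ^ (i + h) < 8 ^ j := by
        rw [pow_add]
        exact lt_of_le_of_lt (by gcongr) hC
      exact (pow_lt_pow_iff_right₀ (by norm_num)).1 this
    have hd8 : d * 100 < 8 ^ j := lt_of_le_of_lt (by gcongr; omega) hC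
    have h3' := h3
    obtain ⟨t, ht, hx⟩ := h3'
    rcases hx with ⟨a, b⟩ | ⟨i3, a, b⟩ | ⟨i3, a, b⟩
    · by_cases hs : x + 3 * d < (t + 2) * 8 ^ j
      · exact ⟨3, le_rfl, by omega, t, ht, Or.inl ⟨by push_cast; omega, by push_cast; omega⟩⟩
      · obtain ⟨m, hm, h4⟩ := catch' (h := h) (τ := τ) (σ := σ) f (z := x + 3 * d) ht (Or.inl hij)
          hi4 hi1 hi2 (by omega) (by omega)
        refine ⟨m + 3, by omega, by omega, ?_⟩
        convert h4 using 1; push_cast; ring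
    · refine fringeStep c f hK' ht (Or.inl hij) hi4 hi1 hi2 hd h1 h2 h3 ?_ ?_
      · have := (f.big (i := i3) (by omega) b).1
        omega
      · rcases a with a | ⟨a, _⟩
        · left
          have := (f.small c a b).2
          nlinarith
        · right; exact a
    · have z3 := f.big (i := i3) (by omega) b
      have r2 : ∀ y, x ≤ y → ((t - 2) * 8 ^ j ≤ y ∨ t = σ) := fun y hy => by
        rcases a with a | ⟨a, _⟩
        · left
          have := (f.small c a b).2
          nlinarith
        · right; exact a
      obtain ⟨i1, a1, b1⟩ := leftFringe c f ht (by omega) (r2 _ (by omega)) h1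
      obtain ⟨i2, a2, b2⟩ := leftFringe c f ht (by omega) (r2 _ (by omega)) h2
      have m12 := f.mono (by omega) b2 b1 (by omega)
      have m23 := f.mono (by omega) b b2 (by omega)
      rcases Nat.lt_or_ge i3 i1 with hlt | hge
      · have := f.lac hlt (by omega) b b1
        refine ⟨4, by omega, by omega, t, ht, Or.inl ⟨by push_cast; omega, ?_⟩⟩
        push_cast; nlinarith
      · have e2 : i2 = i1 := by omega
        have e3 : i3 = i1 := by omega
        subst e2 e3
        obtain ⟨m, m1, m2, m3⟩ := f.closed i3 (by omega) (t * 8 ^ j - 1 - x) (-d)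
          (by rw [abs_neg, abs_of_pos (by omega)]; exact hd) b1 (by convert b2 using 1; ring)
          (by convert b using 1; ring)
        refine ⟨m, m1, m2, t, ht, Or.inr (Or.inr ⟨i3, a1, ?_⟩)⟩
        convert m3 using 1; ring
  · -- medium steps
    have hij : i ≤ j := by
      have : (8 : ℤ) ^ i < 8 ^ (j + 1) := by
        rw [pow_succ]; omega
      have := (pow_lt_pow_iff_right₀ (by norm_num)).1 this
      omega
    by_cases hs : (τ + 2) * 8 ^ j ≤ x + 2 * d
    · exact fringeStep c f hK' c.ht (Or.inr ⟨rfl, hij⟩) hi4 hi1 hi2 hd h1 h2 h3 hs (Or.inr rfl)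
    · push Not at hs
      have hlow := lower c f h3
      have hd0 : 0 < d := by omega
      set N := (τ + 2) * 8 ^ j - (x + 2 * d) with hN
      set q := (N + (d - 1)) / d with hq
      have q1 : q * d ≤ N + (d - 1) := Int.ediv_mul_le _ hd0.ne'
      have q2 : N + (d - 1) < (q + 1) * d := Int.lt_ediv_add_one_mul_self _ hd0
      have q0 : 1 ≤ q := by
        rw [hq, Int.le_ediv_iff_mul_le hd0]; omega
      have hNu : N ≤ 258 * g * 8 ^ j := by
        have := c.len
        have e : (τ + 2) = σ + 256 * g + 2 := by omega
        rw [hN, e]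
        nlinarith
      have hNd : N ≤ 258 * g * (d * 8 ^ h) := hNu.trans (by gcongr)
      have q3 : q ≤ 258 * g * 8 ^ h + 1 := by
        have : (q - 1) * d < (258 * g * 8 ^ h + 1) * d := by nlinarith
        have := lt_of_mul_lt_mul_right this hd0.le
        omega
      obtain ⟨m, hm, h4⟩ := catch' (h := h) (τ := τ) (σ := σ) f (z := x + 2 * d + q * d) c.ht
        (Or.inr ⟨rfl, hij⟩) hi4 hi1 hi2 (by nlinarith) (by nlinarith)
      have hq' : ((q.toNat : ℕ) : ℤ) = q := Int.toNat_of_nonneg (by omega)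
      refine ⟨m + 2 + q.toNat, by omega, ?_, ?_⟩
      · have : (q.toNat : ℤ) ≤ ((258 * g * 8 ^ h + 1 : ℕ) : ℤ) := by
          rw [hq']; push_cast; exact q3
        have : q.toNat ≤ 258 * g * 8 ^ h + 1 := by exact_mod_cast this
        omega
      · convert h4 using 1
        push_cast
        rw [hq']
        ring

end ThreeRed
end

section
namespace ThreeRed

variable {g h K : ℕ} {F : ℕ → ℤ → Prop} {T : ℤ → Prop} {σ τ : ℤ} {j : ℕ}

theorem sigmaZone (c : Cfg g h T σ τ) (f : Fam g K F j) {x y z : ℤ}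
    (hx : InS h F T σ τ j x) (hy : InS h F T σ τ j y) (hz : InS h F T σ τ j z)
    (hap : x + z = 2 * y) (hd : 8 * 8 ^ j ≤ y - x) (hlt : z < (σ + 3) * 8 ^ j) :
    ∃ i ≤ j, F i (σ * 8 ^ j - 1 - x) ∧ F i (σ * 8 ^ j - 1 - y) ∧ F i (σ * 8 ^ j - 1 - z) := by
  have hu : (0 : ℤ) < 8 ^ j := by positivity
  have e3 : (σ + 3) * (8 : ℤ) ^ j = σ * 8 ^ j + 3 * 8 ^ j := by ring
  rw [e3] at hlt
  obtain ⟨i1, a1, b1⟩ := leftFringe c f c.hs (by omega) (Or.inr rfl) hx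
  obtain ⟨i2, a2, b2⟩ := leftFringe c f c.hs (by omega) (Or.inr rfl) hy
  have l1 := f.loc i1 (by omega) _ b1
  have m12 := f.mono (by omega) b2 b1 (by omega)
  rcases Nat.lt_or_ge i2 i1 with hlt' | hge
  · have := f.lac hlt' (by omega) b2 b1
    omega
  have e : i2 = i1 := by omega
  subst e
  have l2 := f.loc i2 (by omega) _ b2
  obtain ⟨i3, a3, b3⟩ := leftFringe c f c.hs (by nlinarith) (Or.inr rfl) hz
  have m23 := f.mono (by omega) b3 b2 (by omega)
  rcases Nat.lt_or_ge i3 i2 with hlt' | hge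
  · have := f.lac hlt' (by omega) b3 b2
    have h6 : (0 : ℤ) ≤ g * 8 ^ i2 := by positivity
    nlinarith
  have e : i3 = i2 := by omega
  subst e
  exact ⟨i3, by omega, b1, b2, b3⟩

theorem tauZone (c : Cfg g h T σ τ) (f : Fam g K F j) {x y z : ℤ}
    (hx : InS h F T σ τ j x) (hy : InS h F T σ τ j y) (hz : InS h F T σ τ j z)
    (hap : x + z = 2 * y) (hd : 8 * 8 ^ j ≤ y - x) (hlt : (τ - 1) * 8 ^ j ≤ x) :
    ∃ i ≤ j, F i (x - (τ + 2) * 8 ^ j) ∧ F i (y - (τ + 2) * 8 ^ j) ∧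
      F i (z - (τ + 2) * 8 ^ j) := by
  obtain ⟨i, hi, h1, h2, h3⟩ := sigmaZone c.mirror f hz.mirror hy.mirror hx.mirror (by omega)
    (by omega) (by nlinarith)
  refine ⟨i, hi, ?_, ?_, ?_⟩
  · convert h3 using 1; ring
  · convert h2 using 1; ring
  · convert h1 using 1; ring

/-- the full set of positions -/
def TT (g : ℕ) (Tm : ℤ → Prop) (t : ℤ) : Prop := t = 2048 * g ∨ t = 2304 * g ∨ Tm t

/-- the properties of the middle part -/
structure Mid (g h : ℕ) (Tm : ℤ → Prop) : Prop where
  hg : 100 ≤ g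
  hgh : g ≤ 8 ^ h
  win : ∀ t, Tm t → 2112 * g ≤ t ∧ t ≤ 2144 * g
  free : ∀ t1 t2 t3, Tm t1 → Tm t2 → Tm t3 → |t1 + t3 - 2 * t2| ≤ 16 → t1 = t2 ∧ t2 = t3
  hit : ∀ u D Y : ℤ, 0 < u → 4096 * u ≤ D → D < 32768 * u → 0 ≤ Y → Y ≤ 5 * D →
      ∃ m : ℕ, m ≤ g ∧ ∃ t, Tm t ∧ t * u ≤ Y + m * D ∧ Y + m * D < (t + 2) * u

variable {Tm : ℤ → Prop}

theorem Mid.cfg (M : Mid g h Tm) : Cfg g h (TT g Tm) (2048 * g) (2304 * g) where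
  hg := M.hg
  hgh := M.hgh
  sep := by
    intro t t' h1 h2 hlt
    have hg : (100 : ℤ) ≤ g := by exact_mod_cast M.hg
    rcases h1 with h1 | h1 | h1 <;> rcases h2 with h2 | h2 | h2
    · omega
    · omega
    · have := M.win _ h2; omega
    · omega
    · omega
    · have := M.win _ h2; omega
    · have := M.win _ h1; omega
    · have := M.win _ h1; omega
    · by_contra hc
      have := M.free t t' t h1 h2 h1 (by rw [abs_le]; omega)
      omega
  mn := by
    intro t h1
    rcases h1 with h1 | h1 | h1
    · omega
    · omega
    · have := M.win _ h1; omega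
  mx := by
    intro t h1
    rcases h1 with h1 | h1 | h1
    · omega
    · omega
    · have := M.win _ h1; omega
  hs := Or.inl rfl
  ht := Or.inr (Or.inl rfl)
  len := by ring

theorem zone (M : Mid g h Tm) (f : Fam g K F j) {x : ℤ}
    (hx : InS h F (TT g Tm) (2048 * g) (2304 * g) j x) :
    (x < 2048 * (g * 8 ^ j) + 3 * 8 ^ j ∧ 2047 * (g * 8 ^ j) ≤ x) ∨
    (2304 * (g * 8 ^ j) - 8 ^ j ≤ x ∧ x < 2305 * (g * 8 ^ j) + 2 * 8 ^ j) ∨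
    (∃ t, Tm t ∧ t * 8 ^ j - 8 ^ j ≤ x ∧ x < t * 8 ^ j + 3 * 8 ^ j ∧ 2112 * (g * 8 ^ j) ≤ t * 8 ^ j
      ∧ t * 8 ^ j ≤ 2144 * (g * 8 ^ j)) := by
  have c := M.cfg
  have hlow := lower c f hx
  have hupp := upper c f hx
  have hu : (0 : ℤ) < 8 ^ j := by positivity
  have hg : (100 : ℤ) ≤ g := by exact_mod_cast M.hg
  have hgu : (100 : ℤ) * 8 ^ j ≤ g * 8 ^ j := by gcongr
  obtain ⟨t, ht, hx⟩ := hx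
  have hloc : (t * 8 ^ j - 8 ^ j ≤ x ∨ t = 2048 * g) ∧ (x < t * 8 ^ j + 3 * 8 ^ j ∨ t = 2304 * g) := by
    rcases hx with ⟨a, b⟩ | ⟨i, a, b⟩ | ⟨i, a, b⟩
    · exact ⟨Or.inl (by omega), Or.inl (by nlinarith)⟩
    · rcases a with a | ⟨a', a⟩
      · have := f.small c a b
        exact ⟨Or.inl (by nlinarith), Or.inl (by nlinarith)⟩
      · have := f.big a b
        exact ⟨Or.inl (by nlinarith), Or.inr a'⟩
    · rcases a with a | ⟨a', a⟩
      · have := f.small c a b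
        exact ⟨Or.inl (by nlinarith), Or.inl (by nlinarith)⟩
      · have := f.big a b
        exact ⟨Or.inr a', Or.inl (by nlinarith)⟩
  rcases ht with rfl | rfl | ht
  · left
    obtain ⟨_, h2⟩ := hloc
    have : x < 2048 * g * 8 ^ j + 3 * 8 ^ j := by
      rcases h2 with h2 | h2
      · exact h2
      · omega
    constructor
    · linarith
    · linarith
  · right; left
    obtain ⟨h2, _⟩ := hloc
    have : 2304 * g * 8 ^ j - 8 ^ j ≤ x := by
      rcases h2 with h2 | h2
      · exact h2
      · omega
    constructor
    · linarith
    · linarith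
  · right; right
    have hw := M.win _ ht
    refine ⟨t, ht, ?_, ?_, ?_, ?_⟩
    · rcases hloc.1 with h1 | h1
      · exact h1
      · omega
    · rcases hloc.2 with h1 | h1
      · exact h1
      · omega
    · have : 2112 * (g : ℤ) * 8 ^ j ≤ t * 8 ^ j := mul_le_mul_of_nonneg_right hw.1 hu.le
      linarith
    · have : t * 8 ^ j ≤ 2144 * (g : ℤ) * 8 ^ j := mul_le_mul_of_nonneg_right hw.2 hu.le
      linarith

/-- large steps stay in one child -/
theorem bigStep (M : Mid g h Tm) (f : Fam g K F j) {x y z : ℤ}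
    (hx : InS h F (TT g Tm) (2048 * g) (2304 * g) j x)
    (hy : InS h F (TT g Tm) (2048 * g) (2304 * g) j y)
    (hz : InS h F (TT g Tm) (2048 * g) (2304 * g) j z)
    (hap : x + z = 2 * y) (hd : 8 * 8 ^ j ≤ y - x) :
    (∃ i ≤ j, F i (2048 * g * 8 ^ j - 1 - x) ∧ F i (2048 * g * 8 ^ j - 1 - y) ∧
      F i (2048 * g * 8 ^ j - 1 - z)) ∨
    (∃ i ≤ j, F i (x - (2304 * g + 2) * 8 ^ j) ∧ F i (y - (2304 * g + 2) * 8 ^ j) ∧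
      F i (z - (2304 * g + 2) * 8 ^ j)) := by
  have c := M.cfg
  have hu : (0 : ℤ) < 8 ^ j := by positivity
  have hg : (100 : ℤ) ≤ g := by exact_mod_cast M.hg
  have hgu : (100 : ℤ) * 8 ^ j ≤ g * 8 ^ j := by gcongr
  have zx := zone M f hx
  have zy := zone M f hy
  have zz := zone M f hz
  by_cases hσ : z < (2048 * g + 3) * 8 ^ j
  · exact Or.inl (sigmaZone c f hx hy hz hap hd hσ)
  by_cases hτ : (2304 * g - 1) * 8 ^ j ≤ x
  · exact Or.inr (tauZone c f hx hy hz hap hd hτ)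
  exfalso
  push Not at hσ hτ
  have e1 : (2048 * g + 3) * (8 : ℤ) ^ j = 2048 * (g * 8 ^ j) + 3 * 8 ^ j := by ring
  have e2 : (2304 * g - 1) * (8 : ℤ) ^ j = 2304 * (g * 8 ^ j) - 8 ^ j := by ring
  rw [e1] at hσ
  rw [e2] at hτ
  rcases zx with zx | zx | ⟨t1, T1, zx⟩
  · rcases zz with zz | zz | ⟨t3, T3, zz⟩
    · omega
    · rcases zy with zy | zy | ⟨t2, T2, zy⟩ <;> omega
    · rcases zy with zy | zy | ⟨t2, T2, zy⟩ <;> omega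
  · omega
  · rcases zz with zz | zz | ⟨t3, T3, zz⟩
    · omega
    · rcases zy with zy | zy | ⟨t2, T2, zy⟩ <;> omega
    · rcases zy with zy | zy | ⟨t2, T2, zy⟩
      · omega
      · omega
      · have hle : |t1 + t3 - 2 * t2| ≤ 16 := by
          rw [abs_le]
          constructor
          · by_contra hc
            push Not at hc
            have : (t1 + t3 - 2 * t2) * 8 ^ j ≤ (-17) * 8 ^ j := by gcongr; omega
            linarith
          · by_contra hc
            push Not at hc
            have : 17 * 8 ^ j ≤ (t1 + t3 - 2 * t2) * 8 ^ j := by gcongr; omega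
            linarith
        obtain ⟨rfl, rfl⟩ := M.free _ _ _ T1 T2 T3 hle
        omega

/-- the recursive family -/
inductive Mem (g h : ℕ) (Tm : ℤ → Prop) : ℕ → ℤ → Prop
  | solid (j : ℕ) (t x : ℤ) : TT g Tm t → t * 8 ^ j ≤ x → x < (t + 2) * 8 ^ j →
      Mem g h Tm (j + 4) x
  | right (j : ℕ) (t x : ℤ) (i : ℕ) : TT g Tm t → (i + h < j ∨ (t = 2304 * g ∧ i ≤ j)) →
      Mem g h Tm i (x - (t + 2) * 8 ^ j) → Mem g h Tm (j + 4) x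
  | left (j : ℕ) (t x : ℤ) (i : ℕ) : TT g Tm t → (i + h < j ∨ (t = 2048 * g ∧ i ≤ j)) →
      Mem g h Tm i (t * 8 ^ j - 1 - x) → Mem g h Tm (j + 4) x

theorem mem_iff (j : ℕ) (x : ℤ) : Mem g h Tm (j + 4) x ↔
    InS h (Mem g h Tm) (TT g Tm) (2048 * g) (2304 * g) j x := by
  constructor
  · intro hm
    cases hm with
    | solid _ t _ h1 h2 h3 => exact ⟨t, h1, Or.inl ⟨h2, h3⟩⟩
    | right _ t _ i h1 h2 h3 => exact ⟨t, h1, Or.inr (Or.inl ⟨i, h2, h3⟩)⟩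
    | left _ t _ i h1 h2 h3 => exact ⟨t, h1, Or.inr (Or.inr ⟨i, h2, h3⟩)⟩
  · rintro ⟨t, h1, ⟨h2, h3⟩ | ⟨i, h2, h3⟩ | ⟨i, h2, h3⟩⟩
    · exact Mem.solid j t x h1 h2 h3
    · exact Mem.right j t x i h1 h2 h3
    · exact Mem.left j t x i h1 h2 h3

theorem mem_ge {i : ℕ} {x : ℤ} (hm : Mem g h Tm i x) : ∃ j, i = j + 4 := by
  cases hm <;> exact ⟨_, rfl⟩

theorem fam (M : Mid g h Tm) (hK : g + 258 * g * 8 ^ h + 10 ≤ K) (j : ℕ) :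
    Fam g K (Mem g h Tm) j := by
  have c := M.cfg
  -- all properties at level `i`, by strong induction
  induction j using Nat.strong_induction_on with
  | _ n ih =>
  have hu : ∀ j : ℕ, (0 : ℤ) < 8 ^ j := fun j => by positivity
  have hg : (100 : ℤ) ≤ g := by exact_mod_cast M.hg
  refine ⟨?_, ?_, ?_⟩
  · intro i hi y hy
    obtain ⟨j, rfl⟩ := mem_ge hy
    have f := ih j (by omega)
    rw [mem_iff] at hy
    have h1 := lower c f hy
    have h2 := upper c f hy
    have h3 : (100 : ℤ) * 8 ^ j ≤ g * 8 ^ j := by have := hu j; gcongr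
    have e : (8 : ℤ) ^ (j + 4) = 4096 * 8 ^ j := by rw [pow_add]; norm_num; ring
    rw [e]
    constructor <;> nlinarith
  · intro i hi hi4 D Y h1 h2 h3 h4
    obtain ⟨j, rfl⟩ : ∃ j, i = j + 4 := ⟨i - 4, by omega⟩
    have e : (8 : ℤ) ^ (j + 4) = 4096 * 8 ^ j := by rw [pow_add]; norm_num; ring
    have e' : (8 : ℤ) ^ (j + 4 + 1) = 32768 * 8 ^ j := by rw [pow_add, pow_add]; norm_num; ring
    rw [e] at h1
    rw [e'] at h2
    obtain ⟨m, hm, t, ht, a, b⟩ := M.hit (8 ^ j) D Y (hu j) h1 h2 h3 h4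
    exact ⟨m, hm, Mem.solid j t _ (Or.inr (Or.inr ht)) a b⟩
  · intro i hi x d hd h1 h2 h3
    obtain ⟨j, rfl⟩ := mem_ge h1
    have f := ih j (by omega)
    rw [mem_iff] at h1 h2 h3
    simp only [mem_iff]
    rcases lt_or_ge (|d|) (8 * 8 ^ j) with hlt | hge
    · rcases abs_cases d with ⟨ha, _⟩ | ⟨ha, _⟩
      · rw [ha] at hd hlt
        exact step c f hK hd hlt h1 h2 h3
      · rw [ha] at hd hlt
        obtain ⟨m, m1, m2, m3⟩ := step c.mirror f hK (x := -1 - x) (d := -d) hd hlt h1.mirror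
          (by convert h2.mirror using 1; ring) (by convert h3.mirror using 1; ring)
        refine ⟨m, m1, m2, InS.of_mirror ?_⟩
        convert m3 using 1; ring
    · have key : (∃ i ≤ j, Mem g h Tm i (2048 * g * 8 ^ j - 1 - x) ∧
            Mem g h Tm i (2048 * g * 8 ^ j - 1 - (x + d)) ∧
            Mem g h Tm i (2048 * g * 8 ^ j - 1 - (x + 2 * d))) ∨
          (∃ i ≤ j, Mem g h Tm i (x - (2304 * g + 2) * 8 ^ j) ∧
            Mem g h Tm i (x + d - (2304 * g + 2) * 8 ^ j) ∧
            Mem g h Tm i (x + 2 * d - (2304 * g + 2) * 8 ^ j)) := by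
        rcases abs_cases d with ⟨ha, _⟩ | ⟨ha, _⟩
        · rw [ha] at hge
          exact bigStep M f h1 h2 h3 (by ring) (by omega)
        · rw [ha] at hge
          rcases bigStep M f h3 h2 h1 (by ring) (by omega) with ⟨i, a, b1, b2, b3⟩ | ⟨i, a, b1, b2, b3⟩
          · exact Or.inl ⟨i, a, b3, b2, b1⟩
          · exact Or.inr ⟨i, a, b3, b2, b1⟩
      rcases key with ⟨i, a, b1, b2, b3⟩ | ⟨i, a, b1, b2, b3⟩
      · obtain ⟨m, m1, m2, m3⟩ := f.closed i a (2048 * g * 8 ^ j - 1 - x) (-d) (by rwa [abs_neg]) b1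
          (by convert b2 using 1; ring) (by convert b3 using 1; ring)
        refine ⟨m, m1, m2, _, c.hs, Or.inr (Or.inr ⟨i, Or.inr ⟨rfl, a⟩, ?_⟩)⟩
        convert m3 using 1; ring
      · obtain ⟨m, m1, m2, m3⟩ := f.closed i a (x - (2304 * g + 2) * 8 ^ j) d hd b1
          (by convert b2 using 1; ring) (by convert b3 using 1; ring)
        refine ⟨m, m1, m2, _, c.ht, Or.inr (Or.inl ⟨i, Or.inr ⟨rfl, a⟩, ?_⟩)⟩
        convert m3 using 1; ring

end ThreeRed
end

section
namespace ThreeRed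

theorem not_findable_three : ∃ k : ℕ, ¬ Findable 3 k := by
  classical
  obtain ⟨g, Tm, hg, hwin, hfree, hhit⟩ := exists_T
  have M : Mid g g Tm := ⟨hg, (Nat.lt_pow_self (by norm_num)).le, hwin, hfree, hhit⟩
  set K := g + 258 * g * 8 ^ g + 10 with hK
  refine ⟨K, ?_⟩
  intro hfind
  have hg0 : (0 : ℝ) < g := by exact_mod_cast (by omega : 0 < g)
  obtain ⟨p₀, hp₀⟩ := hfind (1 / (16 * (2306 * g))) (by positivity)
  set j := p₀ with hj
  set L : ℕ := 2306 * g * 8 ^ j with hL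
  have h8 : p₀ < 8 ^ j := Nat.lt_pow_self (by norm_num)
  have h8L : 8 ^ j ≤ L := Nat.le_mul_of_pos_left _ (by omega)
  obtain ⟨p, hp, hp1, hp2⟩ := Nat.exists_prime_lt_and_le_two_mul (8 * L) (by omega)
  haveI : Fact p.Prime := ⟨hp⟩
  have f : Fam g K (Mem g g Tm) (j + 8) := fam M le_rfl (j + 8)
  set S : ℤ → Prop := fun x => Mem g g Tm (j + 8) (4096 * x) with hS
  have e8 : (8 : ℤ) ^ (j + 8) = 4096 * 4096 * 8 ^ j := by rw [pow_add]; norm_num; ring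
  have e4 : (8 : ℤ) ^ (j + 4) = 4096 * 8 ^ j := by rw [pow_add]; norm_num; ring
  have hbd : ∀ x, S x → 0 ≤ x ∧ x < L := by
    intro x hx
    have := f.loc (j + 8) le_rfl _ hx
    rw [e8] at this
    have h0 : (0 : ℤ) ≤ g * 8 ^ j := by positivity
    have hLZ : (L : ℤ) = 2306 * (g * 8 ^ j) := by rw [hL]; push_cast; ring
    constructor
    · nlinarith
    · rw [hLZ]; nlinarith
  have hin : ∀ y : ℤ, 0 ≤ y → y < 8 ^ j → S (2048 * g * 8 ^ j + y) := by
    intro y h1 h2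
    refine Mem.solid (j + 4) (2048 * g) _ (Or.inl rfl) ?_ ?_
    · rw [e4]; nlinarith
    · rw [e4]; nlinarith
  set A : Set (ZMod p) := {a | ∃ x : ℤ, S x ∧ (x : ZMod p) = a} with hA
  have hsmall : ∀ z : ℤ, |z| < p → (z : ZMod p) = 0 → z = 0 := by
    intro z hz h0
    rw [ZMod.intCast_zmod_eq_zero_iff_dvd] at h0
    exact Int.eq_zero_of_abs_lt_dvd h0 hz
  have hcard1 : 8 ^ j ≤ A.ncard := by
    have hinj : Set.InjOn (fun y : ℕ => ((2048 * g * 8 ^ j + y : ℤ) : ZMod p)) (Finset.range (8 ^ j)) := by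
      intro y hy y' hy' he
      simp only [Finset.coe_range, Set.mem_Iio] at hy hy'
      have := hsmall ((y : ℤ) - y') (by rw [abs_lt]; omega) (by
        have he' := sub_eq_zero.2 he
        simp only at he'
        rw [← he']; push_cast; ring)
      omega
    have h1 := Finset.card_image_of_injOn hinj
    rw [Finset.card_range] at h1
    rw [← h1, ← Set.ncard_coe_finset]
    apply Set.ncard_le_ncard _ (Set.toFinite _)
    intro a ha
    simp only [Finset.coe_image, Set.mem_image, Finset.coe_range, Set.mem_Iio] at ha
    obtain ⟨y, hy, rfl⟩ := ha
    exact ⟨_, hin y (by omega) (by exact_mod_cast hy), rfl⟩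
  have hcard2 : A.ncard ≤ L := by
    have : A ⊆ ((Finset.range L).image (fun n : ℕ => (n : ZMod p)) : Finset (ZMod p)) := by
      rintro a ⟨x, hx, rfl⟩
      have := hbd x hx
      simp only [Finset.coe_image, Set.mem_image, Finset.coe_range, Set.mem_Iio]
      refine ⟨x.toNat, by omega, ?_⟩
      have h3 : ((x.toNat : ℕ) : ℤ) = x := Int.toNat_of_nonneg this.1
      exact_mod_cast congrArg (fun z : ℤ => (z : ZMod p)) h3
    have h2 := Set.ncard_le_ncard this (Set.toFinite _)
    rw [Set.ncard_coe_finset] at h2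
    exact h2.trans (Finset.card_image_le.trans (by simp))
  have hcompl := Set.ncard_add_ncard_compl A
  rw [Nat.card_zmod] at hcompl
  have hδ : 1 / (16 * (2306 * (g : ℝ))) * p ≤ ((8 ^ j : ℕ) : ℝ) := by
    rw [div_mul_eq_mul_div, div_le_iff₀ (by positivity)]
    have : (p : ℝ) ≤ ((2 * (8 * L) : ℕ) : ℝ) := by exact_mod_cast hp2
    rw [hL] at this
    push_cast at this ⊢
    linarith
  obtain ⟨x, d, hd, hr, hb⟩ := hp₀ p hp (by omega) A
    (by rw [Nat.card_coe_set_eq]; exact hδ.trans (by exact_mod_cast hcard1))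
    (by rw [Nat.card_coe_set_eq]; exact hδ.trans (by exact_mod_cast (by omega)))
  obtain ⟨X0, hX0, x0⟩ := hr 0 (by norm_num)
  obtain ⟨X1, hX1, x1⟩ := hr 1 (by norm_num)
  obtain ⟨X2, hX2, x2⟩ := hr 2 (by norm_num)
  have b0 := hbd _ hX0
  have b1 := hbd _ hX1
  have b2 := hbd _ hX2
  have hsum := hsmall (X0 + X2 - 2 * X1) (by rw [abs_lt]; omega) (by
    push_cast
    rw [x0, x1, x2]; push_cast; ring)
  have hDd : ((X1 - X0 : ℤ) : ZMod p) = d := by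
    push_cast
    rw [x0, x1]; push_cast; ring
  have hD0 : X1 - X0 ≠ 0 := by
    intro h0
    rw [h0] at hDd
    exact hd (by simpa using hDd.symm)
  obtain ⟨m, m1, m2, m3⟩ := f.closed (j + 8) le_rfl (4096 * X0) (4096 * (X1 - X0))
    (by
      rw [abs_mul]
      have := Int.one_le_abs hD0
      norm_num
      omega) hX0 (by convert hX1 using 1; ring) (by
      have e : 4096 * X0 + 2 * (4096 * (X1 - X0)) = 4096 * X2 := by linarith
      rw [e]; exact hX2)
  refine hb m m1 (by omega) ⟨X0 + m * (X1 - X0), ?_, ?_⟩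
  · simp only [hS]
    convert m3 using 1; ring
  · push_cast at hDd ⊢
    rw [hDd, x0]; push_cast; ring

end ThreeRed
end

theorem HasAP.drop_red {p : ℕ} {A : Set (ZMod p)} {a b : ℕ} (h : HasAP A (a + 1) b) :
    HasAP A a b := by
  obtain ⟨x, d, hd, h1, h2⟩ := h
  refine ⟨x + d, d, hd, fun i hi => ?_, fun i hi hi2 => ?_⟩
  · have := h1 (i + 1) (by omega)
    convert this using 1
    push_cast; ring
  · have := h2 (i + 1) (by omega) (by omega)
    convert this using 2
    push_cast; ring

theorem HasAP.drop_blue {p : ℕ} {A : Set (ZMod p)} {a b : ℕ} (h : HasAP A a (b + 1)) :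
    HasAP A a b := by
  obtain ⟨x, d, hd, h1, h2⟩ := h
  exact ⟨x, d, hd, h1, fun i hi hi2 => h2 i hi (by omega)⟩

theorem Findable.drop_red {a b : ℕ} (h : Findable (a + 1) b) : Findable a b := by
  intro δ hδ
  obtain ⟨p₀, hp⟩ := h δ hδ
  exact ⟨p₀, fun p h1 h2 A h3 h4 => (hp p h1 h2 A h3 h4).drop_red⟩

theorem Findable.drop_blue {a b : ℕ} (h : Findable a (b + 1)) : Findable a b := by
  intro δ hδ
  obtain ⟨p₀, hp⟩ := h δ hδ
  exact ⟨p₀, fun p h1 h2 A h3 h4 => (hp p h1 h2 A h3 h4).drop_blue⟩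

theorem Findable.mono {a a' b : ℕ} (hle : a ≤ a') (h : Findable a' b) : Findable a b := by
  induction a', hle using Nat.le_induction with
  | base => exact h
  | succ n _ ih => exact ih h.drop_red

/-- For a non-negative integer a, the pair (a, k) is findable for every
non-negative integer k if and only if a ≤ 2. -/
theorem statement5 (a : ℕ) : (∀ k : ℕ, Findable a k) ↔ a ≤ 2 := by
  constructor
  · intro h
    by_contra ha
    obtain ⟨k, hk⟩ := ThreeRed.not_findable_three
    exact hk (Findable.mono (by omega) (h k))
  · intro ha k
    exact Findable.mono ha (TwoRed.findable_two k).drop_blue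
end

section
/- For every real c > 0 and every positive integer k there exists N = N(c, k) ≥ 1 such that the following holds: for every red–blue colouring of ℤ containing no (2,k)-AP, if [m₁, m₂] and [n₁, n₂] are gaps with n₂ − n₁ ≥ N·(m₂ − m₁), then every integer in [m₁, m₂] is at distance at least c·(n₂ − n₁) from every integer in [n₁, n₂]. -/
/-- A red–blue colouring of ℤ (red set `R`, blue its complement) contains an `(a,b)`-AP:
an arithmetic progression `x, x+d, …, x+(a+b−1)d` with `d ≠ 0` whose first `a` terms are
red and whose last `b` terms are blue. -/
def HasAPZ (R : Set ℤ) (a b : ℕ) : Prop :=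
  ∃ x d : ℤ, d ≠ 0 ∧
    (∀ i : ℕ, i < a → x + (i : ℤ) * d ∈ R) ∧
    (∀ i : ℕ, a ≤ i → i < a + b → x + (i : ℤ) * d ∉ R)

/-- `[u, v]` is a gap: `u < v`, `u` and `v` are red, and all integers strictly between
`u` and `v` are blue. -/
def IsGap (R : Set ℤ) (u v : ℤ) : Prop :=
  u < v ∧ u ∈ R ∧ v ∈ R ∧ ∀ n : ℤ, u < n → n < v → n ∉ R

lemma red_next {R : Set ℤ} {k : ℕ} (h : ¬ HasAPZ R 2 k) {x y : ℤ} (hx : x ∈ R) (hy : y ∈ R)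
    (hxy : x ≠ y) : ∃ j : ℕ, 2 ≤ j ∧ j ≤ k + 1 ∧ x + (j : ℤ) * (y - x) ∈ R := by
  by_contra hcon
  push Not at hcon
  refine h ⟨x, y - x, by omega, ?_, ?_⟩
  · intro i hi
    interval_cases i
    · simpa using hx
    · simpa using hy
  · intro i h1 h2
    exact hcon i h1 (by omega)

lemma red_seq {R : Set ℤ} {k : ℕ} (h : ¬ HasAPZ R 2 k) {p q : ℤ} (hp : p ∈ R) (hq : q ∈ R)
    (hpq : p < q) : ∃ a : ℕ → ℤ, a 0 = q ∧ (∀ i, a i ∈ R) ∧ (∀ i, p < a i) ∧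
      (∀ i, a i < a (i + 1)) ∧ ∀ i, a (i + 1) - p ≤ ((k : ℤ) + 1) * (a i - p) := by
  have key : ∀ y : {y : ℤ // y ∈ R ∧ p < y}, ∃ z : {z : ℤ // z ∈ R ∧ p < z},
      y.1 < z.1 ∧ z.1 - p ≤ ((k : ℤ) + 1) * (y.1 - p) := by
    rintro ⟨y, hy, hpy⟩
    obtain ⟨j, h2, hj, hr⟩ := red_next h hp hy hpy.ne
    have h2' : (2 : ℤ) ≤ j := by exact_mod_cast h2
    have hj' : (j : ℤ) ≤ k + 1 := by exact_mod_cast hj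
    have hlt : y < p + (j : ℤ) * (y - p) := by nlinarith
    refine ⟨⟨p + (j : ℤ) * (y - p), hr, by omega⟩, hlt, ?_⟩
    have : (j : ℤ) * (y - p) ≤ (k + 1) * (y - p) :=
      mul_le_mul_of_nonneg_right hj' (by omega)
    simpa using this
  choose f hf1 hf2 using key
  let b : ℕ → {y : ℤ // y ∈ R ∧ p < y} := fun i => Nat.rec ⟨q, hq, hpq⟩ (fun _ y => f y) i
  exact ⟨fun i => (b i).1, rfl, fun i => (b i).2.1, fun i => (b i).2.2,
    fun i => hf1 (b i), fun i => hf2 (b i)⟩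

/-- From a red pair `p < q` that is short compared to its distance to `D`, we obtain another
red pair, not much longer, and nearer to `D` by a constant factor. -/
lemma red_step {R : Set ℤ} {k : ℕ} (h : ¬ HasAPZ R 2 k) {p q D : ℤ} (hp : p ∈ R)
    (hq : q ∈ R) (hpq : p < q) (hD : ((k : ℤ) + 1) ^ (k + 2) * (q - p) ≤ D - p) :
    ∃ p' q' : ℤ, p' ∈ R ∧ q' ∈ R ∧ p' < q' ∧ q' ≤ D ∧
      q' - p' ≤ ((k : ℤ) + 1) ^ (k + 2) * (q - p) ∧
      ((k : ℤ) + 1) ^ 2 * (D - p') ≤ (((k : ℤ) + 1) ^ 2 - 1) * (D - p) := by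
  obtain ⟨a, ha0, haR, hap, hlt, hgr⟩ := red_seq h hp hq hpq
  have hK0 : (0 : ℤ) ≤ (k : ℤ) + 1 := by positivity
  have hK1 : (1 : ℤ) ≤ (k : ℤ) + 1 := by linarith [Int.natCast_nonneg k]
  have hmono : StrictMono a := strictMono_nat_of_lt_succ hlt
  have hpow : ∀ i, a i - p ≤ ((k : ℤ) + 1) ^ i * (q - p) := by
    intro i
    induction i with
    | zero => simp [ha0]
    | succ i ih =>
      calc a (i + 1) - p ≤ ((k : ℤ) + 1) * (a i - p) := hgr i
        _ ≤ ((k : ℤ) + 1) * (((k : ℤ) + 1) ^ i * (q - p)) := mul_le_mul_of_nonneg_left ih hK0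
        _ = _ := by ring
  have hlin : ∀ i : ℕ, (i : ℤ) < a i - p := by
    intro i
    induction i with
    | zero => have := hap 0; push_cast; omega
    | succ i ih => have := hlt i; push_cast; omega
  have hex : ∃ i, D - p < ((k : ℤ) + 1) * (a i - p) := by
    refine ⟨(D - p).toNat, ?_⟩
    have h1 := hlin (D - p).toNat
    have h2 := Int.self_le_toNat (D - p)
    nlinarith
  classical
  set i₀ := Nat.find hex with hi₀
  have hi1 : D - p < ((k : ℤ) + 1) * (a i₀ - p) := Nat.find_spec hex
  have hi2 : k + 1 < i₀ := by
    by_contra hle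
    push Not at hle
    have h1 : a i₀ - p ≤ a (k + 1) - p := by
      have := hmono.monotone hle
      omega
    have h2 := hpow (k + 1)
    have h3 : ((k : ℤ) + 1) * (a i₀ - p) ≤ ((k : ℤ) + 1) * (((k : ℤ) + 1) ^ (k + 1) * (q - p)) :=
      mul_le_mul_of_nonneg_left (h1.trans h2) hK0
    have h4 : ((k : ℤ) + 1) * (((k : ℤ) + 1) ^ (k + 1) * (q - p))
        = ((k : ℤ) + 1) ^ (k + 2) * (q - p) := by ring
    linarith
  obtain ⟨t, ht⟩ : ∃ t, i₀ = t + 1 := ⟨i₀ - 1, by omega⟩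
  have hr1 : ((k : ℤ) + 1) * (a t - p) ≤ D - p := by
    have := Nat.find_min hex (m := t) (by omega)
    push Not at this
    exact this
  have htk : k < t := by omega
  rw [ht] at hi1
  have hr2 : D - p < ((k : ℤ) + 1) ^ 2 * (a t - p) := by
    have := mul_le_mul_of_nonneg_left (hgr t) hK0
    nlinarith
  -- pigeonhole
  have hne : ∀ i : ℕ, i ≤ k → a i < a t := fun i hi => hmono (by omega)
  have hj : ∀ i : ℕ, ∃ j : ℕ, i ≤ k → 2 ≤ j ∧ j ≤ k + 1 ∧ a i + (j : ℤ) * (a t - a i) ∈ R := by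
    intro i
    by_cases hi : i ≤ k
    · obtain ⟨j, hj⟩ := red_next h (haR i) (haR t) (hne i hi).ne
      exact ⟨j, fun _ => hj⟩
    · exact ⟨0, fun h => absurd h hi⟩
  choose f hf using hj
  obtain ⟨u, hu, v, hv, huv, hfe⟩ : ∃ u ∈ Finset.range (k + 1), ∃ v ∈ Finset.range (k + 1),
      u ≠ v ∧ f u = f v := by
    apply Finset.exists_ne_map_eq_of_card_lt_of_maps_to (t := Finset.Icc 2 (k + 1))
    · simp
    · intro i hi
      have hi' : i < k + 1 := by simpa using hi
      obtain ⟨h1, h2, -⟩ := hf i (by omega)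
      simp [h1, h2]
  have main : ∀ u v : ℕ, u ≤ k → v ≤ k → u < v → f u = f v →
      ∃ p' q' : ℤ, p' ∈ R ∧ q' ∈ R ∧ p' < q' ∧ q' ≤ D ∧
      q' - p' ≤ ((k : ℤ) + 1) ^ (k + 2) * (q - p) ∧
      ((k : ℤ) + 1) ^ 2 * (D - p') ≤ (((k : ℤ) + 1) ^ 2 - 1) * (D - p) := by
    intro u v hu hv huv hfe
    obtain ⟨hj2, hjk, hRu⟩ := hf u hu
    obtain ⟨-, -, hRv⟩ := hf v hv
    rw [← hfe] at hRv
    generalize f u = j at hj2 hjk hRu hRv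
    have hj2' : (2 : ℤ) ≤ j := by exact_mod_cast hj2
    have hjk' : (j : ℤ) ≤ k + 1 := by exact_mod_cast hjk
    have hauv : a u < a v := hmono huv
    have hut := hne u hu
    have hvt := hne v hv
    have hpu := hap u
    refine ⟨a v + (j : ℤ) * (a t - a v), a u + (j : ℤ) * (a t - a u), hRv, hRu, ?_, ?_, ?_, ?_⟩
    · nlinarith
    · have h1 : ((j : ℤ) - 1) * (a t - a u) ≤ k * (a t - p) := by
        apply mul_le_mul <;> linarith [Int.natCast_nonneg k]
      nlinarith
    · have h1 : a v - p ≤ a k - p := by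
        have := hmono.monotone hv
        omega
      have h2 : a v - a u ≤ ((k : ℤ) + 1) ^ k * (q - p) := by linarith [hpow k]
      have h3 : ((j : ℤ) - 1) * (a v - a u) ≤ ((k : ℤ) + 1) ^ 2 * (((k : ℤ) + 1) ^ k * (q - p)) := by
        apply mul_le_mul _ h2 (by linarith) (by positivity)
        nlinarith
      have h4 : ((k : ℤ) + 1) ^ 2 * (((k : ℤ) + 1) ^ k * (q - p))
        = ((k : ℤ) + 1) ^ (k + 2) * (q - p) := by ring
      linarith
    · have h1 : a t ≤ a v + (j : ℤ) * (a t - a v) := by nlinarith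
      have h2 : ((k : ℤ) + 1) ^ 2 * a t ≤ ((k : ℤ) + 1) ^ 2 * (a v + (j : ℤ) * (a t - a v)) :=
        mul_le_mul_of_nonneg_left h1 (by positivity)
      linarith
  simp only [Finset.mem_range] at hu hv
  rcases lt_or_gt_of_ne huv with hlt' | hlt'
  · exact main u v (by omega) (by omega) hlt' hfe
  · exact main v u (by omega) (by omega) hlt' hfe.symm

lemma red_end {R : Set ℤ} {k : ℕ} (h : ¬ HasAPZ R 2 k) {p n₁ n₂ : ℤ} (hg : IsGap R n₁ n₂)
    (hp : p ∈ R) (hpn : p < n₁) : n₂ - n₁ ≤ k * (n₁ - p) := by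
  by_contra hcon
  push Not at hcon
  obtain ⟨-, h1, h2, h3⟩ := hg
  obtain ⟨j, hj2, hjk, hr⟩ := red_next h hp h1 hpn.ne
  have hj2' : (2 : ℤ) ≤ j := by exact_mod_cast hj2
  have hjk' : (j : ℤ) ≤ k + 1 := by exact_mod_cast hjk
  exact h3 _ (by nlinarith) (by nlinarith) hr

lemma red_iter {R : Set ℤ} {k : ℕ} (hk : 0 < k) (h : ¬ HasAPZ R 2 k) {n₁ n₂ : ℤ}
    (hg : IsGap R n₁ n₂) (ρ : ℝ) (hρ0 : 0 ≤ ρ)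
    (hρ : ((k : ℝ) + 1) ^ 2 * ρ = ((k : ℝ) + 1) ^ 2 - 1) (I : ℕ) :
    ∀ p q : ℤ, p ∈ R → q ∈ R → p < q → q ≤ n₁ →
      (k : ℤ) * ((((k : ℤ) + 1) ^ (k + 2)) ^ I * (q - p)) < n₂ - n₁ →
      (n₂ : ℝ) - n₁ ≤ k * (ρ ^ I * ((n₁ : ℝ) - p)) := by
  induction I with
  | zero =>
    intro p q hp hq hpq hqn _
    have := red_end h hg hp (by omega)
    have h2 : ((n₂ - n₁ : ℤ) : ℝ) ≤ ((k * (n₁ - p) : ℤ) : ℝ) := by exact_mod_cast this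
    push_cast at h2
    simpa using h2
  | succ I ih =>
    intro p q hp hq hpq hqn hC
    set C : ℤ := ((k : ℤ) + 1) ^ (k + 2) with hCdef
    have hC1 : 1 ≤ C := one_le_pow₀ (by linarith [Int.natCast_nonneg k])
    have hCI : 1 ≤ C ^ I := one_le_pow₀ hC1
    have hk0 : (0 : ℤ) ≤ k := Int.natCast_nonneg k
    rcases le_or_gt (C * (q - p)) (n₁ - p) with hle | hgt
    · obtain ⟨p', q', hp', hq', hpq', hqn', hlen, hdist⟩ := red_step h hp hq hpq hle
      have h1 := ih p' q' hp' hq' hpq' hqn' (by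
        refine lt_of_le_of_lt (mul_le_mul_of_nonneg_left ?_ hk0) hC
        calc C ^ I * (q' - p') ≤ C ^ I * (C * (q - p)) :=
              mul_le_mul_of_nonneg_left hlen (by positivity)
          _ = _ := by ring)
      refine h1.trans ?_
      have h2 : (((k : ℝ) + 1) ^ 2 * ((n₁ : ℝ) - p')) ≤ (((k : ℝ) + 1) ^ 2 - 1) * (n₁ - p) := by
        exact_mod_cast hdist
      rw [← hρ, mul_assoc] at h2
      have h3 : (n₁ : ℝ) - p' ≤ ρ * (n₁ - p) := le_of_mul_le_mul_left h2 (by positivity)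
      rw [pow_succ, mul_assoc]
      gcongr
    · exfalso
      have h1 := red_end h hg hp (by omega)
      have h2 : (k : ℤ) * (n₁ - p) ≤ k * (C ^ (I + 1) * (q - p)) := by
        refine mul_le_mul_of_nonneg_left ?_ hk0
        calc n₁ - p ≤ 1 * (C * (q - p)) := by linarith
          _ ≤ C ^ I * (C * (q - p)) :=
            mul_le_mul_of_nonneg_right hCI (mul_nonneg (by linarith) (by linarith))
          _ = _ := by ring
      linarith

lemma hasAPZ_neg {R : Set ℤ} {a b : ℕ} (h : HasAPZ {x | -x ∈ R} a b) : HasAPZ R a b := by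
  obtain ⟨x, d, hd, h1, h2⟩ := h
  have e : ∀ i : ℤ, -x + i * -d = -(x + i * d) := fun i => by ring
  refine ⟨-x, -d, by omega, fun i hi => ?_, fun i hi hi' => ?_⟩
  · rw [e]; exact h1 i hi
  · rw [e]; exact h2 i hi hi'

lemma isGap_neg {R : Set ℤ} {u v : ℤ} (h : IsGap R u v) : IsGap {x | -x ∈ R} (-v) (-u) := by
  obtain ⟨h0, h1, h2, h3⟩ := h
  exact ⟨by omega, by simpa using h2, by simpa using h1,
    fun n hn hn' => h3 (-n) (by omega) (by omega)⟩

lemma one_sided (c : ℝ) (hc : 0 < c) (k : ℕ) (hk : 0 < k) :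
    ∃ N : ℕ, 2 ≤ N ∧ ∀ R : Set ℤ, ¬ HasAPZ R 2 k →
      ∀ m₁ m₂ n₁ n₂ : ℤ, IsGap R m₁ m₂ → IsGap R n₁ n₂ →
        (N : ℤ) * (m₂ - m₁) ≤ n₂ - n₁ → m₂ ≤ n₁ →
        ∀ x ∈ Set.Icc m₁ m₂, ∀ y ∈ Set.Icc n₁ n₂,
          c * ((n₂ : ℝ) - n₁) ≤ |(x : ℝ) - y| := by
  have hk1 : (0 : ℝ) < k := by exact_mod_cast hk
  set ρ : ℝ := 1 - 1 / ((k : ℝ) + 1) ^ 2 with hρd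
  have hρ : ((k : ℝ) + 1) ^ 2 * ρ = ((k : ℝ) + 1) ^ 2 - 1 := by
    rw [hρd]; field_simp
  have hρ1 : ρ < 1 := by
    have : (0 : ℝ) < 1 / ((k : ℝ) + 1) ^ 2 := by positivity
    linarith
  have hρ0 : 0 ≤ ρ := by
    have : 1 / ((k : ℝ) + 1) ^ 2 ≤ 1 := by
      rw [div_le_one (by positivity)]
      nlinarith
    linarith
  obtain ⟨I, hI⟩ := exists_pow_lt_of_lt_one (show (0 : ℝ) < 1 / (k * (c + 1)) by positivity) hρ1
  have hI' : k * (ρ ^ I * (c + 1)) < 1 := by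
    rw [lt_div_iff₀ (by positivity)] at hI
    linarith
  refine ⟨k * ((k + 1) ^ (k + 2)) ^ I + 1, ?_, ?_⟩
  · have : 0 < k * ((k + 1) ^ (k + 2)) ^ I := by positivity
    omega
  intro R hR m₁ m₂ n₁ n₂ hm hn hN hmn x hx y hy
  by_contra hcon
  push Not at hcon
  have hm0 := hm.1
  push_cast at hN
  have hlt : (k : ℤ) * ((((k : ℤ) + 1) ^ (k + 2)) ^ I * (m₂ - m₁)) < n₂ - n₁ := by nlinarith
  have h1 := red_iter hk hR hn ρ hρ0 hρ I m₁ m₂ hm.2.1 hm.2.2.1 hm0 hmn hlt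
  have hmle : m₂ - m₁ ≤ n₂ - n₁ := by
    have : (0 : ℤ) ≤ (k : ℤ) * (((k : ℤ) + 1) ^ (k + 2)) ^ I * (m₂ - m₁) :=
      mul_nonneg (by positivity) (by omega)
    linarith
  have hmle' : (m₂ : ℝ) - m₁ ≤ n₂ - n₁ := by exact_mod_cast hmle
  have hn0 : (0 : ℝ) < (n₂ : ℝ) - n₁ := by
    have : (n₁ : ℝ) < n₂ := by exact_mod_cast hn.1
    linarith
  have hx1 : (x : ℝ) ≤ m₂ := by exact_mod_cast hx.2
  have hy1 : (n₁ : ℝ) ≤ y := by exact_mod_cast hy.1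
  have habs := (abs_lt.1 hcon).1
  have hL : (n₁ : ℝ) - m₁ ≤ (c + 1) * (n₂ - n₁) := by linarith
  have h2 : (k : ℝ) * (ρ ^ I * ((n₁ : ℝ) - m₁)) ≤ k * (ρ ^ I * ((c + 1) * (n₂ - n₁))) := by
    gcongr
  nlinarith

/-- For every real c > 0 and positive integer k there is N = N(c,k) ≥ 1
such that for every colouring of ℤ with no (2,k)-AP, if [m₁, m₂] and [n₁, n₂] are gaps
with n₂ − n₁ ≥ N·(m₂ − m₁), then every integer of [m₁, m₂] is at distance at least
c·(n₂ − n₁) from every integer of [n₁, n₂]. -/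
theorem statement9 (c : ℝ) (hc : 0 < c) (k : ℕ) (hk : 0 < k) :
    ∃ N : ℕ, 1 ≤ N ∧ ∀ R : Set ℤ, ¬ HasAPZ R 2 k →
      ∀ m₁ m₂ n₁ n₂ : ℤ, IsGap R m₁ m₂ → IsGap R n₁ n₂ →
        (N : ℤ) * (m₂ - m₁) ≤ n₂ - n₁ →
        ∀ x ∈ Set.Icc m₁ m₂, ∀ y ∈ Set.Icc n₁ n₂,
          c * ((n₂ : ℝ) - n₁) ≤ |(x : ℝ) - y| := by
  obtain ⟨N, hN2, hN⟩ := one_sided c hc k hk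
  refine ⟨N, by omega, ?_⟩
  intro R hR m₁ m₂ n₁ n₂ hm hn hlen x hx y hy
  by_cases h1 : m₂ ≤ n₁
  · exact hN R hR m₁ m₂ n₁ n₂ hm hn hlen h1 x hx y hy
  by_cases h2 : n₂ ≤ m₁
  · have := hN {x | -x ∈ R} (fun h => hR (hasAPZ_neg h)) (-m₂) (-m₁) (-n₂) (-n₁)
      (isGap_neg hm) (isGap_neg hn) (by linarith) (by omega) (-x)
      ⟨by linarith [hx.2], by linarith [hx.1]⟩ (-y) ⟨by linarith [hy.2], by linarith [hy.1]⟩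
    push_cast at this
    rw [show -(x : ℝ) - -(y : ℝ) = -((x : ℝ) - y) by ring, abs_neg] at this
    linarith
  · exfalso
    obtain ⟨hm0, hm1, hm2, hm3⟩ := hm
    obtain ⟨hn0, hn1, hn2, hn3⟩ := hn
    have h3 : m₁ ≤ n₁ := by
      by_contra h3
      exact hn3 m₁ (by omega) (by omega) hm1
    have h4 : n₂ ≤ m₂ := by
      by_contra h4
      exact hn3 m₂ (by omega) (by omega) hm2
    have hN2' : (2 : ℤ) ≤ N := by exact_mod_cast hN2
    nlinarith
end

section
/- For every positive integer k there exists N₀ = N₀(k) such that the following holds: for every red–blue colouring of ℤ containing no (2,k)-AP and every integer d ≥ 1 such that [0, d] is a gap, if ℓ, m ≥ N₀ are integers with −ℓd and md both red, then d[−ℓ, m] is an extendable table. -/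
/-- The set `d[−ℓ, m] = {dn : −ℓ ≤ n ≤ m}` is a table with respect to `k`: `−ℓd` and `md`
are both red, and every gap `n₁ < n₂` of `d[−ℓ, m]` (i.e. `dn₁, dn₂` red and `dn` blue
for `n₁ < n < n₂`) satisfies `n₂ − n₁ ≤ (m + ℓ)/(k+1)`. -/
def IsTable (R : Set ℤ) (k : ℕ) (d ℓ m : ℤ) : Prop :=
  (-ℓ * d ∈ R) ∧ (m * d ∈ R) ∧
  ∀ n₁ n₂ : ℤ, -ℓ ≤ n₁ → n₁ < n₂ → n₂ ≤ m →
    n₁ * d ∈ R → n₂ * d ∈ R → (∀ n : ℤ, n₁ < n → n < n₂ → n * d ∉ R) →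
    ((n₂ - n₁ : ℚ) ≤ (m + ℓ) / (k + 1))

/-- A table `d[−ℓ, m]` is extendable if for all `ℓ' ≥ ℓ` and `m' ≥ m` with `−ℓ'd` and
`m'd` both red, `d[−ℓ', m']` is also a table. -/
def ExtendableTable (R : Set ℤ) (k : ℕ) (d ℓ m : ℤ) : Prop :=
  IsTable R k d ℓ m ∧
  ∀ ℓ' m' : ℤ, ℓ ≤ ℓ' → m ≤ m' → -ℓ' * d ∈ R → m' * d ∈ R → IsTable R k d ℓ' m'


/-- Closure form of having no `(2,k)`-AP. -/
def Clos (S : Set ℤ) (k : ℕ) : Prop :=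
  ∀ x y : ℤ, x ∈ S → y ∈ S → x ≠ y → ∃ j : ℤ, 1 ≤ j ∧ j ≤ k ∧ y + j * (y - x) ∈ S

theorem clos_of_noAP (R : Set ℤ) (k : ℕ) (h : ¬ HasAPZ R 2 k) : Clos R k := by
  intro x y hx hy hxy
  by_contra hc
  push Not at hc
  apply h
  refine ⟨x, y - x, by omega, ?_, ?_⟩
  · intro i hi
    interval_cases i
    · simpa using hx
    · simpa using hy
  · intro i h1 h2 h3
    apply hc ((i : ℤ) - 1) (by omega) (by omega)
    convert h3 using 1
    ring

/-- Bound on the number of red elements in the windows. -/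
def fbound (k : ℕ) : ℕ → ℕ
  | 0 => 0
  | n + 1 => (k + 1) * fbound k n + 1

open Classical in
theorem window_card (S : Set ℤ) (k : ℕ) (H : Clos S k) (u v : ℤ)
    (hblue : ∀ n : ℤ, u < n → n < v → n ∉ S) (i : ℕ) :
    ((Finset.Icc 0 u).filter (fun z => z ∈ S ∧ k * (u - z) < i * (v - u))).card ≤ fbound k i := by
  induction i with
  | zero =>
    rw [fbound, Nat.le_zero, Finset.card_eq_zero, Finset.filter_eq_empty_iff]
    rintro z hz ⟨_, h⟩
    rw [Finset.mem_Icc] at hz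
    have : (0 : ℤ) ≤ k * (u - z) := mul_nonneg (by positivity) (by omega)
    push_cast at h
    linarith
  | succ i ih =>
    set A := (Finset.Icc 0 u).filter (fun z => z ∈ S ∧ k * (u - z) < i * (v - u)) with hA
    set B := (Finset.Icc 0 u).filter
      (fun z => z ∈ S ∧ k * (u - z) < ((i + 1 : ℕ) : ℤ) * (v - u)) with hB
    have hBA : B.card ≤ A.card + (B \ A).card := by
      have := Finset.card_le_card (show B ⊆ A ∪ (B \ A) by
        intro z hz; by_cases h : z ∈ A <;> simp [h, hz])
      exact this.trans (Finset.card_union_le _ _)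
    have hD : (B \ A).card ≤ k * A.card + 1 := by
      rcases (B \ A).eq_empty_or_nonempty with h0 | hne
      · simp [h0]
      set y := (B \ A).max' hne with hy
      have hyD : y ∈ B \ A := Finset.max'_mem _ _
      have hsub : B \ A ⊆ insert y (((Finset.Icc (1 : ℤ) k) ×ˢ A).image
          (fun p => y - (p.2 - y) / p.1)) := by
        intro x hx
        by_cases hxy : x = y
        · simp [hxy]
        have hxle : x ≤ y := Finset.le_max' _ _ hx
        have hlt : x < y := lt_of_le_of_ne hxle hxy
        rw [Finset.mem_sdiff, hA, hB, Finset.mem_filter, Finset.mem_filter, Finset.mem_Icc] at hx hyD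
        obtain ⟨⟨hx0, hxS, hx1⟩, hx2⟩ := hx
        obtain ⟨⟨hy0, hyS, hy1⟩, hy2⟩ := hyD
        have hy3 : (i : ℤ) * (v - u) ≤ k * (u - y) := by
          by_contra hc
          exact hy2 ⟨hy0, hyS, by linarith⟩
        obtain ⟨j, hj1, hjk, hjS⟩ := H x y hxS hyS hxy
        push_cast at hx1 hy1
        have hjle : j * (y - x) ≤ k * (y - x) :=
          mul_le_mul_of_nonneg_right hjk (by omega)
        have hjpos : 0 < j * (y - x) := mul_pos (by omega) (by omega)
        have hzv : y + j * (y - x) < v := by nlinarith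
        have hzu : y + j * (y - x) ≤ u := by
          by_contra hc
          exact hblue _ (by omega) hzv hjS
        have hzB : y + j * (y - x) ∈ B := by
          rw [hB, Finset.mem_filter, Finset.mem_Icc]
          refine ⟨⟨by omega, hzu⟩, hjS, ?_⟩
          push_cast
          have : (0 : ℤ) ≤ k * (j * (y - x)) := mul_nonneg (by positivity) hjpos.le
          nlinarith
        have hzA : y + j * (y - x) ∈ A := by
          by_contra hc
          have := Finset.le_max' (B \ A) _ (Finset.mem_sdiff.2 ⟨hzB, hc⟩)
          rw [← hy] at this
          omega
        refine Finset.mem_insert_of_mem (Finset.mem_image.2 ⟨(j, y + j * (y - x)), ?_, ?_⟩)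
        · exact Finset.mem_product.2 ⟨Finset.mem_Icc.2 ⟨hj1, hjk⟩, hzA⟩
        · have : (y + j * (y - x) - y) / j = y - x := by
            rw [add_sub_cancel_left]
            exact Int.mul_ediv_cancel_left _ (by omega)
          simp only [this]
          ring
      have h1 := Finset.card_le_card hsub
      have h2 := Finset.card_insert_le y (((Finset.Icc (1 : ℤ) k) ×ˢ A).image
          (fun p => y - (p.2 - y) / p.1))
      have h3 : (((Finset.Icc (1 : ℤ) k) ×ˢ A).image
          (fun p => y - (p.2 - y) / p.1)).card ≤ k * A.card := by
        refine Finset.card_image_le.trans ?_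
        rw [Finset.card_product, Int.card_Icc]
        simp
      omega
    rw [fbound]
    have := Nat.mul_le_mul_left (k + 1) ih
    nlinarith

open Classical in
theorem many_red (S : Set ℤ) (k : ℕ) (H : Clos S k) (h0 : (0 : ℤ) ∈ S) (h1 : (1 : ℤ) ∈ S) (n : ℕ) :
    ∃ y : ℤ, y ∈ S ∧ 1 ≤ y ∧ y ≤ ((k : ℤ) + 1) ^ n ∧
      n + 1 ≤ ((Finset.Icc 0 y).filter (fun z => z ∈ S)).card := by
  induction n with
  | zero =>
    refine ⟨1, h1, le_rfl, by simp, ?_⟩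
    exact Finset.card_pos.2 ⟨1, by simp [h1]⟩
  | succ n ih =>
    obtain ⟨y, hyS, hy1, hyk, hc⟩ := ih
    obtain ⟨j, hj1, hjk, hjS⟩ := H 0 y h0 hyS (by omega)
    rw [sub_zero] at hjS
    have hjy : 0 < j * y := mul_pos (by omega) (by omega)
    have hjle : j * y ≤ k * y := mul_le_mul_of_nonneg_right hjk (by omega)
    refine ⟨y + j * y, hjS, by omega, ?_, ?_⟩
    · rw [pow_succ]
      have := mul_le_mul_of_nonneg_right hyk (show (0 : ℤ) ≤ (k : ℤ) + 1 by positivity)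
      nlinarith
    · have hss : (Finset.Icc 0 y).filter (fun z => z ∈ S) ⊂
          (Finset.Icc 0 (y + j * y)).filter (fun z => z ∈ S) := by
        rw [Finset.ssubset_iff]
        refine ⟨y + j * y, ?_, ?_⟩
        · simp only [Finset.mem_filter, Finset.mem_Icc]
          omega
        · intro z hz
          simp only [Finset.mem_insert, Finset.mem_filter, Finset.mem_Icc] at hz ⊢
          rcases hz with rfl | ⟨hz, hzS⟩
          · exact ⟨by omega, hjS⟩
          · exact ⟨by omega, hzS⟩
      have := Finset.card_lt_card hss
      omega

/-- Uniform bound constant. -/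
def Nbound (k : ℕ) : ℕ := (k + 1) * (k * (k + 1) ^ fbound k (k * k + 1))

theorem pos_gap (S : Set ℤ) (k : ℕ) (hk : 0 < k) (H : Clos S k) (h0 : (0 : ℤ) ∈ S)
    (h1 : (1 : ℤ) ∈ S) (u v : ℤ) (hu : 1 ≤ u) (huv : u < v) (huS : u ∈ S)
    (hblue : ∀ n : ℤ, u < n → n < v → n ∉ S) :
    ((k : ℤ) + 1) * (v - u) ≤ v + Nbound k := by
  classical
  have hkz : (1 : ℤ) ≤ k := by exact_mod_cast hk
  rcases lt_or_ge u (((k : ℤ) + 1) ^ fbound k (k * k + 1)) with hlt | hge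
  · have hg : v - u ≤ k * u := by
      obtain ⟨j, hj1, hjk, hjS⟩ := H 0 u h0 huS (by omega)
      rw [sub_zero] at hjS
      have hjy : 0 < j * u := mul_pos (by omega) (by omega)
      have hjle : j * u ≤ k * u := mul_le_mul_of_nonneg_right hjk (by omega)
      by_contra hc
      exact hblue _ (by omega) (by omega) hjS
    have h2 : (k : ℤ) * u ≤ k * ((k : ℤ) + 1) ^ fbound k (k * k + 1) :=
      mul_le_mul_of_nonneg_left hlt.le (by omega)
    have h3 := mul_le_mul_of_nonneg_left (hg.trans h2) (show (0 : ℤ) ≤ (k : ℤ) + 1 by omega)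
    rw [Nbound]
    push_cast
    linarith
  · suffices h : (k : ℤ) * (v - u) ≤ u by
      have : (0 : ℤ) ≤ Nbound k := by positivity
      linarith
    by_contra hc
    push Not at hc
    obtain ⟨y, hyS, hy1, hyk, hcard⟩ := many_red S k H h0 h1 (fbound k (k * k + 1))
    have hw := window_card S k H u v hblue (k * k + 1)
    have hsub : (Finset.Icc 0 y).filter (fun z => z ∈ S) ⊆ (Finset.Icc 0 u).filter
        (fun z => z ∈ S ∧ k * (u - z) < ((k * k + 1 : ℕ) : ℤ) * (v - u)) := by
      intro z hz
      simp only [Finset.mem_filter, Finset.mem_Icc] at hz ⊢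
      refine ⟨by omega, hz.2, ?_⟩
      push_cast
      have e1 : (k : ℤ) * (u - z) ≤ k * u := mul_le_mul_of_nonneg_left (by omega) (by omega)
      have e2 : (k : ℤ) * u ≤ k * (k * (v - u)) := mul_le_mul_of_nonneg_left hc.le (by omega)
      nlinarith
    have := Finset.card_le_card hsub
    omega

theorem all_gap (S : Set ℤ) (k : ℕ) (hk : 0 < k) (H : Clos S k) (h0 : (0 : ℤ) ∈ S)
    (h1 : (1 : ℤ) ∈ S) (ℓ m u v : ℤ) (hl : ((Nbound k + k + 1 : ℕ) : ℤ) ≤ ℓ)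
    (hm : ((Nbound k + k + 1 : ℕ) : ℤ) ≤ m) (hlu : -ℓ ≤ u) (huv : u < v) (hvm : v ≤ m)
    (huS : u ∈ S) (hvS : v ∈ S) (hblue : ∀ n : ℤ, u < n → n < v → n ∉ S) :
    ((k : ℤ) + 1) * (v - u) ≤ m + ℓ := by
  push_cast at hl hm
  have hN : (0 : ℤ) ≤ Nbound k := by positivity
  rcases le_or_gt 1 u with hu | hu
  · have := pos_gap S k hk H h0 h1 u v hu huv huS hblue
    omega
  rcases le_or_gt v 0 with hv | hv
  · have H' : Clos {n | 1 - n ∈ S} k := by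
      intro x y hx hy hxy
      obtain ⟨j, hj1, hjk, hjS⟩ := H (1 - x) (1 - y) hx hy (by omega)
      refine ⟨j, hj1, hjk, ?_⟩
      rw [Set.mem_ofPred_eq]
      convert hjS using 1
      ring
    have := pos_gap {n | 1 - n ∈ S} k hk H' (by simpa using h1) (by simpa using h0)
      (1 - v) (1 - u) (by omega) (by omega) (by simpa using hvS)
      (fun n ha hb hc => hblue (1 - n) (by omega) (by omega) hc)
    have e : (1 - u) - (1 - v) = v - u := by ring
    rw [e] at this
    omega
  · have hu0 : u = 0 := by
      by_contra hne
      exact hblue 0 (by omega) hv h0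
    have hv1 : v = 1 := by
      by_contra hne
      exact hblue 1 (by omega) (by omega) h1
    subst hu0 hv1
    omega

theorem statement10 (k : ℕ) (hk : 0 < k) :
    ∃ N₀ : ℕ, ∀ R : Set ℤ, ¬ HasAPZ R 2 k →
      ∀ d : ℤ, 1 ≤ d → IsGap R 0 d →
        ∀ ℓ m : ℤ, (N₀ : ℤ) ≤ ℓ → (N₀ : ℤ) ≤ m →
          -ℓ * d ∈ R → m * d ∈ R → ExtendableTable R k d ℓ m := by
  refine ⟨Nbound k + k + 1, ?_⟩
  intro R hR d hd hgap ℓ m hl hm hlR hmR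
  have HR := clos_of_noAP R k hR
  have H : Clos {n : ℤ | n * d ∈ R} k := by
    intro x y hx hy hxy
    obtain ⟨j, hj1, hjk, hjS⟩ := HR (x * d) (y * d) hx hy (by
      intro h
      exact hxy (mul_right_cancel₀ (by omega) h))
    refine ⟨j, hj1, hjk, ?_⟩
    rw [Set.mem_ofPred_eq]
    convert hjS using 1
    ring
  have key : ∀ ℓ' m' : ℤ, ℓ ≤ ℓ' → m ≤ m' → -ℓ' * d ∈ R → m' * d ∈ R →
      IsTable R k d ℓ' m' := by
    intro ℓ' m' hl' hm' hlR' hmR'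
    refine ⟨hlR', hmR', ?_⟩
    intro u v hlu huv hvm huR hvR hblue
    have := all_gap {n : ℤ | n * d ∈ R} k hk H (by simpa using hgap.2.1)
      (by simpa using hgap.2.2.1) ℓ' m' u v (hl.trans hl') (hm.trans hm') hlu huv hvm huR hvR hblue
    rw [le_div_iff₀ (by positivity)]
    have h2 : (((k : ℤ) + 1) * (v - u) : ℚ) ≤ m' + ℓ' := by exact_mod_cast this
    push_cast at h2
    linarith
  exact ⟨key ℓ m le_rfl le_rfl hlR hmR, key⟩
end
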